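/- Let n ≥ 2, T > 0 and 0 < ε < π. For every finitely supported family of complex numbers (v_p)_{p ∈ (ℕ*)^n} define v(x,t) = Σ_p v_p e^{−i|p|²t} ∏_{j=1}^n sin(p_j x_j) for x ∈ [0,π]^n and t ∈ [0,T], where |p|² = p₁²+⋯+p_n². Then there exists a constant c > 0, depending only on n, T and ε, such that for every such finitely supported family: Σ_p |p|² |v_p|² ≤ c · Σ_{j=1}^n Σ_{σ ∈ {0,π}} ∫₀^T ∫_{G_{j,σ}} |∂v/∂x_j(x,t)|² dx' dt, where for each j ∈ {1,…,n} and σ ∈ {0,π} the inner integral is taken over the set G_{j,σ} = { x' ∈ (0,π)^{n−1} : σ + Σ_{i} x'_i > nπ − ε } of the remaining n−1 coordinates, and ∂v/∂x_j is evaluated at the boundary point of the cube whose j-th coordinate equals σ and whose other coordinates are x'. -/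

import Mathlib

open MeasureTheory

/-- `|p|² = p₁² + ⋯ + p_n²` for a tuple of positive integers. -/
noncomputable def pnorm2 {n : ℕ} (p : Fin n → ℕ+) : ℝ := ∑ j, ((p j : ℝ)) ^ 2

/-- The explicit solution `v(x,t) = Σ_p v_p e^{−i|p|²t} ∏_j sin(p_j x_j)` of the
linear Schrödinger equation with Dirichlet boundary conditions. -/
noncomputable def solV {n : ℕ} (v : (Fin n → ℕ+) →₀ ℂ) (x : Fin n → ℝ) (t : ℝ) : ℂ :=
  v.sum fun p c =>
    c * Complex.exp (-Complex.I * (pnorm2 p : ℂ) * (t : ℂ)) *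
      ∏ i, (Real.sin ((p i : ℝ) * x i) : ℂ)

/-- The partial derivative `∂v/∂x_j` of the explicit solution above:
`Σ_p v_p e^{−i|p|²t} p_j cos(p_j x_j) ∏_{i ≠ j} sin(p_i x_i)`. -/
noncomputable def dV {n : ℕ} (v : (Fin n → ℕ+) →₀ ℂ) (j : Fin n)
    (x : Fin n → ℝ) (t : ℝ) : ℂ :=
  v.sum fun p c =>
    c * Complex.exp (-Complex.I * (pnorm2 p : ℂ) * (t : ℂ)) *
      ((p j : ℝ) : ℂ) * (Real.cos ((p j : ℝ) * x j) : ℂ) *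
      ∏ i ∈ Finset.univ.erase j, (Real.sin ((p i : ℝ) * x i) : ℂ)

section Observability

open scoped ComplexConjugate

/-- The character `y ↦ exp(i k·y)` with integer frequency vector `k`. -/
noncomputable def expo {ι : Type*} [Fintype ι] (k : ι → ℤ) (y : ι → ℝ) : ℂ :=
  Complex.exp (Complex.I * ∑ i, (k i : ℂ) * (y i : ℂ))

section Characters

variable {ι : Type*} [Fintype ι]

lemma expo_eq_prod (k : ι → ℤ) (y : ι → ℝ) :
    expo k y = ∏ i, Complex.exp (Complex.I * ((k i : ℂ) * (y i : ℂ))) := by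
  rw [expo, Finset.mul_sum, Complex.exp_sum]

lemma continuous_expo (k : ι → ℤ) : Continuous (expo k) := by
  unfold expo; fun_prop

lemma expo_eq_exp_ofReal (k : ι → ℤ) (y : ι → ℝ) :
    expo k y = Complex.exp (((∑ i, (k i : ℝ) * y i : ℝ) : ℂ) * Complex.I) := by
  rw [expo]; push_cast; rw [mul_comm]

lemma norm_expo (k : ι → ℤ) (y : ι → ℝ) : ‖expo k y‖ = 1 := by
  rw [expo_eq_exp_ofReal, Complex.norm_exp_ofReal_mul_I]

lemma expo_add_right (k : ι → ℤ) (y s : ι → ℝ) : expo k (y + s) = expo k y * expo k s := by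
  simp only [expo, ← Complex.exp_add, ← mul_add, ← Finset.sum_add_distrib, Pi.add_apply]
  push_cast; rfl

lemma expo_mul_conj (k l : ι → ℤ) (y : ι → ℝ) :
    expo k y * conj (expo l y) = expo (k - l) y := by
  simp only [expo, ← Complex.exp_conj, ← Complex.exp_add, map_mul, map_sum, Complex.conj_I,
    Complex.conj_ofReal, map_intCast, Pi.sub_apply]
  congr 1
  push_cast
  simp only [sub_mul, Finset.sum_sub_distrib]
  ring

end Characters

/-- The cube `[-r, r]^ι`. -/
def cube (ι : Type*) (r : ℝ) : Set (ι → ℝ) := Set.Icc (fun _ => -r) (fun _ => r)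

lemma isCompact_cube (ι : Type*) (r : ℝ) : IsCompact (cube ι r) :=
  isCompact_Icc

lemma measurableSet_cube (ι : Type*) [Fintype ι] (r : ℝ) : MeasurableSet (cube ι r) :=
  measurableSet_Icc

lemma integral_weighted_norm_sq_sum {α κ : Type*} [MeasurableSpace α] (μ : Measure α)
    (F : Finset κ) (w : α → ℝ) (Φ : κ → α → ℂ)
    (h : ∀ k l, Integrable (fun x => (w x : ℂ) * (Φ k x * conj (Φ l x))) μ) (a : κ → ℂ) :
    ((∫ x, w x * ‖∑ k ∈ F, a k * Φ k x‖ ^ 2 ∂μ : ℝ) : ℂ) =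
      ∑ k ∈ F, ∑ l ∈ F, a k * conj (a l) * ∫ x, (w x : ℂ) * (Φ k x * conj (Φ l x)) ∂μ := by
  rw [← integral_complex_ofReal]
  have : ∀ x, ((w x * ‖∑ k ∈ F, a k * Φ k x‖ ^ 2 : ℝ) : ℂ) =
      ∑ k ∈ F, ∑ l ∈ F, a k * conj (a l) * ((w x : ℂ) * (Φ k x * conj (Φ l x))) := by
    intro x
    push_cast
    rw [← Complex.mul_conj', map_sum, Finset.sum_mul_sum, Finset.mul_sum]
    refine Finset.sum_congr rfl fun k _ => ?_
    rw [Finset.mul_sum]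
    refine Finset.sum_congr rfl fun l _ => ?_
    rw [map_mul]; ring
  simp_rw [this]
  rw [integral_finsetSum _ fun k _ => integrable_finsetSum _ fun l _ => (h k l).const_mul _]
  refine Finset.sum_congr rfl fun k _ => ?_
  rw [integral_finsetSum _ fun l _ => (h k l).const_mul _]
  refine Finset.sum_congr rfl fun l _ => ?_
  rw [integral_const_mul]

lemma integral_norm_sq_sum_of_orthogonal {α κ : Type*} [MeasurableSpace α] (μ : Measure α)
    (F : Finset κ) (Φ : κ → α → ℂ)
    (h : ∀ k l, Integrable (fun x => Φ k x * conj (Φ l x)) μ)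
    (horth : ∀ k ∈ F, ∀ l ∈ F, k ≠ l → ∫ x, Φ k x * conj (Φ l x) ∂μ = 0) (a : κ → ℂ) :
    ∫ x, ‖∑ k ∈ F, a k * Φ k x‖ ^ 2 ∂μ = ∑ k ∈ F, ‖a k‖ ^ 2 * ∫ x, ‖Φ k x‖ ^ 2 ∂μ := by
  have key := integral_weighted_norm_sq_sum μ F (fun _ => 1) Φ (by simpa using h) a
  simp only [one_mul, Complex.ofReal_one] at key
  apply Complex.ofReal_injective
  rw [key]
  push_cast
  refine Finset.sum_congr rfl fun k hk => ?_
  rw [Finset.sum_eq_single k]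
  · rw [Complex.mul_conj', ← integral_complex_ofReal]
    congr 2
    ext x
    rw [Complex.mul_conj']; push_cast; rfl
  · intro l hl hlk
    rw [horth k hk l hl hlk.symm, mul_zero]
  · exact fun h => (h hk).elim

/-- Integration of a product of one-variable functions over a cube. -/
lemma setIntegral_pi_prod {ι : Type*} [Fintype ι] (s : ι → Set ℝ)
    (f : ι → ℝ → ℂ) :
    ∫ y in Set.univ.pi s, ∏ i, f i (y i) = ∏ i, ∫ t in s i, f i t := by
  rw [volume_pi, Measure.restrict_pi_pi, integral_fintype_prod_eq_prod]

lemma setIntegral_cube_prod {ι : Type*} [Fintype ι] (r : ℝ) (f : ι → ℝ → ℂ) :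
    ∫ y in cube ι r, ∏ i, f i (y i) = ∏ i, ∫ t in Set.Icc (-r) r, f i t := by
  rw [cube, ← Set.pi_univ_Icc, setIntegral_pi_prod]

lemma integral_exp_int_period {m : ℤ} (hm : m ≠ 0) :
    ∫ t in Set.Icc (-Real.pi) Real.pi, Complex.exp (Complex.I * ((m : ℂ) * (t : ℂ))) = 0 := by
  rw [integral_Icc_eq_integral_Ioc, ← intervalIntegral.integral_of_le (by linarith [Real.pi_pos])]
  have hc : Complex.I * (m : ℂ) ≠ 0 := by simp [hm]
  have := integral_exp_mul_complex (a := -Real.pi) (b := Real.pi) hc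
  simp only [mul_assoc] at this
  rw [this, div_eq_zero_iff]
  left
  rw [sub_eq_zero, Complex.exp_eq_exp_iff_exists_int]
  refine ⟨m, ?_⟩
  push_cast; ring

lemma setIntegral_expo_period {ι : Type*} [Fintype ι] {k : ι → ℤ} (hk : k ≠ 0) :
    ∫ y in cube ι Real.pi, expo k y = 0 := by
  simp_rw [expo_eq_prod]
  rw [setIntegral_cube_prod Real.pi fun i t => Complex.exp (Complex.I * ((k i : ℂ) * (t : ℂ)))]
  obtain ⟨i, hi⟩ := Function.ne_iff.1 hk
  exact Finset.prod_eq_zero (Finset.mem_univ i) (integral_exp_int_period hi)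

lemma volume_real_cube (ι : Type*) [Fintype ι] {r : ℝ} (hr : 0 ≤ r) :
    volume.real (cube ι r) = (2 * r) ^ Fintype.card ι := by
  rw [Measure.real, cube, Real.volume_Icc_pi_toReal (fun _ => by linarith)]
  simp [two_mul]

/-- Upper bound for trigonometric polynomials with integer frequencies on a period. -/
lemma integral_norm_sq_expo_le {ι : Type*} [Fintype ι] {s : Set (ι → ℝ)}
    (hs : s ⊆ cube ι Real.pi) (F : Finset (ι → ℤ)) (a : (ι → ℤ) → ℂ) :
    ∫ y in s, ‖∑ k ∈ F, a k * expo k y‖ ^ 2 ≤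
      (2 * Real.pi) ^ Fintype.card ι * ∑ k ∈ F, ‖a k‖ ^ 2 := by
  have hcont : Continuous fun y : ι → ℝ => ‖∑ k ∈ F, a k * expo k y‖ ^ 2 := by
    have := fun k : ι → ℤ => continuous_expo k
    fun_prop
  calc _ ≤ ∫ y in cube ι Real.pi, ‖∑ k ∈ F, a k * expo k y‖ ^ 2 :=
        setIntegral_mono_set (hcont.continuousOn.integrableOn_compact (isCompact_cube ι _))
          (Filter.Eventually.of_forall fun _ => by positivity) hs.eventuallyLE
    _ = ∑ k ∈ F, ‖a k‖ ^ 2 * ∫ y in cube ι Real.pi, ‖expo k y‖ ^ 2 := by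
        refine integral_norm_sq_sum_of_orthogonal _ F expo (fun k l => ?_) ?_ a
        · simp_rw [expo_mul_conj]
          exact (continuous_expo _).continuousOn.integrableOn_compact (isCompact_cube ι _)
        · intro k _ l _ hkl
          simp_rw [expo_mul_conj]
          exact setIntegral_expo_period (sub_ne_zero.2 hkl)
    _ = _ := by
        simp only [norm_expo, one_pow, setIntegral_const, smul_eq_mul, mul_one,
          volume_real_cube ι Real.pi_pos.le]
        rw [Finset.mul_sum]
        exact Finset.sum_congr rfl fun _ _ => mul_comm _ _

/-- `Λ` satisfies the lower Ingham-type bound with constant `c` on the cube `[-r, r]^ι`. -/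
def Observable {ι : Type*} [Fintype ι] (Λ : Set (ι → ℤ)) (r c : ℝ) : Prop :=
  ∀ F : Finset (ι → ℤ), (↑F : Set (ι → ℤ)) ⊆ Λ → ∀ a : (ι → ℤ) → ℂ,
    c * ∑ k ∈ F, ‖a k‖ ^ 2 ≤ ∫ y in cube ι r, ‖∑ k ∈ F, a k * expo k y‖ ^ 2

lemma norm_one_sub_exp_sq (x : ℝ) :
    ‖1 - Complex.exp (Complex.I * (x : ℂ))‖ ^ 2 = 2 - 2 * Real.cos x := by
  rw [mul_comm, ← Complex.normSq_eq_norm_sq, Complex.normSq_apply, Complex.sub_re,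
    Complex.sub_im, Complex.exp_ofReal_mul_I_re, Complex.exp_ofReal_mul_I_im, Complex.one_re,
    Complex.one_im]
  nlinarith [Real.sin_sq_add_cos_sq x]

lemma exists_pos_le_integral_one_sub_exp {δ : ℝ} (hδ : 0 < δ) :
    ∃ η : ℝ, 0 < η ∧ ∀ m : ℤ, m ≠ 0 →
      η ≤ ∫ s in (0 : ℝ)..δ, ‖1 - Complex.exp (Complex.I * (((m : ℝ) * s : ℝ) : ℂ))‖ ^ 2 := by
  have hπ := Real.pi_pos
  refine ⟨min δ (4 / (3 * Real.pi ^ 2) * δ ^ 3), by positivity, fun m hm => ?_⟩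
  simp_rw [norm_one_sub_exp_sq]
  have hm1 : (1 : ℝ) ≤ |(m : ℝ)| := by exact_mod_cast Int.one_le_abs hm
  have hm0 : (m : ℝ) ≠ 0 := by exact_mod_cast hm
  rcases le_or_gt (|(m : ℝ)| * δ) Real.pi with h | h
  · refine (min_le_right _ _).trans ?_
    have : ∫ s in (0 : ℝ)..δ, 4 / Real.pi ^ 2 * s ^ 2 = 4 / (3 * Real.pi ^ 2) * δ ^ 3 := by
      rw [intervalIntegral.integral_const_mul, integral_pow]
      ring
    rw [← this]
    apply intervalIntegral.integral_mono_on hδ.le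
    · exact Continuous.intervalIntegrable (by fun_prop) _ _
    · exact Continuous.intervalIntegrable (by fun_prop) _ _
    · intro s hs
      have hms : |(m : ℝ) * s| ≤ Real.pi := by
        rw [abs_mul, abs_of_nonneg hs.1]
        exact (mul_le_mul_of_nonneg_left hs.2 (abs_nonneg _)).trans h
      have h1 := Real.cos_le_one_sub_mul_cos_sq hms
      have h2 : s ^ 2 ≤ ((m : ℝ) * s) ^ 2 := by
        rw [mul_pow]
        have : 1 ≤ (m : ℝ) ^ 2 := by rw [← sq_abs]; nlinarith
        nlinarith [sq_nonneg s]
      have h3 : 2 / Real.pi ^ 2 * s ^ 2 ≤ 2 / Real.pi ^ 2 * ((m : ℝ) * s) ^ 2 := by gcongr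
      have h4 : 4 / Real.pi ^ 2 * s ^ 2 = 2 * (2 / Real.pi ^ 2 * s ^ 2) := by ring
      linarith
  · refine (min_le_left _ _).trans ?_
    have : ∫ s in (0 : ℝ)..δ, (2 - 2 * Real.cos ((m : ℝ) * s)) =
        2 * δ - 2 * (Real.sin (m * δ) / m) := by
      rw [intervalIntegral.integral_sub (by simp)
        (Continuous.intervalIntegrable (by fun_prop) _ _), intervalIntegral.integral_const_mul,
        intervalIntegral.integral_comp_mul_left (fun x => Real.cos x) hm0, integral_cos]
      simp
      ring
    rw [this]
    have h1 : Real.sin (m * δ) / m ≤ 1 / |(m : ℝ)| := by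
      refine (le_abs_self _).trans ?_
      rw [abs_div]
      gcongr
      exact Real.abs_sin_le_one _
    have h2 : 1 / |(m : ℝ)| ≤ δ / 2 := by
      rw [div_le_div_iff₀ (by linarith) (by norm_num)]
      nlinarith [Real.pi_gt_three]
    linarith

/-- Averaging over shifts: if the weighted sum of `‖1 - exp(i mₖ s)‖²` is bounded uniformly for
`s ∈ [0, δ]`, then so is the sum of the weights over the nonzero frequencies `mₖ`. -/
lemma sum_filter_le_of_shift_bound {κ : Type*} {δ η : ℝ} (hδ : 0 < δ)
    (hη : ∀ m : ℤ, m ≠ 0 →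
      η ≤ ∫ s in (0 : ℝ)..δ, ‖1 - Complex.exp (Complex.I * (((m : ℝ) * s : ℝ) : ℂ))‖ ^ 2)
    (F : Finset κ) (w : κ → ℝ) (hw : ∀ k, 0 ≤ w k) (m : κ → ℤ) (B : ℝ)
    (h : ∀ s ∈ Set.Icc (0 : ℝ) δ,
      ∑ k ∈ F, w k * ‖1 - Complex.exp (Complex.I * (((m k : ℝ) * s : ℝ) : ℂ))‖ ^ 2 ≤ B) :
    η * ∑ k ∈ F with m k ≠ 0, w k ≤ δ * B := by
  have h_int : ∀ k, IntervalIntegrable (fun s : ℝ => w k *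
      ‖1 - Complex.exp (Complex.I * (((m k : ℝ) * s : ℝ) : ℂ))‖ ^ 2) volume 0 δ := fun k =>
    Continuous.intervalIntegrable (by fun_prop) _ _
  calc η * ∑ k ∈ F with m k ≠ 0, w k
      = ∑ k ∈ F with m k ≠ 0, w k * η := by rw [Finset.mul_sum]; simp_rw [mul_comm]
    _ ≤ ∑ k ∈ F with m k ≠ 0, w k *
        ∫ s in (0 : ℝ)..δ, ‖1 - Complex.exp (Complex.I * (((m k : ℝ) * s : ℝ) : ℂ))‖ ^ 2 :=
        Finset.sum_le_sum fun k hk =>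
          mul_le_mul_of_nonneg_left (hη _ (Finset.mem_filter.1 hk).2) (hw k)
    _ ≤ ∑ k ∈ F, w k *
        ∫ s in (0 : ℝ)..δ, ‖1 - Complex.exp (Complex.I * (((m k : ℝ) * s : ℝ) : ℂ))‖ ^ 2 :=
        Finset.sum_le_sum_of_subset_of_nonneg (Finset.filter_subset _ _) fun k _ _ =>
          mul_nonneg (hw k) (intervalIntegral.integral_nonneg hδ.le fun _ _ => by positivity)
    _ = ∫ s in (0 : ℝ)..δ, ∑ k ∈ F, w k *
          ‖1 - Complex.exp (Complex.I * (((m k : ℝ) * s : ℝ) : ℂ))‖ ^ 2 := by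
        rw [intervalIntegral.integral_finsetSum fun k _ => h_int k]
        simp_rw [intervalIntegral.integral_const_mul]
    _ ≤ ∫ s in (0 : ℝ)..δ, B := by
        apply intervalIntegral.integral_mono_on hδ.le _ (by simp) h
        exact Continuous.intervalIntegrable (by fun_prop) _ _
    _ = δ * B := by simp

lemma norm_sub_sq_le_two {E : Type*} [SeminormedAddCommGroup E] (x y : E) :
    ‖x - y‖ ^ 2 ≤ 2 * ‖x‖ ^ 2 + 2 * ‖y‖ ^ 2 := by
  have := norm_sub_le x y
  nlinarith [norm_nonneg (x - y), sq_nonneg (‖x‖ - ‖y‖), norm_nonneg x, norm_nonneg y]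

lemma cube_mono {ι : Type*} {r r' : ℝ} (h : r' ≤ r) : cube ι r' ⊆ cube ι r :=
  Set.Icc_subset_Icc (fun _ => neg_le_neg h) fun _ => h

section Haraux

variable {ι : Type*} [Fintype ι]

lemma continuous_trigSum (F : Finset (ι → ℤ)) (a : (ι → ℤ) → ℂ) :
    Continuous fun y : ι → ℝ => ∑ k ∈ F, a k * expo k y := by
  have := fun k : ι → ℤ => continuous_expo k
  fun_prop

lemma setIntegral_cube_shift_le {r r' : ℝ} (f : (ι → ℝ) → ℝ) (hf : Continuous f)
    (hf0 : ∀ y, 0 ≤ f y) (s : ι → ℝ) (hs : ∀ i, |s i| ≤ r - r') :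
    ∫ y in cube ι r', f (y + s) ≤ ∫ y in cube ι r, f y := by
  rw [← (measurePreserving_add_right volume s).setIntegral_preimage_emb
    (measurableEmbedding_addRight s) f (cube ι r)]
  refine setIntegral_mono_set ?_ (Filter.Eventually.of_forall fun _ => hf0 _)
    (LE.le.eventuallyLE ?_)
  · exact (MeasurePreserving.integrableOn_comp_preimage
      (measurePreserving_add_right volume s) (measurableEmbedding_addRight s)).2
      (hf.continuousOn.integrableOn_compact (isCompact_cube ι r))
  · intro y hy
    constructor <;> intro i <;>
    · have h1 := hy.1 i
      have h2 := hy.2 i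
      have h3 := abs_le.1 (hs i)
      simp only [Pi.add_apply]
      simp only at h1 h2
      linarith [h3.1, h3.2]

lemma integrableOn_cube_norm_sq {g : (ι → ℝ) → ℂ} (hg : Continuous g) (r : ℝ) :
    IntegrableOn (fun y => ‖g y‖ ^ 2) (cube ι r) :=
  ((hg.norm.pow 2).continuousOn).integrableOn_compact (isCompact_cube ι r)

lemma integral_norm_sq_sub_shift_le {r r' : ℝ} (hrr' : r' ≤ r) {f : (ι → ℝ) → ℂ}
    (hf : Continuous f) (z : ℂ) (hz : ‖z‖ = 1) (s : ι → ℝ) (hs : ∀ i, |s i| ≤ r - r') :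
    ∫ y in cube ι r', ‖f y - z * f (y + s)‖ ^ 2 ≤ 4 * ∫ y in cube ι r, ‖f y‖ ^ 2 := by
  have hfs : Continuous fun y => f (y + s) := by fun_prop
  have hzf : Continuous fun y => f y - z * f (y + s) := by fun_prop
  have i1 := integrableOn_cube_norm_sq hf r'
  have i2 := integrableOn_cube_norm_sq hfs r'
  calc ∫ y in cube ι r', ‖f y - z * f (y + s)‖ ^ 2
      ≤ ∫ y in cube ι r', (2 * ‖f y‖ ^ 2 + 2 * ‖f (y + s)‖ ^ 2) := by
        refine setIntegral_mono_on (integrableOn_cube_norm_sq hzf r')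
          ((i1.const_mul 2).add (i2.const_mul 2)) (measurableSet_cube ι _) fun y _ => ?_
        refine (norm_sub_sq_le_two _ _).trans_eq ?_
        rw [norm_mul, hz, one_mul]
    _ = 2 * (∫ y in cube ι r', ‖f y‖ ^ 2) + 2 * ∫ y in cube ι r', ‖f (y + s)‖ ^ 2 := by
        rw [integral_add (i1.const_mul 2) (i2.const_mul 2), integral_const_mul,
          integral_const_mul]
    _ ≤ 2 * (∫ y in cube ι r, ‖f y‖ ^ 2) + 2 * ∫ y in cube ι r, ‖f y‖ ^ 2 := by
        refine add_le_add (mul_le_mul_of_nonneg_left ?_ two_pos.le)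
          (mul_le_mul_of_nonneg_left ?_ two_pos.le)
        · exact setIntegral_mono_set (integrableOn_cube_norm_sq hf r)
            (Filter.Eventually.of_forall fun _ => by positivity) (cube_mono hrr').eventuallyLE
        · exact setIntegral_cube_shift_le (fun y => ‖f y‖ ^ 2) (by fun_prop)
            (fun _ => by positivity) s hs
    _ = 4 * ∫ y in cube ι r, ‖f y‖ ^ 2 := by ring

/-- Adding one frequency to an observable set preserves observability on a larger cube, with a
constant depending only on the old constant and the cubes. -/
lemma Observable.insert_of_lt {r r' c : ℝ} (hr' : 0 < r') (hrr' : r' < r)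
    (hr : r ≤ Real.pi) (hc : 0 < c) :
    ∃ c' : ℝ, 0 < c' ∧ ∀ (Λ : Set (ι → ℤ)) (k₀ : ι → ℤ), Observable Λ r' c →
      Observable (insert k₀ Λ) r c' := by
  classical
  obtain ⟨η, hη0, hη⟩ := exists_pos_le_integral_one_sub_exp (sub_pos.2 hrr')
  set N := Fintype.card ι
  have hr0 : 0 < r := hr'.trans hrr'
  have hδ : 0 < r - r' := sub_pos.2 hrr'
  have hπ := Real.pi_pos
  set D : ℝ := N * ((r - r') * (4 / c) / η) with hD
  have hD0 : 0 ≤ D := by positivity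
  set D' : ℝ := D + (2 + 2 * ((2 * Real.pi) ^ N * D)) / (2 * r) ^ N with hD'
  have hD'0 : 0 < D' := by positivity
  refine ⟨1 / D', by positivity, fun Λ k₀ hΛ F hF a => ?_⟩
  set f : (ι → ℝ) → ℂ := fun y => ∑ k ∈ F, a k * expo k y with hf
  have hfc : Continuous f := continuous_trigSum F a
  set I := ∫ y in cube ι r, ‖f y‖ ^ 2 with hI
  have h_int : ∀ {g : (ι → ℝ) → ℂ} {ρ : ℝ}, Continuous g →
      IntegrableOn (fun y => ‖g y‖ ^ 2) (cube ι ρ) := fun hg =>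
    integrableOn_cube_norm_sq hg _
  have hI0 : 0 ≤ I := integral_nonneg fun _ => by positivity
  have hcoord : ∀ i : ι, ∑ k ∈ F with k i - k₀ i ≠ 0, ‖a k‖ ^ 2 ≤
      (r - r') * (4 / c) / η * I := by
    intro i
    have := sum_filter_le_of_shift_bound hδ hη F (fun k => ‖a k‖ ^ 2) (fun k => by positivity)
      (fun k => k i - k₀ i) (4 / c * I) ?_
    · rw [div_mul_eq_mul_div, le_div_iff₀ hη0]
      linarith
    intro s hs
    set e : (ι → ℤ) → ℂ := fun k =>
      1 - Complex.exp (Complex.I * ((((k i - k₀ i : ℤ) : ℝ) * s : ℝ) : ℂ)) with he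
    have h1 := hΛ (F.filter fun k => k i - k₀ i ≠ 0) (fun k hk => by
      rw [Finset.mem_coe, Finset.mem_filter] at hk
      rcases hF hk.1 with h | h
      · exact absurd (by rw [h, sub_self]) hk.2
      · exact h) (fun k => a k * e k)
    have he0 : ∀ k : ι → ℤ, k i - k₀ i = 0 → e k = 0 := fun k hk => by
      simp only [he, hk]; simp
    rw [Finset.sum_filter_of_ne (p := fun k : ι → ℤ => k i - k₀ i ≠ 0)
      (f := fun k => ‖a k * e k‖ ^ 2) (s := F)
      (fun k _ h h' => h (by simp [he0 k h']))] at h1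
    have hfilter : ∀ y : ι → ℝ, ∑ k ∈ F with k i - k₀ i ≠ 0, a k * e k * expo k y =
        ∑ k ∈ F, a k * e k * expo k y := fun y =>
      Finset.sum_filter_of_ne fun k _ h h' => h (by simp [he0 k h'])
    simp_rw [hfilter] at h1
    have h2 : ∀ y : ι → ℝ, ∑ k ∈ F, a k * e k * expo k y =
        f y - Complex.exp (-(Complex.I * ((k₀ i : ℂ) * (s : ℂ)))) * f (y + Pi.single i s) := by
      intro y
      rw [hf, Finset.mul_sum, ← Finset.sum_sub_distrib]
      refine Finset.sum_congr rfl fun k _ => ?_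
      rw [expo_add_right]
      have : expo k (Pi.single i s) = Complex.exp (Complex.I * ((k i : ℂ) * (s : ℂ))) := by
        rw [expo, Finset.sum_eq_single i]
        · simp
        · intro j _ hj; simp [hj]
        · simp
      rw [this]
      have h3 : Complex.exp (Complex.I * ((((k i - k₀ i : ℤ) : ℝ) * s : ℝ) : ℂ)) =
          Complex.exp (-(Complex.I * ((k₀ i : ℂ) * (s : ℂ)))) *
            Complex.exp (Complex.I * ((k i : ℂ) * (s : ℂ))) := by
        rw [← Complex.exp_add]; congr 1; push_cast; ring
      simp only [he, h3]
      ring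
    simp_rw [h2] at h1
    have h4 := integral_norm_sq_sub_shift_le hrr'.le hfc
      (Complex.exp (-(Complex.I * ((k₀ i : ℂ) * (s : ℂ))))) (by simp [Complex.norm_exp])
      (Pi.single i s) fun j => by
        rcases eq_or_ne j i with rfl | hj
        · simpa [abs_of_nonneg hs.1] using hs.2
        · simpa [hj] using hrr'.le
    have h5 := h1.trans h4
    simp_rw [norm_mul, mul_pow] at h5
    rw [div_mul_eq_mul_div, le_div_iff₀ hc, mul_comm]
    exact h5
  have hne : ∑ k ∈ F with k ≠ k₀, ‖a k‖ ^ 2 ≤ D * I := by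
    calc ∑ k ∈ F with k ≠ k₀, ‖a k‖ ^ 2
        ≤ ∑ i : ι, ∑ k ∈ F with k i - k₀ i ≠ 0, ‖a k‖ ^ 2 := by
          simp_rw [Finset.sum_filter]
          rw [Finset.sum_comm]
          refine Finset.sum_le_sum fun k _ => ?_
          split_ifs with h
          · obtain ⟨i, hi⟩ := Function.ne_iff.1 h
            refine le_trans ?_ (Finset.single_le_sum (fun j _ => ?_) (Finset.mem_univ i))
            · rw [if_pos (sub_ne_zero.2 hi)]
            · split_ifs <;> positivity
          · exact Finset.sum_nonneg fun j _ => by split_ifs <;> positivity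
      _ ≤ ∑ _i : ι, (r - r') * (4 / c) / η * I := Finset.sum_le_sum fun i _ => hcoord i
      _ = D * I := by simp [hD, N]; ring
  have hsum : ∑ k ∈ F, ‖a k‖ ^ 2 ≤ D' * I := by
    by_cases hk : k₀ ∈ F
    · have hsplit : ∀ {M : Type} [AddCommMonoid M] (g : (ι → ℤ) → M),
          ∑ k ∈ F, g k = g k₀ + ∑ k ∈ F with k ≠ k₀, g k := by
        intro M _ g
        rw [← Finset.add_sum_erase _ _ hk, Finset.filter_ne']
      have h1 : (2 * r) ^ N * ‖a k₀‖ ^ 2 ≤ 2 * I + 2 * ((2 * Real.pi) ^ N * (D * I)) := by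
        calc (2 * r) ^ N * ‖a k₀‖ ^ 2 = ∫ y in cube ι r, ‖a k₀ * expo k₀ y‖ ^ 2 := by
              simp [norm_expo, volume_real_cube ι hr0.le, N]
          _ ≤ ∫ y in cube ι r, (2 * ‖f y‖ ^ 2 +
                2 * ‖∑ k ∈ F with k ≠ k₀, a k * expo k y‖ ^ 2) := by
              apply setIntegral_mono_on
              · exact h_int (continuous_const.mul (continuous_expo _))
              · exact ((h_int hfc).const_mul 2).add ((h_int (continuous_trigSum _ a)).const_mul 2)
              · exact measurableSet_cube ι _
              · intro y _
                refine le_trans (le_of_eq ?_) (norm_sub_sq_le_two _ _)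
                simp only [hf]
                rw [hsplit fun k => a k * expo k y, add_sub_cancel_right]
          _ = 2 * I + 2 * ∫ y in cube ι r, ‖∑ k ∈ F with k ≠ k₀, a k * expo k y‖ ^ 2 := by
              rw [integral_add, integral_const_mul, integral_const_mul]
              · exact (h_int hfc).const_mul 2
              · exact (h_int (continuous_trigSum _ a)).const_mul 2
          _ ≤ _ := by
              gcongr
              refine (integral_norm_sq_expo_le (cube_mono hr) _ a).trans ?_
              gcongr
      rw [hsplit, hD', add_mul, add_comm]
      gcongr
      rw [div_mul_eq_mul_div, le_div_iff₀ (by positivity)]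
      linarith
    · have : F.filter (fun k => k ≠ k₀) = F :=
        Finset.filter_true_of_mem fun k hkF h => hk (h ▸ hkF)
      rw [this] at hne
      refine hne.trans ?_
      gcongr
      rw [hD']
      linarith [show 0 ≤ (2 + 2 * ((2 * Real.pi) ^ N * D)) / (2 * r) ^ N by positivity]
  rw [one_div, inv_mul_le_iff₀ hD'0]
  exact hsum

lemma Observable.union_finset {M : ℕ} : ∀ {r r' c : ℝ}, 0 < r' → r' < r →
    r ≤ Real.pi → 0 < c →
    ∃ c' : ℝ, 0 < c' ∧ ∀ (Λ : Set (ι → ℤ)) (E : Finset (ι → ℤ)), E.card ≤ M →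
      Observable Λ r' c → Observable (Λ ∪ ↑E) r c' := by
  classical
  induction M with
  | zero =>
    intro r r' c hr' hrr' hr hc
    refine ⟨c, hc, fun Λ E hE h => ?_⟩
    obtain rfl := Finset.card_eq_zero.1 (Nat.le_zero.1 hE)
    simp only [Finset.coe_empty, Set.union_empty]
    intro F hF a
    refine (h F hF a).trans (setIntegral_mono_set ?_
      (Filter.Eventually.of_forall fun _ => by positivity) (cube_mono hrr'.le).eventuallyLE)
    exact integrableOn_cube_norm_sq (continuous_trigSum F a) r
  | succ M ih =>
    intro r r' c hr' hrr' hr hc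
    obtain ⟨c₁, hc₁, h₁⟩ := ih (r := (r' + r) / 2) (r' := r') (c := c) hr' (by linarith)
      (by linarith) hc
    obtain ⟨c₂, hc₂, h₂⟩ := Observable.insert_of_lt (ι := ι) (r := r) (r' := (r' + r) / 2)
      (c := c₁) (by linarith) (by linarith) hr hc₁
    refine ⟨min c₁ c₂, by positivity, fun Λ E hE h => ?_⟩
    rcases E.eq_empty_or_nonempty with rfl | ⟨k, hk⟩
    · have := h₂ _ 0 (h₁ Λ ∅ (by simp) h)
      intro F hF a
      refine le_trans ?_ (this F (hF.trans (Set.subset_insert _ _)) a)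
      gcongr
      exact min_le_right _ _
    · have := h₂ _ k (h₁ Λ (E.erase k) (by rw [Finset.card_erase_of_mem hk]; omega) h)
      intro F hF a
      refine le_trans ?_ (this F (hF.trans ?_) a)
      · gcongr
        exact min_le_right _ _
      · rw [← Set.union_insert, ← Finset.coe_insert, Finset.insert_erase hk]

end Haraux

lemma summable_pi_prod {ι : Type*} [Fintype ι] {κ : Type*} {g : κ → ℝ} (hg0 : ∀ m, 0 ≤ g m)
    (hg : Summable g) : Summable fun k : ι → κ => ∏ i, g (k i) := by
  classical
  refine summable_of_sum_le (c := ∏ _i : ι, ∑' m, g m)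
    (fun k => Finset.prod_nonneg fun i _ => hg0 _) fun u => ?_
  calc ∑ k ∈ u, ∏ i, g (k i)
      ≤ ∑ k ∈ Fintype.piFinset fun i => u.image fun k => k i, ∏ i, g (k i) := by
        refine Finset.sum_le_sum_of_subset_of_nonneg (fun k hk => ?_) fun k _ _ =>
          Finset.prod_nonneg fun i _ => hg0 _
        rw [Fintype.mem_piFinset]
        exact fun i => Finset.mem_image_of_mem _ hk
    _ = ∏ i, ∑ m ∈ u.image fun k => k i, g m := by
        rw [Finset.prod_univ_sum]
    _ ≤ ∏ _i : ι, ∑' m, g m :=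
        Finset.prod_le_prod (fun i _ => Finset.sum_nonneg fun m _ => hg0 _) fun i _ =>
          hg.sum_le_tsum _ fun m _ => hg0 _

lemma norm_integral_parabola_exp_le {r : ℝ} (hr : 0 < r) {m : ℤ} (hm : m ≠ 0) :
    ‖∫ t in Set.Icc (-r) r, ((r ^ 2 - t ^ 2 : ℝ) : ℂ) *
      Complex.exp (Complex.I * ((m : ℂ) * (t : ℂ)))‖ ≤ (4 * r + 4) * (1 / (m : ℝ) ^ 2) := by
  rw [integral_Icc_eq_integral_Ioc, ← intervalIntegral.integral_of_le (by linarith)]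
  set z : ℂ := Complex.I * m with hz
  have hz0 : z ≠ 0 := by simp [hz, hm]
  have hderiv : ∀ t : ℝ, HasDerivAt (fun t : ℝ => Complex.exp (z * t) *
      (((r : ℂ) ^ 2 - (t : ℂ) ^ 2) / z + 2 * t / z ^ 2 - 2 / z ^ 3))
      (((r ^ 2 - t ^ 2 : ℝ) : ℂ) * Complex.exp (Complex.I * ((m : ℂ) * (t : ℂ)))) t := by
    intro t
    have h1 : HasDerivAt (fun t : ℝ => (t : ℂ)) 1 t := Complex.ofRealCLM.hasDerivAt
    have h2 := (h1.const_mul z).cexp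
    have h3 := ((((h1.pow 2).const_sub ((r : ℂ) ^ 2)).div_const z).add
      ((h1.const_mul 2).div_const (z ^ 2))).sub_const (2 / z ^ 3)
    refine (h2.mul h3).congr_deriv ?_
    rw [show Complex.I * ((m : ℂ) * (t : ℂ)) = z * t by rw [hz]; ring]
    simp only [Pi.add_apply, Pi.pow_apply]
    push_cast
    field_simp
    ring
  rw [intervalIntegral.integral_eq_sub_of_hasDerivAt (fun t _ => hderiv t)
    (Continuous.intervalIntegrable (by fun_prop) _ _)]
  have hzn : ‖z‖ = |(m : ℝ)| := by simp [hz]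
  have hm1 : (1 : ℝ) ≤ |(m : ℝ)| := by exact_mod_cast Int.one_le_abs hm
  have hexp : ∀ t : ℝ, ‖Complex.exp (z * t)‖ = 1 := fun t => by
    rw [hz, Complex.norm_exp]; simp
  have key : ∀ t : ℝ, t ^ 2 = r ^ 2 → ‖Complex.exp (z * t) *
      (((r : ℂ) ^ 2 - (t : ℂ) ^ 2) / z + 2 * t / z ^ 2 - 2 / z ^ 3)‖ ≤
      (2 * r + 2) * (1 / (m : ℝ) ^ 2) := by
    intro t ht
    have ht' : (t : ℂ) ^ 2 = (r : ℂ) ^ 2 := by exact_mod_cast ht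
    have hta : |t| = r := by rw [← abs_of_pos hr]; exact sq_eq_sq_iff_abs_eq_abs _ _ |>.1 ht
    rw [norm_mul, hexp, one_mul, ht', sub_self, zero_div, zero_add]
    refine (norm_sub_le _ _).trans ?_
    rw [norm_div, norm_div, norm_pow, norm_pow, hzn, norm_mul, Complex.norm_real,
      Real.norm_eq_abs, hta, Complex.norm_ofNat, sq_abs, mul_one_div, add_div]
    gcongr
    rw [← sq_abs]
    exact pow_le_pow_right₀ hm1 (by norm_num)
  have h1 := key r rfl
  have h2 := key (-r) (by ring)
  refine (norm_sub_le _ _).trans ?_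
  linarith

lemma summable_integral_parabola_exp {r : ℝ} (hr : 0 < r) :
    Summable fun m : ℤ => ‖∫ t in Set.Icc (-r) r, ((r ^ 2 - t ^ 2 : ℝ) : ℂ) *
      Complex.exp (Complex.I * ((m : ℂ) * (t : ℂ)))‖ := by
  have h1 : Summable fun m : ℤ => (4 * r + 4) * (1 / (m : ℝ) ^ 2) :=
    (Real.summable_one_div_int_pow.2 one_lt_two).mul_left _
  refine Summable.of_norm_bounded_eventually h1 ?_
  filter_upwards [(Set.finite_singleton (0 : ℤ)).compl_mem_cofinite] with m hm
  rw [norm_norm]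
  exact norm_integral_parabola_exp_le hr hm

section Ingham

variable {ι : Type*} [Fintype ι]

/-- A weight on the cube with summable Fourier coefficients, comparable to `1` inside. -/
lemma summable_norm_integral_weight_expo {r : ℝ} (hr : 0 < r) :
    Summable fun k : ι → ℤ =>
      ‖∫ y in cube ι r, ((∏ i, (r ^ 2 - y i ^ 2) : ℝ) : ℂ) * expo k y‖ := by
  refine (summable_pi_prod (ι := ι) (fun m => norm_nonneg _)
    (summable_integral_parabola_exp hr)).congr fun k => ?_
  rw [← norm_prod, ← setIntegral_cube_prod r fun i t => ((r ^ 2 - t ^ 2 : ℝ) : ℂ) *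
      Complex.exp (Complex.I * ((k i : ℂ) * (t : ℂ)))]
  congr 2
  ext y
  rw [expo_eq_prod, Finset.prod_mul_distrib, Complex.ofReal_prod]

lemma sum_sum_eq_sum_classes_add {κ : Type*} {α M : Type*} [DecidableEq κ] [AddCommMonoid M]
    (F : Finset α) (cl : α → κ) (A : α → α → M) :
    ∑ k ∈ F, ∑ l ∈ F, A k l =
      (∑ x ∈ F.image cl, ∑ k ∈ F with cl k = x, ∑ l ∈ F with cl l = x, A k l) +
        ∑ k ∈ F, ∑ l ∈ F with cl l ≠ cl k, A k l := by
  have : ∑ x ∈ F.image cl, ∑ k ∈ F with cl k = x, ∑ l ∈ F with cl l = x, A k l =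
      ∑ k ∈ F, ∑ l ∈ F with cl l = cl k, A k l := by
    rw [← Finset.sum_fiberwise_of_maps_to (s := F) (t := F.image cl) (g := cl)
      fun k hk => Finset.mem_image_of_mem _ hk]
    refine Finset.sum_congr rfl fun x _ => Finset.sum_congr rfl fun k hk => ?_
    rw [(Finset.mem_filter.1 hk).2]
  rw [this, ← Finset.sum_add_distrib]
  exact Finset.sum_congr rfl fun k _ => (Finset.sum_filter_add_sum_filter_not _ _ _).symm

lemma norm_sum_sum_le_of_row_bound {α : Type*} (F : Finset α) (P : α → α → Prop)
    [∀ k, DecidablePred (P k)] (hP : ∀ k l, P k l → P l k) (a : α → ℂ) (g : α → α → ℂ)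
    (hg : ∀ k l, ‖g k l‖ = ‖g l k‖) (δ : ℝ)
    (h : ∀ k ∈ F, ∑ l ∈ F with P k l, ‖g k l‖ ≤ δ) :
    ‖∑ k ∈ F, ∑ l ∈ F with P k l, a k * conj (a l) * g k l‖ ≤ δ * ∑ k ∈ F, ‖a k‖ ^ 2 := by
  have hrow : ∑ k ∈ F, ∑ l ∈ F with P k l, ‖a k‖ ^ 2 * ‖g k l‖ ≤ δ * ∑ k ∈ F, ‖a k‖ ^ 2 := by
    rw [Finset.mul_sum]
    refine Finset.sum_le_sum fun k hk => ?_
    rw [← Finset.mul_sum, mul_comm]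
    gcongr
    exact h k hk
  have hcol : ∑ k ∈ F, ∑ l ∈ F with P k l, ‖a l‖ ^ 2 * ‖g k l‖ =
      ∑ k ∈ F, ∑ l ∈ F with P k l, ‖a k‖ ^ 2 * ‖g k l‖ := by
    simp_rw [Finset.sum_filter]
    rw [Finset.sum_comm]
    refine Finset.sum_congr rfl fun k _ => Finset.sum_congr rfl fun l _ => ?_
    rw [hg l k]
    exact if_congr ⟨hP _ _, hP _ _⟩ rfl rfl
  calc ‖∑ k ∈ F, ∑ l ∈ F with P k l, a k * conj (a l) * g k l‖
      ≤ ∑ k ∈ F, ∑ l ∈ F with P k l, (‖a k‖ ^ 2 * ‖g k l‖ + ‖a l‖ ^ 2 * ‖g k l‖) / 2 := by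
        refine (norm_sum_le _ _).trans (Finset.sum_le_sum fun k _ => ?_)
        refine (norm_sum_le _ _).trans (Finset.sum_le_sum fun l _ => ?_)
        rw [norm_mul, norm_mul, RCLike.norm_conj]
        nlinarith [mul_nonneg (sq_nonneg (‖a k‖ - ‖a l‖)) (norm_nonneg (g k l))]
    _ = (∑ k ∈ F, ∑ l ∈ F with P k l, ‖a k‖ ^ 2 * ‖g k l‖ +
          ∑ k ∈ F, ∑ l ∈ F with P k l, ‖a l‖ ^ 2 * ‖g k l‖) / 2 := by
        simp_rw [← Finset.sum_div, Finset.sum_add_distrib]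
    _ ≤ δ * ∑ k ∈ F, ‖a k‖ ^ 2 := by rw [hcol]; linarith

/-- Ingham-type localisation: if frequencies in distinct classes never differ by an element of
a suitable finite set, then observability of the classes implies observability of the whole. -/
lemma Observable.of_classes {r c : ℝ} (hr : 0 < r) (hc : 0 < c) :
    ∃ S : Finset (ι → ℤ), ∃ c' : ℝ, 0 < c' ∧ ∀ {κ : Type} (Λ : Set (ι → ℤ)) (cl : (ι → ℤ) → κ),
      (∀ x, Observable (Λ ∩ cl ⁻¹' {x}) (r / 2) c) →
      (∀ k ∈ Λ, ∀ l ∈ Λ, k - l ∈ S → cl k = cl l) → Observable Λ r c' := by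
  classical
  set N := Fintype.card ι
  set h : (ι → ℝ) → ℝ := fun y => ∏ i, (r ^ 2 - y i ^ 2) with hh
  have hcont : Continuous h := by fun_prop
  set m : ℝ := (3 * r ^ 2 / 4) ^ N with hm
  have hm0 : 0 < m := by positivity
  have hsq : ∀ {ρ t : ℝ}, -ρ ≤ t → t ≤ ρ → t ^ 2 ≤ ρ ^ 2 := fun h1 h2 => sq_le_sq' h1 h2
  have hnonneg : ∀ y ∈ cube ι r, 0 ≤ h y := fun y hy =>
    Finset.prod_nonneg fun i _ => sub_nonneg.2 (hsq (hy.1 i) (hy.2 i))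
  have hupper : ∀ y ∈ cube ι r, h y ≤ (r ^ 2) ^ N := fun y hy =>
    (Finset.prod_le_prod (fun i _ => sub_nonneg.2 (hsq (hy.1 i) (hy.2 i)))
      (fun i _ => sub_le_self _ (sq_nonneg (y i)))).trans (by simp [N])
  have hlower : ∀ y ∈ cube ι (r / 2), m ≤ h y := fun y hy => by
    have : ∏ _i : ι, (3 * r ^ 2 / 4) ≤ ∏ i, (r ^ 2 - y i ^ 2) :=
      Finset.prod_le_prod (fun i _ => by positivity) fun i _ => by
        have := hsq (hy.1 i) (hy.2 i)
        linarith [show (r / 2) ^ 2 = r ^ 2 / 4 by ring]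
    simpa only [hm, N, Finset.prod_const, Finset.card_univ] using this
  set g : (ι → ℤ) → ℂ := fun k => ∫ y in cube ι r, (h y : ℂ) * expo k y with hg
  have hsum : Summable fun k => ‖g k‖ := summable_norm_integral_weight_expo hr
  obtain ⟨S, hS⟩ := summable_iff_vanishing_norm.1 hsum (m * c / 2) (by positivity)
  refine ⟨S, m * c / 2 / (r ^ 2) ^ N, by positivity, fun {κ} Λ cl hcl hsep F hF a => ?_⟩
  have h_int : ∀ k l, IntegrableOn (fun y => (h y : ℂ) * (expo k y * conj (expo l y)))
      (cube ι r) := fun k l => by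
    simp_rw [expo_mul_conj]
    have := continuous_expo (k - l)
    exact (Continuous.continuousOn (by fun_prop)).integrableOn_compact (isCompact_cube ι r)
  have hQ : ∀ G : Finset (ι → ℤ), ((∫ y in cube ι r, h y * ‖∑ k ∈ G, a k * expo k y‖ ^ 2 : ℝ) : ℂ) =
      ∑ k ∈ G, ∑ l ∈ G, a k * conj (a l) * g (k - l) := fun G => by
    rw [integral_weighted_norm_sq_sum _ G h expo h_int a]
    simp_rw [expo_mul_conj, hg]
  have hwint : ∀ (G : Finset (ι → ℤ)) (ρ : ℝ),
      IntegrableOn (fun y => h y * ‖∑ k ∈ G, a k * expo k y‖ ^ 2) (cube ι ρ) := fun G ρ => by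
    have := continuous_trigSum G a
    exact (Continuous.continuousOn (by fun_prop)).integrableOn_compact (isCompact_cube ι ρ)
  have hclass : ∀ x, m * (c * ∑ k ∈ F with cl k = x, ‖a k‖ ^ 2) ≤
      ∫ y in cube ι r, h y * ‖∑ k ∈ F with cl k = x, a k * expo k y‖ ^ 2 := fun x => by
    have h1 := hcl x (F.filter fun k => cl k = x) (fun k hk => by
      have hk' := Finset.mem_filter.1 (Finset.mem_coe.1 hk)
      exact ⟨hF hk'.1, hk'.2⟩) a
    calc _ ≤ m * ∫ y in cube ι (r / 2), ‖∑ k ∈ F with cl k = x, a k * expo k y‖ ^ 2 := by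
          exact mul_le_mul_of_nonneg_left h1 hm0.le
      _ = ∫ y in cube ι (r / 2), m * ‖∑ k ∈ F with cl k = x, a k * expo k y‖ ^ 2 := by
          rw [integral_const_mul]
      _ ≤ ∫ y in cube ι (r / 2), h y * ‖∑ k ∈ F with cl k = x, a k * expo k y‖ ^ 2 := by
          refine setIntegral_mono_on ((integrableOn_cube_norm_sq (continuous_trigSum _ a) _).const_mul
            m) (hwint _ _) (measurableSet_cube ι _) fun y hy => ?_
          gcongr
          exact hlower y hy
      _ ≤ _ := by
          refine setIntegral_mono_set (hwint _ _) ?_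
            (cube_mono (by linarith : r / 2 ≤ r)).eventuallyLE
          refine (ae_restrict_iff' (measurableSet_cube ι _)).2 (Filter.Eventually.of_forall
            fun y hy => mul_nonneg (hnonneg y hy) (by positivity))
  have hcross : ‖∑ k ∈ F, ∑ l ∈ F with cl l ≠ cl k, a k * conj (a l) * g (k - l)‖ ≤
      m * c / 2 * ∑ k ∈ F, ‖a k‖ ^ 2 := by
    refine norm_sum_sum_le_of_row_bound F (fun k l => cl l ≠ cl k) (fun k l h => h.symm) a
      (fun k l => g (k - l)) (fun k l => ?_) _ fun k hk => ?_
    · rw [← RCLike.norm_conj]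
      simp only [hg]
      rw [← integral_conj]
      congr 2
      ext y
      rw [map_mul, Complex.conj_ofReal, ← expo_mul_conj, ← expo_mul_conj, map_mul,
        Complex.conj_conj, mul_comm (expo l y)]
    · have := hS ((F.filter fun l => cl l ≠ cl k).image fun l => k - l) (by
        rw [Finset.disjoint_left]
        intro x hx hxS
        obtain ⟨l, hl, rfl⟩ := Finset.mem_image.1 hx
        rw [Finset.mem_filter] at hl
        exact hl.2 (hsep k (hF hk) l (hF hl.1) hxS).symm)
      rw [Finset.sum_image fun x _ y _ hxy => sub_right_injective hxy] at this
      exact (le_abs_self _).trans this.le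
  have htotal : m * c / 2 * ∑ k ∈ F, ‖a k‖ ^ 2 ≤
      ∫ y in cube ι r, h y * ‖∑ k ∈ F, a k * expo k y‖ ^ 2 := by
    have h1 := hQ F
    rw [sum_sum_eq_sum_classes_add F cl] at h1
    simp_rw [← hQ] at h1
    rw [← Complex.ofReal_sum, ← sub_eq_iff_eq_add', ← Complex.ofReal_sub] at h1
    rw [← h1, Complex.norm_real, Real.norm_eq_abs] at hcross
    have h2 : m * c * ∑ k ∈ F, ‖a k‖ ^ 2 ≤ ∑ x ∈ F.image cl,
        ∫ y in cube ι r, h y * ‖∑ k ∈ F with cl k = x, a k * expo k y‖ ^ 2 := by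
      rw [← Finset.sum_fiberwise_of_maps_to (s := F) (t := F.image cl) (g := cl)
        fun k hk => Finset.mem_image_of_mem _ hk, Finset.mul_sum]
      refine Finset.sum_le_sum fun x _ => ?_
      rw [mul_assoc]
      exact hclass x
    have := (abs_le.1 hcross).1
    linarith
  have hfinal : ∫ y in cube ι r, h y * ‖∑ k ∈ F, a k * expo k y‖ ^ 2 ≤
      (r ^ 2) ^ N * ∫ y in cube ι r, ‖∑ k ∈ F, a k * expo k y‖ ^ 2 := by
    rw [← integral_const_mul]
    refine setIntegral_mono_on (hwint _ _) ((integrableOn_cube_norm_sq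
      (continuous_trigSum _ a) _).const_mul _) (measurableSet_cube ι _) fun y hy => ?_
    gcongr
    exact hupper y hy
  rw [div_mul_eq_mul_div, div_le_iff₀ (by positivity), mul_comm _ ((r ^ 2) ^ N)]
  exact htotal.trans hfinal

end Ingham

section Reach

variable {n : ℕ}

/-- One step of length in `H ∩ U` between points having small scalar product with the step. -/
def Step (H : Finset (Fin n → ℝ)) (R : ℝ) (U : Submodule ℝ (Fin n → ℝ)) (x y : Fin n → ℝ) : Prop :=
  y - x ∈ H ∧ y - x ∈ U ∧ |x ⬝ᵥ (y - x)| ≤ R ∧ |y ⬝ᵥ (y - x)| ≤ R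

/-- Points connected by a chain of steps. -/
def Reach (H : Finset (Fin n → ℝ)) (R : ℝ) (U : Submodule ℝ (Fin n → ℝ)) :
    (Fin n → ℝ) → (Fin n → ℝ) → Prop :=
  Relation.ReflTransGen (Step H R U)

lemma Reach.symm {H : Finset (Fin n → ℝ)} (hH : ∀ h ∈ H, -h ∈ H) {R : ℝ}
    {U : Submodule ℝ (Fin n → ℝ)} {x y : Fin n → ℝ} (h : Reach H R U x y) : Reach H R U y x := by
  have hsymm : Std.Symm (Step H R U) := ⟨fun x y hxy => ?_⟩
  · exact (Relation.ReflTransGen.stdSymm).symm _ _ h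
  obtain ⟨h1, h2, h3, h4⟩ := hxy
  have : x - y = -(y - x) := (neg_sub y x).symm
  refine ⟨this ▸ hH _ h1, this ▸ U.neg_mem h2, ?_, ?_⟩
  · rw [this, dotProduct_neg, abs_neg]; exact h4
  · rw [this, dotProduct_neg, abs_neg]; exact h3

lemma Reach.sub_mem {H : Finset (Fin n → ℝ)} {R : ℝ}
    {U : Submodule ℝ (Fin n → ℝ)} {x y : Fin n → ℝ} (h : Reach H R U x y) : y - x ∈ U := by
  induction h with
  | refl => simp
  | @tail b c _ hs ih =>
    have := U.add_mem ih hs.2.1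
    simpa using this

lemma abs_dotProduct_le (x h : Fin n → ℝ) : |x ⬝ᵥ h| ≤ n * (‖x‖ * ‖h‖) := by
  rw [dotProduct]
  refine (Finset.abs_sum_le_sum_abs _ _).trans ?_
  calc ∑ i, |x i * h i| ≤ ∑ _i : Fin n, ‖x‖ * ‖h‖ := by
        refine Finset.sum_le_sum fun i _ => ?_
        rw [abs_mul]
        exact mul_le_mul (norm_le_pi_norm x i) (norm_le_pi_norm h i) (abs_nonneg _) (norm_nonneg _)
    _ = _ := by simp

lemma exists_bound_dotProduct_of_mem_span (A : Set (Fin n → ℝ)) (R : ℝ) {h : Fin n → ℝ}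
    (hh : h ∈ Submodule.span ℝ A) :
    ∃ C : ℝ, 0 ≤ C ∧ ∀ x : Fin n → ℝ, (∀ g ∈ A, |x ⬝ᵥ g| ≤ R) → |x ⬝ᵥ h| ≤ C := by
  induction hh using Submodule.span_induction with
  | mem g hg => exact ⟨|R|, abs_nonneg _, fun x hx => (hx g hg).trans (le_abs_self R)⟩
  | zero => exact ⟨0, le_rfl, fun x _ => by simp⟩
  | add g₁ g₂ _ _ h₁ h₂ =>
    obtain ⟨C₁, h₁, H₁⟩ := h₁
    obtain ⟨C₂, h₂, H₂⟩ := h₂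
    refine ⟨C₁ + C₂, by positivity, fun x hx => ?_⟩
    rw [dotProduct_add]
    exact (abs_add_le _ _).trans (add_le_add (H₁ x hx) (H₂ x hx))
  | smul a g _ h₁ =>
    obtain ⟨C₁, h₁, H₁⟩ := h₁
    refine ⟨|a| * C₁, by positivity, fun x hx => ?_⟩
    rw [dotProduct_smul, smul_eq_mul, abs_mul]
    gcongr
    exact H₁ x hx

lemma exists_norm_le_of_mem_span (A : Finset (Fin n → ℝ)) (C : ℝ) :
    ∃ M : ℝ, 0 ≤ M ∧ ∀ z ∈ Submodule.span ℝ (A : Set (Fin n → ℝ)),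
      (∀ g ∈ A, |z ⬝ᵥ g| ≤ C) → ‖z‖ ≤ M := by
  set U := Submodule.span ℝ (A : Set (Fin n → ℝ))
  let L : U →ₗ[ℝ] (A → ℝ) :=
    { toFun := fun z g => (z : Fin n → ℝ) ⬝ᵥ g
      map_add' := fun z w => by ext g; simp [add_dotProduct]
      map_smul' := fun a z => by ext g; simp [smul_dotProduct] }
  have hL : LinearMap.ker L = ⊥ := by
    rw [LinearMap.ker_eq_bot']
    intro z hz
    have h1 : ∀ w ∈ U, (z : Fin n → ℝ) ⬝ᵥ w = 0 := by
      intro w hw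
      induction hw using Submodule.span_induction with
      | mem g hg => exact congrFun hz ⟨g, hg⟩
      | zero => simp
      | add g₁ g₂ _ _ h₁ h₂ => rw [dotProduct_add, h₁, h₂, add_zero]
      | smul a g _ h₁ => rw [dotProduct_smul, h₁, smul_zero]
    exact Subtype.ext (dotProduct_self_eq_zero.1 (h1 z z.2))
  obtain ⟨K, -, hK⟩ := L.exists_antilipschitzWith hL
  refine ⟨K * |C|, by positivity, fun z hz h => ?_⟩
  have h1 := hK.le_mul_dist ⟨z, hz⟩ 0
  rw [map_zero, dist_zero_right, dist_zero_right] at h1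
  refine h1.trans (mul_le_mul_of_nonneg_left ?_ K.2)
  exact (pi_norm_le_iff_of_nonneg (abs_nonneg C)).2 fun g => (h g g.2).trans (le_abs_self C)

/-- Dichotomy: in a subspace of dimension at most `d + 1`, all points outside a set of bounded
diameter have their chains confined to a proper subspace. -/
lemma exists_exceptional_bound (H : Finset (Fin n → ℝ)) {R D : ℝ} {d : ℕ}
    (hD : ∀ U : Submodule ℝ (Fin n → ℝ), Module.finrank ℝ U ≤ d →
      ∀ x y, Reach H R U x y → ‖y - x‖ ≤ D) :
    ∃ M : ℝ, 0 ≤ M ∧ ∀ U : Submodule ℝ (Fin n → ℝ), Module.finrank ℝ U ≤ d + 1 →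
      ∃ P : (Fin n → ℝ) → Prop, (∀ x y, P x → P y → y - x ∈ U → ‖y - x‖ ≤ M) ∧
        ∀ x, ¬ P x → ∃ W : Submodule ℝ (Fin n → ℝ), Module.finrank ℝ W ≤ d ∧
          ∀ y, Reach H R U x y → Reach H R W x y := by
  classical
  set B : ℝ := ∑ h ∈ H, ‖h‖ with hB
  have hB' : ∀ h ∈ H, ‖h‖ ≤ B := fun h hh =>
    Finset.single_le_sum (f := fun h => ‖h‖) (fun _ _ => norm_nonneg _) hh
  set R₂ : ℝ := R + n * (D * B) with hR₂
  have hC : ∀ q : Finset (Fin n → ℝ) × (Fin n → ℝ), ∃ C : ℝ, 0 ≤ C ∧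
      (q.2 ∈ Submodule.span ℝ (q.1 : Set (Fin n → ℝ)) → ∀ x : Fin n → ℝ,
        (∀ g ∈ q.1, |x ⬝ᵥ g| ≤ R₂) → |x ⬝ᵥ q.2| ≤ C) := fun q => by
    by_cases h : q.2 ∈ Submodule.span ℝ (q.1 : Set (Fin n → ℝ))
    · obtain ⟨C, hC0, hC⟩ := exists_bound_dotProduct_of_mem_span _ R₂ h
      exact ⟨C, hC0, fun _ => hC⟩
    · exact ⟨0, le_rfl, fun h' => (h h').elim⟩
  choose C hC0 hC using hC
  set C₀ : ℝ := ∑ q ∈ H.powerset ×ˢ H, C q with hC₀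
  have hCle : ∀ A ⊆ H, ∀ h ∈ H, C (A, h) ≤ C₀ := fun A hA h hh =>
    Finset.single_le_sum (f := C) (fun q _ => hC0 q)
      (Finset.mem_product.2 ⟨Finset.mem_powerset.2 hA, hh⟩)
  choose M hM0 hM using fun A : Finset (Fin n → ℝ) => exists_norm_le_of_mem_span A (2 * C₀)
  refine ⟨∑ A ∈ H.powerset, M A, Finset.sum_nonneg fun A _ => hM0 A, fun U hU => ?_⟩
  set A : (Fin n → ℝ) → Finset (Fin n → ℝ) := fun x => H.filter fun h => h ∈ U ∧ |x ⬝ᵥ h| ≤ R₂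
    with hA
  have hAH : ∀ x, A x ⊆ H := fun x => Finset.filter_subset _ _
  have hAU : ∀ x, Submodule.span ℝ (A x : Set (Fin n → ℝ)) ≤ U := fun x =>
    Submodule.span_le.2 fun h hh => (Finset.mem_filter.1 (Finset.mem_coe.1 hh)).2.1
  refine ⟨fun x => Submodule.span ℝ (A x : Set (Fin n → ℝ)) = U, fun x y hx hy hxy => ?_,
    fun x hx => ⟨Submodule.span ℝ (A x : Set (Fin n → ℝ)), ?_, ?_⟩⟩
  · have hbound : ∀ z, Submodule.span ℝ (A z : Set (Fin n → ℝ)) = U →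
        ∀ h ∈ A x, |z ⬝ᵥ h| ≤ C₀ := fun z hz h hh =>
      (hC (A z, h) (hz ▸ hx ▸ Submodule.subset_span hh) z fun g hg =>
        (Finset.mem_filter.1 hg).2.2).trans (hCle _ (hAH z) _ (hAH x hh))
    refine (hM (A x) (y - x) (hx ▸ hxy) fun h hh => ?_).trans
      (Finset.single_le_sum (f := M) (fun A _ => hM0 A) (Finset.mem_powerset.2 (hAH x)))
    rw [sub_dotProduct]
    have h1 := hbound x hx h hh
    have h2 := hbound y hy h hh
    exact (abs_sub _ _).trans (by linarith)
  · have := Submodule.finrank_lt_finrank_of_lt (lt_of_le_of_ne (hAU x) hx)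
    omega
  · intro y hy
    induction hy with
    | refl => exact Relation.ReflTransGen.refl
    | @tail b c _ hs ih =>
      refine Relation.ReflTransGen.tail ih ⟨hs.1, Submodule.subset_span ?_, hs.2.2⟩
      refine Finset.mem_coe.2 (Finset.mem_filter.2 ⟨hs.1, hs.2.1, ?_⟩)
      have hW : Module.finrank ℝ (Submodule.span ℝ (A x : Set (Fin n → ℝ))) ≤ d := by
        have := Submodule.finrank_lt_finrank_of_lt (lt_of_le_of_ne (hAU x) hx)
        omega
      have h1 := hD _ hW x b ih
      have h2 := abs_dotProduct_le (b - x) (c - b)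
      have h3 : ‖b - x‖ * ‖c - b‖ ≤ D * B :=
        mul_le_mul h1 (hB' _ hs.1) (norm_nonneg _) ((norm_nonneg _).trans h1)
      have h4 : x ⬝ᵥ (c - b) = b ⬝ᵥ (c - b) - (b - x) ⬝ᵥ (c - b) := by
        rw [sub_dotProduct]; ring
      rw [h4]
      refine (abs_sub _ _).trans ?_
      rw [hR₂]
      have h5 : (n : ℝ) * (‖b - x‖ * ‖c - b‖) ≤ n * (D * B) := by gcongr
      linarith [hs.2.2.1]

lemma exists_reach_bound {H : Finset (Fin n → ℝ)} (hH : ∀ h ∈ H, -h ∈ H) (R : ℝ) (d : ℕ) :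
    ∃ D : ℝ, ∀ U : Submodule ℝ (Fin n → ℝ), Module.finrank ℝ U ≤ d →
      ∀ x y, Reach H R U x y → ‖y - x‖ ≤ D := by
  induction d with
  | zero =>
    refine ⟨0, fun U hU x y h => ?_⟩
    have h1 := h.sub_mem
    rw [Submodule.finrank_eq_zero.1 (Nat.le_zero.1 hU), Submodule.mem_bot] at h1
    simp [h1]
  | succ d ih =>
    obtain ⟨D, hD⟩ := ih
    obtain ⟨M, hM0, hM⟩ := exists_exceptional_bound H hD
    refine ⟨max D M, fun U hU x y h => ?_⟩
    obtain ⟨P, hP, hP'⟩ := hM U hU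
    by_cases hx : P x
    · by_cases hy : P y
      · exact (hP x y hx hy h.sub_mem).trans (le_max_right _ _)
      · obtain ⟨W, hW, hW'⟩ := hP' y hy
        rw [norm_sub_rev]
        exact (hD W hW _ _ (hW' x (h.symm hH))).trans (le_max_left _ _)
    · obtain ⟨W, hW, hW'⟩ := hP' x hx
      exact (hD W hW _ _ (hW' y h)).trans (le_max_left _ _)

end Reach

section Paraboloid

variable {n : ℕ}

/-- The integer points of the paraboloid `k₀ = -|k|²` whose spatial part lies in `k₀ + W`. -/
def parab (W : Submodule ℝ (Fin n → ℝ)) (k₀ : Fin n → ℝ) : Set (Fin (n + 1) → ℤ) :=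
  {l | l 0 = -∑ i : Fin n, l i.succ ^ 2 ∧ (fun i : Fin n => (l i.succ : ℝ)) - k₀ ∈ W}

lemma Observable.mono {ι : Type*} [Fintype ι] {Λ Λ' : Set (ι → ℤ)} {r c : ℝ}
    (h : Observable Λ r c) (hs : Λ' ⊆ Λ) : Observable Λ' r c :=
  fun F hF a => h F (hF.trans hs) a

lemma Observable.empty {ι : Type*} [Fintype ι] (r c : ℝ) :
    Observable (∅ : Set (ι → ℤ)) r c := by
  intro F hF a
  have : F = ∅ := by simpa using hF
  simp [this]

/-- Uniform observability for the paraboloid restricted to affine subspaces. -/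
lemma exists_observable_parab (d : ℕ) : ∀ r : ℝ, 0 < r → r ≤ Real.pi → ∃ c : ℝ, 0 < c ∧
    ∀ W : Submodule ℝ (Fin n → ℝ), Module.finrank ℝ W ≤ d → ∀ k₀ : Fin n → ℝ,
      Observable (parab W k₀) r c := by
  classical
  induction d with
  | zero =>
    intro r hr hrπ
    obtain ⟨c, hc, h⟩ := Observable.union_finset (ι := Fin (n + 1)) (M := 1) (r := r) (r' := r / 2)
      (c := 1) (by linarith) (by linarith) hrπ one_pos
    refine ⟨c, hc, fun W hW k₀ => ?_⟩
    have hW' : W = ⊥ := Submodule.finrank_eq_zero.1 (Nat.le_zero.1 hW)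
    have huniq : ∀ l ∈ parab W k₀, ∀ l' ∈ parab W k₀, l = l' := by
      intro l hl l' hl'
      have h1 := hl.2
      have h2 := hl'.2
      rw [hW', Submodule.mem_bot, sub_eq_zero] at h1 h2
      have h3 : ∀ i : Fin n, l i.succ = l' i.succ := fun i => by
        have := congrFun (h1.trans h2.symm) i
        exact_mod_cast this
      ext i
      refine Fin.cases ?_ h3 i
      rw [hl.1, hl'.1]
      simp_rw [h3]
    rcases (parab W k₀).eq_empty_or_nonempty with he | ⟨l, hl⟩
    · rw [he]; exact Observable.empty r c
    · refine (h ∅ {l} (by simp) (Observable.empty _ _)).mono fun l' hl' => ?_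
      right
      simpa using huniq l' hl' l hl
  | succ d ih =>
    intro r hr hrπ
    obtain ⟨c, hc, hobs⟩ := ih (r / 4) (by linarith) (by linarith)
    obtain ⟨S, c₁, hc₁, hS⟩ := Observable.of_classes (ι := Fin (n + 1)) (r := r / 2) (c := c)
      (by linarith) hc
    rw [show r / 2 / 2 = r / 4 by ring] at hS
    set tl : (Fin (n + 1) → ℤ) → (Fin n → ℝ) := fun l i => (l i.succ : ℝ) with htl
    set H : Finset (Fin n → ℝ) := S.image tl ∪ S.image fun l => -tl l with hH
    have hHsymm : ∀ h ∈ H, -h ∈ H := by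
      intro h hh
      rcases Finset.mem_union.1 hh with hh | hh
      · obtain ⟨l, hl, rfl⟩ := Finset.mem_image.1 hh
        exact Finset.mem_union_right _ (Finset.mem_image_of_mem (fun l => -tl l) hl)
      · obtain ⟨l, hl, rfl⟩ := Finset.mem_image.1 hh
        rw [neg_neg]
        exact Finset.mem_union_left _ (Finset.mem_image_of_mem tl hl)
    set R : ℝ := ∑ s ∈ S, (|(s 0 : ℝ)| + tl s ⬝ᵥ tl s) with hR
    have hsq0 : ∀ x : Fin n → ℝ, 0 ≤ x ⬝ᵥ x := fun x =>
      Finset.sum_nonneg fun i _ => mul_self_nonneg _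
    have hRle : ∀ s ∈ S, |(s 0 : ℝ)| + tl s ⬝ᵥ tl s ≤ R := fun s hs =>
      Finset.single_le_sum (f := fun s => |(s 0 : ℝ)| + tl s ⬝ᵥ tl s)
        (fun s _ => add_nonneg (abs_nonneg _) (hsq0 _)) hs
    obtain ⟨D, hD⟩ := exists_reach_bound hHsymm R d
    obtain ⟨M, hM0, hM⟩ := exists_exceptional_bound H hD
    set box : Finset (Fin n → ℤ) := Fintype.piFinset fun _ => Finset.Icc (-⌊M⌋) ⌊M⌋ with hbox
    obtain ⟨c₂, hc₂, hadd⟩ := Observable.union_finset (ι := Fin (n + 1)) (M := box.card) (r := r)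
      (r' := r / 2) (c := c₁) (by linarith) (by linarith) hrπ hc₁
    refine ⟨c₂, hc₂, fun W hW k₀ => ?_⟩
    obtain ⟨P, hP, hP'⟩ := hM W hW
    set Λ := parab W k₀ with hΛ
    have hdiff : ∀ l ∈ Λ, ∀ l' ∈ Λ, tl l' - tl l ∈ W := fun l hl l' hl' => by
      have := W.sub_mem hl'.2 hl.2
      simpa using this
    have htime : ∀ l ∈ Λ, (l 0 : ℝ) = -(tl l ⬝ᵥ tl l) := fun l hl => by
      rw [hl.1]
      push_cast
      simp only [htl, dotProduct, sq]
    have hE : ∃ E : Finset (Fin (n + 1) → ℤ), E.card ≤ box.card ∧ ∀ l ∈ Λ, P (tl l) → l ∈ E := by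
      by_cases hex : ∃ e ∈ Λ, P (tl e)
      · obtain ⟨e, he, hPe⟩ := hex
        refine ⟨box.image fun u => Fin.cons (-∑ i, (e i.succ + u i) ^ 2) fun i => e i.succ + u i,
          Finset.card_image_le, fun l hl hPl => Finset.mem_image.2
            ⟨fun i => l i.succ - e i.succ, ?_, ?_⟩⟩
        · rw [hbox, Fintype.mem_piFinset]
          intro i
          have h1 := (norm_le_pi_norm _ i).trans (hP _ _ hPe hPl (hdiff e he l hl))
          simp only [htl, Pi.sub_apply, Real.norm_eq_abs] at h1
          have h2 := abs_le.1 h1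
          rw [Finset.mem_Icc]
          constructor
          · rw [neg_le, Int.le_floor]
            push_cast
            linarith [h2.1]
          · rw [Int.le_floor]
            push_cast
            exact h2.2
        · ext i
          refine Fin.cases ?_ (fun i => ?_) i
          · rw [hl.1]; simp
          · simp
      · exact ⟨∅, by simp, fun l hl hPl => (hex ⟨l, hl, hPl⟩).elim⟩
    obtain ⟨E, hEcard, hE⟩ := hE
    refine (hadd (Λ \ ↑E) E hEcard (hS (Λ \ ↑E)
      (fun l => {y : Fin n → ℝ | Reach H R W (tl l) y}) ?_ ?_)).mono fun l hl => ?_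
    · intro X
      rcases ((Λ \ ↑E) ∩ (fun l => {y : Fin n → ℝ | Reach H R W (tl l) y}) ⁻¹'
        {X}).eq_empty_or_nonempty with he | ⟨l, hl, hlX⟩
      · rw [he]; exact Observable.empty _ _
      · obtain ⟨W', hW', hreach⟩ := hP' (tl l) fun h => hl.2 (hE l hl.1 h)
        refine (hobs W' hW' (tl l)).mono fun l' hl' => ⟨hl'.1.1.1, ?_⟩
        refine (hreach (tl l') ?_).sub_mem
        have h1 : {y : Fin n → ℝ | Reach H R W (tl l') y} = {y | Reach H R W (tl l) y} :=
          hl'.2.trans hlX.symm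
        have h2 : tl l' ∈ {y : Fin n → ℝ | Reach H R W (tl l') y} := Relation.ReflTransGen.refl
        rw [h1] at h2
        exact h2
    · intro k hk l hl hkl
      have hreach : Reach H R W (tl k) (tl l) := by
        refine Relation.ReflTransGen.single ?_
        have h1 : tl l - tl k = -tl (k - l) := by
          ext i; simp [htl]
        have h2 := hRle _ hkl
        have h3 : ((k - l) 0 : ℝ) = tl l ⬝ᵥ tl l - tl k ⬝ᵥ tl k := by
          have := htime k hk.1
          have := htime l hl.1
          rw [Pi.sub_apply]; push_cast; linarith
        have h4 : tl (k - l) ⬝ᵥ tl (k - l) = (tl l - tl k) ⬝ᵥ (tl l - tl k) := by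
          rw [h1]; simp
        rw [h3, h4] at h2
        have h5 : (tl l - tl k) ⬝ᵥ (tl l - tl k) =
            tl l ⬝ᵥ (tl l - tl k) - tl k ⬝ᵥ (tl l - tl k) := sub_dotProduct _ _ _
        have h6 : tl l ⬝ᵥ tl l - tl k ⬝ᵥ tl k =
            tl l ⬝ᵥ (tl l - tl k) + tl k ⬝ᵥ (tl l - tl k) := by
          simp only [dotProduct_sub]; rw [dotProduct_comm (tl k) (tl l)]; ring
        have h7 := hsq0 (tl l - tl k)
        rw [h5] at h2 h7
        rw [h6] at h2
        refine ⟨?_, hdiff _ hk.1 _ hl.1, ?_, ?_⟩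
        · rw [h1]
          exact Finset.mem_union_right _ (Finset.mem_image_of_mem (fun l => -tl l) hkl)
        · have h8 := abs_le.1 (le_sub_iff_add_le.2 h2)
          rw [abs_le]; constructor <;> linarith [h8.1, h8.2]
        · have h8 := abs_le.1 (le_sub_iff_add_le.2 h2)
          rw [abs_le]; constructor <;> linarith [h8.1, h8.2]
      ext y
      exact ⟨fun h => (hreach.symm hHsymm).trans h, fun h => hreach.trans h⟩
    · by_cases h : l ∈ E
      · exact Or.inr h
      · exact Or.inl ⟨hl, h⟩

end Paraboloid

section Glue

variable {ι : Type*} [DecidableEq ι]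

/-- The point with `j`-th coordinate `t` and remaining coordinates `x`. -/
def glue (j : ι) (t : ℝ) (x : {i : ι // i ≠ j} → ℝ) : ι → ℝ :=
  fun i => if h : i = j then t else x ⟨i, h⟩

@[simp] lemma glue_self (j : ι) (t : ℝ) (x : {i : ι // i ≠ j} → ℝ) : glue j t x j = t := by
  simp [glue]

@[simp] lemma glue_ne (j : ι) (t : ℝ) (x : {i : ι // i ≠ j} → ℝ) (i : {i : ι // i ≠ j}) :
    glue j t x i = x i := by
  simp [glue, i.2]

lemma glue_of_ne {j i : ι} (h : i ≠ j) (t : ℝ) (x : {i : ι // i ≠ j} → ℝ) :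
    glue j t x i = x ⟨i, h⟩ := by
  simp [glue, h]

lemma update_glue (j : ι) (s t : ℝ) (x : {i : ι // i ≠ j} → ℝ) :
    Function.update (glue j t x) j s = glue j s x := by
  ext i
  by_cases h : i = j
  · subst h; simp
  · simp [h, glue_of_ne h]

lemma continuous_glue (j : ι) :
    Continuous fun z : ℝ × ({i : ι // i ≠ j} → ℝ) => glue j z.1 z.2 := by
  refine continuous_pi fun i => ?_
  by_cases h : i = j
  · subst h; simpa using continuous_fst
  · simp only [glue_of_ne h]; fun_prop

/-- Splitting off the `j`-th coordinate, as a measurable equivalence. -/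
noncomputable def splitAt (j : ι) : (ι → ℝ) ≃ᵐ ℝ × ({i : ι // i ≠ j} → ℝ) :=
  (MeasurableEquiv.piEquivPiSubtypeProd (fun _ : ι => ℝ) (fun i => i = j)).trans
    ((MeasurableEquiv.funUnique {i : ι // i = j} ℝ).prodCongr (MeasurableEquiv.refl _))

lemma splitAt_apply (j : ι) (y : ι → ℝ) :
    splitAt j y = (y j, fun i : {i : ι // i ≠ j} => y i) := rfl

lemma glue_splitAt (j : ι) (y : ι → ℝ) : glue j (splitAt j y).1 (splitAt j y).2 = y := by
  ext i
  by_cases h : i = j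
  · subst h; simp [splitAt_apply]
  · simp [glue_of_ne h, splitAt_apply]

lemma measurePreserving_splitAt [Fintype ι] (j : ι) : MeasurePreserving (splitAt (ι := ι) j) := by
  have h1 := volume_preserving_piEquivPiSubtypeProd (fun _ : ι => ℝ) (fun i => i = j)
  have h2 : MeasurePreserving ((MeasurableEquiv.funUnique {i : ι // i = j} ℝ).prodCongr
      (MeasurableEquiv.refl ({i : ι // ¬ i = j} → ℝ))) :=
    (volume_preserving_funUnique {i : ι // i = j} ℝ).prod
      (MeasurePreserving.id (volume : Measure ({i : ι // ¬ i = j} → ℝ)))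
  refine h1.trans ?_
  convert h2

/-- The set of points whose `j`-th coordinate is in `A` and other coordinates in `B`. -/
def cyl (j : ι) (A : Set ℝ) (B : Set ({i : ι // i ≠ j} → ℝ)) : Set (ι → ℝ) :=
  splitAt j ⁻¹' (A ×ˢ B)

lemma mem_cyl {j : ι} {A : Set ℝ} {B : Set ({i : ι // i ≠ j} → ℝ)} {y : ι → ℝ} :
    y ∈ cyl j A B ↔ y j ∈ A ∧ (fun i : {i : ι // i ≠ j} => y i) ∈ B := Iff.rfl

lemma Icc_eq_cyl (j : ι) (a b : ℝ) :
    Set.Icc (fun _ : ι => a) (fun _ => b) =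
      cyl j (Set.Icc a b) (Set.Icc (fun _ => a) (fun _ => b)) := by
  ext y
  simp only [mem_cyl, Set.mem_Icc, Pi.le_def, Subtype.forall]
  constructor
  · exact fun h => ⟨⟨h.1 j, h.2 j⟩, fun i _ => h.1 i, fun i _ => h.2 i⟩
  · rintro ⟨⟨h1, h2⟩, h3, h4⟩
    refine ⟨fun i => ?_, fun i => ?_⟩ <;> by_cases h : i = j
    · exact h ▸ h1
    · exact h3 i h
    · exact h ▸ h2
    · exact h4 i h

variable [Fintype ι] {E : Type*} [NormedAddCommGroup E]

lemma integrableOn_cyl_iff {j : ι} {A : Set ℝ} {B : Set ({i : ι // i ≠ j} → ℝ)}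
    {f : (ι → ℝ) → E} : IntegrableOn f (cyl j A B) ↔
      IntegrableOn (fun z : ℝ × ({i : ι // i ≠ j} → ℝ) => f (glue j z.1 z.2)) (A ×ˢ B) := by
  rw [cyl, ← (measurePreserving_splitAt j).integrableOn_comp_preimage
    (splitAt j).measurableEmbedding]
  have : (fun z : ℝ × ({i : ι // i ≠ j} → ℝ) => f (glue j z.1 z.2)) ∘ splitAt j = f := by
    ext y; simp [glue_splitAt]
  rw [this]

variable [NormedSpace ℝ E]

lemma setIntegral_cyl {j : ι} {A : Set ℝ} {B : Set ({i : ι // i ≠ j} → ℝ)}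
    {f : (ι → ℝ) → E} (hf : IntegrableOn f (cyl j A B)) :
    ∫ y in cyl j A B, f y = ∫ t in A, ∫ x in B, f (glue j t x) := by
  rw [← setIntegral_prod (fun z : ℝ × ({i : ι // i ≠ j} → ℝ) => f (glue j z.1 z.2))
    (integrableOn_cyl_iff.1 hf), ← Measure.volume_eq_prod,
    ← (measurePreserving_splitAt j).setIntegral_preimage_emb (splitAt j).measurableEmbedding]
  simp only [glue_splitAt, cyl]

lemma setIntegral_cyl_symm {j : ι} {A : Set ℝ} {B : Set ({i : ι // i ≠ j} → ℝ)}
    {f : (ι → ℝ) → E} (hf : IntegrableOn f (cyl j A B)) :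
    ∫ y in cyl j A B, f y = ∫ x in B, ∫ t in A, f (glue j t x) := by
  rw [setIntegral_cyl hf]
  refine integral_integral_swap (f := fun t x => f (glue j t x)) ?_
  rw [Measure.prod_restrict]
  exact integrableOn_cyl_iff.1 hf

/-- Fundamental theorem of calculus in one coordinate, integrated over a cube. -/
lemma setIntegral_cube_deriv [CompleteSpace E] (j : ι) {a b : ℝ} (hab : a ≤ b) {f f' : (ι → ℝ) → E}
    (hf' : Continuous f')
    (hd : ∀ y, HasDerivAt (fun s => f (Function.update y j s)) (f' y) (y j)) :
    ∫ y in Set.Icc (fun _ : ι => a) (fun _ => b), f' y =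
      ∫ x in Set.Icc (fun _ : {i : ι // i ≠ j} => a) (fun _ => b),
        (f (glue j b x) - f (glue j a x)) := by
  have h_int : IntegrableOn f' (Set.Icc (fun _ : ι => a) (fun _ => b)) :=
    hf'.continuousOn.integrableOn_compact isCompact_Icc
  rw [Icc_eq_cyl j] at h_int ⊢
  rw [setIntegral_cyl_symm h_int]
  congr 1
  ext x
  rw [integral_Icc_eq_integral_Ioc, ← intervalIntegral.integral_of_le hab]
  refine intervalIntegral.integral_eq_sub_of_hasDerivAt (f := fun t => f (glue j t x))
    (fun t _ => ?_) ?_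
  · have := hd (glue j t x)
    simp only [update_glue, glue_self] at this
    exact this
  · refine Continuous.intervalIntegrable ?_ _ _
    exact hf'.comp ((continuous_glue j).comp (by fun_prop : Continuous fun t : ℝ => (t, x)))

end Glue

/-- Translated and reindexed form of `Observable`. -/
lemma Observable.le_integral_translate {ι κ : Type*} [Fintype ι] {Λ : Set (ι → ℤ)} {r c : ℝ}
    (h : Observable Λ r c) (y₀ : ι → ℝ) (F : Finset κ) (k : κ → ι → ℤ)
    (hinj : Set.InjOn k F) (hk : ∀ x ∈ F, k x ∈ Λ) (a : κ → ℂ) :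
    c * ∑ x ∈ F, ‖a x‖ ^ 2 ≤
      ∫ y in Set.Icc (fun i => y₀ i - r) (fun i => y₀ i + r), ‖∑ x ∈ F, a x * expo (k x) y‖ ^ 2 := by
  classical
  rcases isEmpty_or_nonempty κ with hκ | hκ
  · have : F = ∅ := Finset.eq_empty_of_isEmpty F
    simp [this]
  set b : (ι → ℤ) → ℂ := fun l =>
    a (Function.invFunOn k F l) * expo (k (Function.invFunOn k F l)) y₀ with hb
  have hb' : ∀ x ∈ F, b (k x) = a x * expo (k x) y₀ := fun x hx => by
    simp only [hb, hinj.leftInvOn_invFunOn (Finset.mem_coe.2 hx)]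
  have h1 := h (F.image k) (fun l hl => by
    obtain ⟨x, hx, rfl⟩ := Finset.mem_image.1 (Finset.mem_coe.1 hl)
    exact hk x hx) b
  rw [Finset.sum_image hinj] at h1
  simp_rw [Finset.sum_image hinj] at h1
  have h2 : ∑ x ∈ F, ‖b (k x)‖ ^ 2 = ∑ x ∈ F, ‖a x‖ ^ 2 :=
    Finset.sum_congr rfl fun x hx => by rw [hb' x hx, norm_mul, norm_expo, mul_one]
  have h3 : ∀ y, ∑ x ∈ F, b (k x) * expo (k x) y = ∑ x ∈ F, a x * expo (k x) (y + y₀) := fun y =>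
    Finset.sum_congr rfl fun x hx => by rw [hb' x hx, expo_add_right]; ring
  rw [h2] at h1
  simp_rw [h3] at h1
  refine h1.trans_eq ?_
  rw [← (measurePreserving_add_right volume y₀).setIntegral_preimage_emb
    (measurableEmbedding_addRight y₀) (fun y => ‖∑ x ∈ F, a x * expo (k x) y‖ ^ 2)]
  congr 2
  ext y
  simp only [cube, Set.mem_Icc, Set.mem_preimage, Pi.le_def, Pi.add_apply]
  refine and_congr (forall_congr' fun i => ?_) (forall_congr' fun i => ?_)
  · constructor <;> intro h <;> linarith
  · constructor <;> intro h <;> linarith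

/-- The squared length of an integer vector. -/
def nsq {ι : Type*} [Fintype ι] (q : ι → ℤ) : ℝ := ∑ i, (q i : ℝ) ^ 2

/-- The plane wave solution of the free Schrödinger equation with frequency `q`. -/
noncomputable def wave {ι : Type*} [Fintype ι] (q : ι → ℤ) (x : ι → ℝ) (t : ℝ) : ℂ :=
  expo q x * Complex.exp (-Complex.I * (nsq q : ℂ) * (t : ℂ))

/-- Finite superposition of plane waves. -/
noncomputable def waveSum {ι : Type*} [Fintype ι] (F : Finset (ι → ℤ)) (b : (ι → ℤ) → ℂ)
    (x : ι → ℝ) (t : ℝ) : ℂ := ∑ q ∈ F, b q * wave q x t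

@[fun_prop]
lemma continuous_waveSum {ι X : Type*} [Fintype ι] [TopologicalSpace X] (F : Finset (ι → ℤ))
    (b : (ι → ℤ) → ℂ) {f : X → ι → ℝ} {g : X → ℝ} (hf : Continuous f) (hg : Continuous g) :
    Continuous fun z => waveSum F b (f z) (g z) := by
  unfold waveSum wave expo
  fun_prop

/-- Internal observability of the free Schrödinger equation on boxes of any size. -/
lemma exists_internal_observability (n : ℕ) {r : ℝ} (hr : 0 < r) (hrπ : r ≤ Real.pi) :
    ∃ c : ℝ, 0 < c ∧ ∀ (t₀ : ℝ) (x₀ : Fin n → ℝ) (F : Finset (Fin n → ℤ)) (b : (Fin n → ℤ) → ℂ),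
      c * ∑ q ∈ F, ‖b q‖ ^ 2 ≤ ∫ t in Set.Icc (t₀ - r) (t₀ + r),
        ∫ x in Set.Icc (fun i => x₀ i - r) (fun i => x₀ i + r), ‖waveSum F b x t‖ ^ 2 := by
  obtain ⟨c, hc, h⟩ := exists_observable_parab (n := n) n r hr hrπ
  refine ⟨c, hc, fun t₀ x₀ F b => ?_⟩
  have h1 := (h ⊤ (by simp) 0).le_integral_translate (Fin.cons t₀ x₀) F
    (fun q : Fin n → ℤ => Fin.cons (-∑ i, q i ^ 2) q)
    (fun q _ q' _ hqq => by
      ext i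
      simpa using congrFun hqq i.succ)
    (fun q _ => by simp [parab]) b
  refine h1.trans_eq ?_
  have hw : ∀ (q : Fin n → ℤ) (z : ℝ × (Fin n → ℝ)),
      expo (Fin.cons (-∑ i, q i ^ 2) q : Fin (n + 1) → ℤ) (Fin.cons z.1 z.2) =
        wave q z.2 z.1 := by
    intro q z
    rw [wave, expo, expo, ← Complex.exp_add, Fin.sum_univ_succ]
    simp only [Fin.cons_zero, Fin.cons_succ, nsq]
    congr 1
    push_cast
    ring
  have hcont : Continuous fun z : ℝ × (Fin n → ℝ) => ‖waveSum F b z.2 z.1‖ ^ 2 := by fun_prop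
  have hprod := setIntegral_prod (μ := (volume : Measure ℝ)) (ν := (volume : Measure (Fin n → ℝ)))
    (fun z : ℝ × (Fin n → ℝ) => ‖waveSum F b z.2 z.1‖ ^ 2)
    (s := Set.Icc (t₀ - r) (t₀ + r)) (t := Set.Icc (fun i => x₀ i - r) (fun i => x₀ i + r))
    (hcont.continuousOn.integrableOn_compact (isCompact_Icc.prod isCompact_Icc))
  refine Eq.trans ?_ hprod
  rw [← Measure.volume_eq_prod]
  have hmp := (volume_preserving_piFinSuccAbove (fun _ : Fin (n + 1) => ℝ) 0).setIntegral_preimage_emb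
    (MeasurableEquiv.piFinSuccAbove (fun _ : Fin (n + 1) => ℝ) 0).measurableEmbedding
    (fun z : ℝ × (Fin n → ℝ) => ‖waveSum F b z.2 z.1‖ ^ 2)
    (Set.Icc (t₀ - r) (t₀ + r) ×ˢ Set.Icc (fun i => x₀ i - r) (fun i => x₀ i + r))
  refine Eq.trans ?_ hmp
  have he : ∀ y : Fin (n + 1) → ℝ,
      (MeasurableEquiv.piFinSuccAbove (fun _ : Fin (n + 1) => ℝ) 0) y = (y 0, fun i => y i.succ) :=
    fun y => rfl
  have hcons : ∀ y : Fin (n + 1) → ℝ, y = Fin.cons (y 0) fun i => y i.succ := fun y =>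
    (Fin.cons_self_tail y).symm
  have hset : Set.Icc (fun i => (Fin.cons t₀ x₀ : Fin (n + 1) → ℝ) i - r)
      (fun i => (Fin.cons t₀ x₀ : Fin (n + 1) → ℝ) i + r) =
      (MeasurableEquiv.piFinSuccAbove (fun _ : Fin (n + 1) => ℝ) 0) ⁻¹'
        (Set.Icc (t₀ - r) (t₀ + r) ×ˢ Set.Icc (fun i => x₀ i - r) (fun i => x₀ i + r)) := by
    ext y
    simp only [Set.mem_preimage, he, Set.mem_prod, Set.mem_Icc, Pi.le_def, Fin.forall_fin_succ,
      Fin.cons_zero, Fin.cons_succ]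
    tauto
  rw [hset]
  congr 1
  ext y
  simp only [he, waveSum]
  congr 2
  refine Finset.sum_congr rfl fun q _ => ?_
  rw [← hw q (y 0, fun i => y i.succ), ← hcons y]

section Rellich

variable {ι : Type*} [Fintype ι]

/-- Fourier coefficients of the `j`-th partial derivative. -/
noncomputable def coordCoeff (j : ι) (b : (ι → ℤ) → ℂ) (q : ι → ℤ) : ℂ := Complex.I * q j * b q

/-- Fourier coefficients of the derivative in direction `(1, …, 1)`. -/
noncomputable def diagCoeff (b : (ι → ℤ) → ℂ) (q : ι → ℤ) : ℂ :=
  Complex.I * (∑ j, (q j : ℂ)) * b q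

/-- Fourier coefficients of the time derivative. -/
noncomputable def timeCoeff (b : (ι → ℤ) → ℂ) (q : ι → ℤ) : ℂ := -Complex.I * nsq q * b q

variable (F : Finset (ι → ℤ)) (b : (ι → ℤ) → ℂ)

lemma waveSum_const_mul (c : ℂ) (x : ι → ℝ) (t : ℝ) :
    waveSum F (fun q => c * b q) x t = c * waveSum F b x t := by
  simp only [waveSum, Finset.mul_sum, mul_assoc]

lemma sum_waveSum {κ : Type*} (s : Finset κ) (a : κ → (ι → ℤ) → ℂ) (x : ι → ℝ) (t : ℝ) :
    ∑ k ∈ s, waveSum F (a k) x t = waveSum F (fun q => ∑ k ∈ s, a k q) x t := by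
  simp only [waveSum, Finset.sum_mul]
  exact Finset.sum_comm

lemma sum_coordCoeff (x : ι → ℝ) (t : ℝ) :
    ∑ j, waveSum F (coordCoeff j b) x t = waveSum F (diagCoeff b) x t := by
  rw [sum_waveSum]
  congr 1
  ext q
  simp only [coordCoeff, diagCoeff, Finset.mul_sum, Finset.sum_mul]

lemma coordCoeff_diagCoeff (i : ι) :
    coordCoeff i (diagCoeff b) = diagCoeff (coordCoeff i b) := by
  ext q; simp only [coordCoeff, diagCoeff]; ring

lemma diagCoeff_timeCoeff : diagCoeff (timeCoeff b) = timeCoeff (diagCoeff b) := by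
  ext q; simp only [diagCoeff, timeCoeff]; ring

lemma sum_coordCoeff_coordCoeff (x : ι → ℝ) (t : ℝ) :
    ∑ j, waveSum F (coordCoeff j (coordCoeff j b)) x t =
      -Complex.I * waveSum F (timeCoeff b) x t := by
  rw [sum_waveSum, ← waveSum_const_mul]
  congr 1
  ext q
  simp only [coordCoeff, timeCoeff, nsq]
  push_cast
  simp only [Finset.mul_sum, Finset.sum_mul]
  refine Finset.sum_congr rfl fun j _ => ?_
  ring

lemma hasDerivAt_waveSum_time (x : ι → ℝ) (t : ℝ) :
    HasDerivAt (fun t => waveSum F b x t) (waveSum F (timeCoeff b) x t) t := by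
  unfold waveSum
  refine HasDerivAt.fun_sum fun q _ => ?_
  have h1 : HasDerivAt (fun t : ℝ => (t : ℂ)) 1 t := Complex.ofRealCLM.hasDerivAt
  have h2 := (((h1.const_mul (-Complex.I * (nsq q : ℂ))).cexp).const_mul (expo q x)).const_mul (b q)
  refine h2.congr_deriv ?_
  simp only [timeCoeff, wave]
  ring

variable [DecidableEq ι]

lemma hasDerivAt_sum_update (y : ι → ℝ) (j : ι) (f : ι → ℂ) (s : ℝ) :
    HasDerivAt (fun s : ℝ => ∑ i, f i * (Function.update y j s i : ℂ)) (f j) s := by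
  have : ∀ i ∈ Finset.univ, HasDerivAt (fun s : ℝ => f i * (Function.update y j s i : ℂ))
      (if i = j then f i else 0) s := by
    intro i _
    by_cases h : i = j
    · subst h
      simp only [Function.update_self, if_true]
      simpa using (Complex.ofRealCLM.hasDerivAt (x := s)).const_mul (f i)
    · simp only [Function.update_of_ne h, h, if_false]
      exact hasDerivAt_const _ _
  have h2 := HasDerivAt.fun_sum this
  simpa using h2

lemma hasDerivAt_waveSum_coord (j : ι) (y : ι → ℝ) (t : ℝ) :
    HasDerivAt (fun s => waveSum F b (Function.update y j s) t)
      (waveSum F (coordCoeff j b) y t) (y j) := by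
  unfold waveSum
  refine HasDerivAt.fun_sum fun q _ => ?_
  have h2 := ((((hasDerivAt_sum_update y j (fun i => (q i : ℂ)) (y j)).const_mul
    Complex.I).cexp).mul_const (Complex.exp (-Complex.I * (nsq q : ℂ) * (t : ℂ)))).const_mul (b q)
  refine h2.congr_deriv ?_
  simp only [coordCoeff, wave, expo, Function.update_eq_self]
  ring

lemma HasDerivAt.mul_conj {f g : ℝ → ℂ} {f' g' : ℂ} {s : ℝ} (hf : HasDerivAt f f' s)
    (hg : HasDerivAt g g' s) :
    HasDerivAt (fun s => f s * conj (g s)) (f' * conj (g s) + f s * conj g') s :=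
  hf.mul (hg.star)

/-- The complex flux in direction `j` of the multiplier identity. -/
noncomputable def flux (ψ ψ' : ℝ → ℝ) (t : ℝ) (j : ι) (y : ι → ℝ) : ℂ :=
  (ψ (∑ i, y i) : ℂ) * (2 * (waveSum F (coordCoeff j b) y t * conj (waveSum F (diagCoeff b) y t)) -
    ∑ i, waveSum F (coordCoeff i b) y t * conj (waveSum F (coordCoeff i b) y t) -
    Complex.I * (waveSum F b y t * conj (waveSum F (timeCoeff b) y t))) +
  Fintype.card ι * ((ψ' (∑ i, y i) : ℂ) *
    (waveSum F b y t * conj (waveSum F (coordCoeff j b) y t)))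

/-- The derivative of `flux` in direction `j`. -/
noncomputable def fluxDeriv (ψ ψ' ψ'' : ℝ → ℝ) (t : ℝ) (j : ι) (y : ι → ℝ) : ℂ :=
  (ψ' (∑ i, y i) : ℂ) * (2 * (waveSum F (coordCoeff j b) y t * conj (waveSum F (diagCoeff b) y t)) -
    ∑ i, waveSum F (coordCoeff i b) y t * conj (waveSum F (coordCoeff i b) y t) -
    Complex.I * (waveSum F b y t * conj (waveSum F (timeCoeff b) y t))) +
  (ψ (∑ i, y i) : ℂ) *
    (2 * (waveSum F (coordCoeff j (coordCoeff j b)) y t * conj (waveSum F (diagCoeff b) y t) +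
      waveSum F (coordCoeff j b) y t * conj (waveSum F (coordCoeff j (diagCoeff b)) y t)) -
    ∑ i, (waveSum F (coordCoeff j (coordCoeff i b)) y t * conj (waveSum F (coordCoeff i b) y t) +
      waveSum F (coordCoeff i b) y t * conj (waveSum F (coordCoeff j (coordCoeff i b)) y t)) -
    Complex.I * (waveSum F (coordCoeff j b) y t * conj (waveSum F (timeCoeff b) y t) +
      waveSum F b y t * conj (waveSum F (coordCoeff j (timeCoeff b)) y t))) +
  Fintype.card ι * ((ψ'' (∑ i, y i) : ℂ) *
      (waveSum F b y t * conj (waveSum F (coordCoeff j b) y t)) +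
    (ψ' (∑ i, y i) : ℂ) *
      (waveSum F (coordCoeff j b) y t * conj (waveSum F (coordCoeff j b) y t) +
        waveSum F b y t * conj (waveSum F (coordCoeff j (coordCoeff j b)) y t)))

lemma hasDerivAt_comp_sum_update {ψ ψ' : ℝ → ℝ} (hψ : ∀ u, HasDerivAt ψ (ψ' u) u) (j : ι)
    (y : ι → ℝ) :
    HasDerivAt (fun s => (ψ (∑ i, Function.update y j s i) : ℂ)) (ψ' (∑ i, y i) : ℂ) (y j) := by
  have h1 : HasDerivAt (fun s => ∑ i, Function.update y j s i) 1 (y j) := by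
    have h := HasDerivAt.fun_sum (u := Finset.univ) fun i _ =>
      (hasDerivAt_pi.1 (hasDerivAt_update y j (y j))) i
    refine h.congr_deriv ?_
    simp [Pi.single_apply]
  have h2 := hψ (∑ i, Function.update y j (y j) i)
  have h3 := (h2.comp (y j) h1).ofReal_comp
  refine h3.congr_deriv ?_
  simp

lemma hasDerivAt_flux {ψ ψ' ψ'' : ℝ → ℝ} (hψ : ∀ u, HasDerivAt ψ (ψ' u) u)
    (hψ' : ∀ u, HasDerivAt ψ' (ψ'' u) u) (t : ℝ) (j : ι) (y : ι → ℝ) :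
    HasDerivAt (fun s => flux F b ψ ψ' t j (Function.update y j s))
      (fluxDeriv F b ψ ψ' ψ'' t j y) (y j) := by
  have hp := hasDerivAt_comp_sum_update hψ j y
  have hp' := hasDerivAt_comp_sum_update hψ' j y
  have hv := hasDerivAt_waveSum_coord F b j y t
  have hj := hasDerivAt_waveSum_coord F (coordCoeff j b) j y t
  have hD := hasDerivAt_waveSum_coord F (diagCoeff b) j y t
  have ht := hasDerivAt_waveSum_coord F (timeCoeff b) j y t
  have hi : ∀ i ∈ Finset.univ, _ := fun i _ =>
    (hasDerivAt_waveSum_coord F (coordCoeff i b) j y t).mul_conj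
      (hasDerivAt_waveSum_coord F (coordCoeff i b) j y t)
  have h := (hp.mul ((((hj.mul_conj hD).const_mul 2).sub (HasDerivAt.fun_sum hi)).sub
    ((hv.mul_conj ht).const_mul Complex.I))).add
    ((hp'.mul (hv.mul_conj hj)).const_mul (Fintype.card ι : ℂ))
  refine h.congr_deriv ?_
  simp only [fluxDeriv, Pi.sub_apply, Function.update_eq_self]

lemma re_sum_fluxDeriv (ψ ψ' ψ'' : ℝ → ℝ) (t : ℝ) (y : ι → ℝ) :
    (∑ j, fluxDeriv F b ψ ψ' ψ'' t j y).re =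
      2 * ψ' (∑ i, y i) * ‖waveSum F (diagCoeff b) y t‖ ^ 2 +
      Fintype.card ι * (ψ'' (∑ i, y i) *
        (waveSum F b y t * conj (waveSum F (diagCoeff b) y t)).re) +
      ψ (∑ i, y i) * (waveSum F (timeCoeff b) y t * conj (waveSum F (diagCoeff b) y t) +
        waveSum F b y t * conj (waveSum F (timeCoeff (diagCoeff b)) y t)).im := by
  have hA := sum_coordCoeff F b y t
  have hC : ∀ i, ∑ j, waveSum F (coordCoeff j (coordCoeff i b)) y t =
      waveSum F (coordCoeff i (diagCoeff b)) y t := fun i => by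
    rw [sum_coordCoeff, coordCoeff_diagCoeff]
  have hL := sum_coordCoeff_coordCoeff F b y t
  have hE : ∑ j, waveSum F (coordCoeff j (timeCoeff b)) y t =
      waveSum F (timeCoeff (diagCoeff b)) y t := by
    rw [sum_coordCoeff, diagCoeff_timeCoeff]
  have hdouble : ∑ j, ∑ i, (waveSum F (coordCoeff j (coordCoeff i b)) y t *
      conj (waveSum F (coordCoeff i b) y t) +
      waveSum F (coordCoeff i b) y t * conj (waveSum F (coordCoeff j (coordCoeff i b)) y t)) =
      ∑ i, (waveSum F (coordCoeff i (diagCoeff b)) y t * conj (waveSum F (coordCoeff i b) y t) +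
      waveSum F (coordCoeff i b) y t * conj (waveSum F (coordCoeff i (diagCoeff b)) y t)) := by
    rw [Finset.sum_comm]
    refine Finset.sum_congr rfl fun i _ => ?_
    rw [Finset.sum_add_distrib, ← Finset.sum_mul, ← Finset.mul_sum, ← map_sum, hC]
  simp only [fluxDeriv, Finset.sum_add_distrib, ← Finset.mul_sum, Finset.sum_sub_distrib] at hdouble ⊢
  rw [hdouble]
  simp only [← Finset.sum_mul, ← map_sum, hA, hL, hE, Finset.sum_const, Finset.card_univ,
    nsmul_eq_mul, map_mul, map_neg, Complex.conj_I]
  generalize waveSum F (diagCoeff b) y t = A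
  generalize waveSum F (timeCoeff b) y t = vt
  generalize waveSum F (timeCoeff (diagCoeff b)) y t = E
  generalize waveSum F b y t = v
  have hre : (∑ i, waveSum F (coordCoeff i b) y t *
      conj (waveSum F (coordCoeff i (diagCoeff b)) y t)).re =
      (∑ i, waveSum F (coordCoeff i (diagCoeff b)) y t *
      conj (waveSum F (coordCoeff i b) y t)).re := by
    simp only [Complex.re_sum]
    refine Finset.sum_congr rfl fun i _ => ?_
    simp only [Complex.mul_re, Complex.conj_re, Complex.conj_im]
    ring
  generalize (∑ i, waveSum F (coordCoeff i b) y t *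
      conj (waveSum F (coordCoeff i (diagCoeff b)) y t)) = X at hre ⊢
  generalize (∑ i, waveSum F (coordCoeff i (diagCoeff b)) y t *
      conj (waveSum F (coordCoeff i b) y t)) = Y at hre ⊢
  generalize (∑ i, waveSum F (coordCoeff i b) y t * conj (waveSum F (coordCoeff i b) y t)) = Z
  rw [← Complex.normSq_eq_norm_sq, Complex.normSq_apply]
  simp
  rw [hre]
  ring

end Rellich

section IntegratedRellich

variable {ι : Type*} [Fintype ι] [DecidableEq ι] {F : Finset (ι → ℤ)} {b : (ι → ℤ) → ℂ}

/-- If a wave vanishes on the face `x_j = π`, so do its tangential derivatives. -/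
lemma waveSum_coordCoeff_eq_zero {c : ℝ} {j i : ι} (hij : i ≠ j)
    (h : ∀ x t, x j = c → waveSum F b x t = 0) {x : ι → ℝ} (hx : x j = c) (t : ℝ) :
    waveSum F (coordCoeff i b) x t = 0 := by
  have h1 := hasDerivAt_waveSum_coord F b i x t
  have h2 : HasDerivAt (fun s => waveSum F b (Function.update x i s) t) 0 (x i) := by
    have : ∀ s, waveSum F b (Function.update x i s) t = 0 := fun s =>
      h _ _ (by rw [Function.update_of_ne hij.symm, hx])
    simp only [this]; exact hasDerivAt_const _ _
  exact h1.unique h2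

lemma waveSum_diagCoeff_eq {c : ℝ} {j : ι} (h : ∀ x t, x j = c → waveSum F b x t = 0)
    {x : ι → ℝ} (hx : x j = c) (t : ℝ) :
    waveSum F (diagCoeff b) x t = waveSum F (coordCoeff j b) x t := by
  rw [← sum_coordCoeff]
  exact Finset.sum_eq_single j (fun i _ hi => waveSum_coordCoeff_eq_zero hi h hx t) (by simp)

lemma re_flux_of_eq_zero {c : ℝ} {j : ι} (h : ∀ x t, x j = c → waveSum F b x t = 0)
    {x : ι → ℝ} (hx : x j = c) (ψ ψ' : ℝ → ℝ) (t : ℝ) :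
    (flux F b ψ ψ' t j x).re = ψ (∑ i, x i) * ‖waveSum F (coordCoeff j b) x t‖ ^ 2 := by
  have hs : ∑ i, waveSum F (coordCoeff i b) x t * conj (waveSum F (coordCoeff i b) x t) =
      waveSum F (coordCoeff j b) x t * conj (waveSum F (coordCoeff j b) x t) :=
    Finset.sum_eq_single j
      (fun i _ hi => by rw [waveSum_coordCoeff_eq_zero hi h hx t, zero_mul]) (by simp)
  rw [flux, hs, waveSum_diagCoeff_eq h hx, h x t hx, ← Complex.normSq_eq_norm_sq,
    Complex.normSq_apply]
  simp
  ring_nf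
  simp

lemma integral_re_sum_fluxDeriv {ψ ψ' ψ'' : ℝ → ℝ} (hψ : ∀ u, HasDerivAt ψ (ψ' u) u)
    (hψ' : ∀ u, HasDerivAt ψ' (ψ'' u) u) (hψ'' : Continuous ψ'')
    (hzero : ∀ u ≤ Fintype.card ι * Real.pi - Real.pi, ψ u = 0 ∧ ψ' u = 0)
    (hv : ∀ j x t, x j = Real.pi → waveSum F b x t = 0) (t : ℝ) :
    ∫ y in Set.Icc (fun _ : ι => 0) (fun _ => Real.pi),
        (∑ j, fluxDeriv F b ψ ψ' ψ'' t j y).re =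
      ∑ j, ∫ x in Set.Icc (fun _ : {i : ι // i ≠ j} => 0) (fun _ => Real.pi),
        ψ (∑ i, glue j Real.pi x i) *
          ‖waveSum F (coordCoeff j b) (glue j Real.pi x) t‖ ^ 2 := by
  have hcψ : Continuous ψ := continuous_iff_continuousAt.2 fun u => (hψ u).continuousAt
  have hcψ' : Continuous ψ' := continuous_iff_continuousAt.2 fun u => (hψ' u).continuousAt
  have hc : ∀ j, Continuous fun y => (fluxDeriv F b ψ ψ' ψ'' t j y).re := by
    intro j
    unfold fluxDeriv waveSum wave expo
    fun_prop
  simp only [Complex.re_sum]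
  rw [integral_finsetSum]
  swap
  · intro j _
    exact (hc j).continuousOn.integrableOn_compact isCompact_Icc
  refine Finset.sum_congr rfl fun j _ => ?_
  rw [setIntegral_cube_deriv j Real.pi_pos.le (hc j)
    (f := fun y => (flux F b ψ ψ' t j y).re)]
  · refine setIntegral_congr_fun measurableSet_Icc fun x hx => ?_
    have h0 : (flux F b ψ ψ' t j (glue j 0 x)).re = 0 := by
      have hle : ∑ i, glue j 0 x i ≤ Fintype.card ι * Real.pi - Real.pi := by
        have : ∀ i ∈ Finset.univ, glue j 0 x i ≤ Real.pi - if i = j then Real.pi else 0 := by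
          intro i _
          by_cases h : i = j
          · subst h; simp
          · simpa [glue_of_ne h, h] using hx.2 ⟨i, h⟩
        refine (Finset.sum_le_sum this).trans_eq ?_
        simp
      obtain ⟨h1, h2⟩ := hzero _ hle
      simp [flux, h1, h2]
    simp only [h0, sub_zero]
    exact re_flux_of_eq_zero (hv j) (glue_self _ _ _) _ _ _
  · intro y
    exact Complex.reCLM.hasFDerivAt.comp_hasDerivAt _ (hasDerivAt_flux F b hψ hψ' t j y)

/-- The integrated multiplier identity for waves vanishing on the faces `x_j = π`. -/
lemma integral_multiplier_eq {ψ ψ' ψ'' : ℝ → ℝ} (hψ : ∀ u, HasDerivAt ψ (ψ' u) u)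
    (hψ' : ∀ u, HasDerivAt ψ' (ψ'' u) u) (hψ'' : Continuous ψ'')
    (hzero : ∀ u ≤ Fintype.card ι * Real.pi - Real.pi, ψ u = 0 ∧ ψ' u = 0)
    (hv : ∀ j x t, x j = Real.pi → waveSum F b x t = 0) {T : ℝ} (hT : 0 ≤ T) :
    (∫ t in Set.Icc 0 T, ∫ y in Set.Icc (fun _ : ι => 0) (fun _ => Real.pi),
        2 * ψ' (∑ i, y i) * ‖waveSum F (diagCoeff b) y t‖ ^ 2) +
      (∫ t in Set.Icc 0 T, ∫ y in Set.Icc (fun _ : ι => 0) (fun _ => Real.pi),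
        Fintype.card ι * (ψ'' (∑ i, y i) *
        (waveSum F b y t * conj (waveSum F (diagCoeff b) y t)).re)) +
      ((∫ y in Set.Icc (fun _ : ι => 0) (fun _ => Real.pi),
        ψ (∑ i, y i) * (waveSum F b y T * conj (waveSum F (diagCoeff b) y T)).im) -
      (∫ y in Set.Icc (fun _ : ι => 0) (fun _ => Real.pi),
        ψ (∑ i, y i) * (waveSum F b y 0 * conj (waveSum F (diagCoeff b) y 0)).im)) =
      ∫ t in Set.Icc 0 T, ∑ j,
        ∫ x in Set.Icc (fun _ : {i : ι // i ≠ j} => 0) (fun _ => Real.pi),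
        ψ (∑ i, glue j Real.pi x i) *
          ‖waveSum F (coordCoeff j b) (glue j Real.pi x) t‖ ^ 2 := by
  have hcψ : Continuous ψ := continuous_iff_continuousAt.2 fun u => (hψ u).continuousAt
  have hcψ' : Continuous ψ' := continuous_iff_continuousAt.2 fun u => (hψ' u).continuousAt
  have hy : ∀ {f : (ι → ℝ) → ℝ}, Continuous f →
      IntegrableOn f (Set.Icc (fun _ : ι => 0) (fun _ => Real.pi)) := fun hf =>
    hf.continuousOn.integrableOn_compact isCompact_Icc
  have ht : ∀ {f : ℝ × (ι → ℝ) → ℝ}, Continuous f →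
      Integrable f ((volume.restrict (Set.Icc 0 T)).prod
        (volume.restrict (Set.Icc (fun _ : ι => 0) (fun _ => Real.pi)))) := fun hf => by
    rw [Measure.prod_restrict]
    exact hf.continuousOn.integrableOn_compact (isCompact_Icc.prod isCompact_Icc)
  have c1 : Continuous fun z : ℝ × (ι → ℝ) =>
      2 * ψ' (∑ i, z.2 i) * ‖waveSum F (diagCoeff b) z.2 z.1‖ ^ 2 := by
    unfold waveSum wave expo; fun_prop
  have c2 : Continuous fun z : ℝ × (ι → ℝ) => Fintype.card ι * (ψ'' (∑ i, z.2 i) *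
        (waveSum F b z.2 z.1 * conj (waveSum F (diagCoeff b) z.2 z.1)).re) := by
    unfold waveSum wave expo; fun_prop
  have c3 : Continuous fun z : ℝ × (ι → ℝ) => ψ (∑ i, z.2 i) *
      (waveSum F (timeCoeff b) z.2 z.1 * conj (waveSum F (diagCoeff b) z.2 z.1) +
        waveSum F b z.2 z.1 * conj (waveSum F (timeCoeff (diagCoeff b)) z.2 z.1)).im := by
    unfold waveSum wave expo; fun_prop
  have c4 : ∀ s, Continuous fun y : ι → ℝ => ψ (∑ i, y i) *
      (waveSum F b y s * conj (waveSum F (diagCoeff b) y s)).im := by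
    intro s; unfold waveSum wave expo; fun_prop
  have htime : (∫ t in Set.Icc 0 T, ∫ y in Set.Icc (fun _ : ι => 0) (fun _ => Real.pi),
      ψ (∑ i, y i) * (waveSum F (timeCoeff b) y t * conj (waveSum F (diagCoeff b) y t) +
        waveSum F b y t * conj (waveSum F (timeCoeff (diagCoeff b)) y t)).im) =
      (∫ y in Set.Icc (fun _ : ι => 0) (fun _ => Real.pi),
        ψ (∑ i, y i) * (waveSum F b y T * conj (waveSum F (diagCoeff b) y T)).im) -
      (∫ y in Set.Icc (fun _ : ι => 0) (fun _ => Real.pi),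
        ψ (∑ i, y i) * (waveSum F b y 0 * conj (waveSum F (diagCoeff b) y 0)).im) := by
    refine (integral_integral_swap (f := fun t y => ψ (∑ i, y i) *
      (waveSum F (timeCoeff b) y t * conj (waveSum F (diagCoeff b) y t) +
        waveSum F b y t * conj (waveSum F (timeCoeff (diagCoeff b)) y t)).im) (ht c3)).trans ?_
    rw [← integral_sub (hy (c4 T)) (hy (c4 0))]
    congr 1
    ext y
    rw [integral_Icc_eq_integral_Ioc, ← intervalIntegral.integral_of_le hT]
    refine intervalIntegral.integral_eq_sub_of_hasDerivAt
      (f := fun t => ψ (∑ i, y i) * (waveSum F b y t * conj (waveSum F (diagCoeff b) y t)).im)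
      (fun t _ => ?_) ?_
    · exact (Complex.imCLM.hasFDerivAt.comp_hasDerivAt _
        ((hasDerivAt_waveSum_time F b y t).mul_conj
          (hasDerivAt_waveSum_time F (diagCoeff b) y t))).const_mul _
    · exact Continuous.intervalIntegrable
        (c3.comp (by fun_prop : Continuous fun t : ℝ => (t, y))) _ _
  rw [← htime, ← integral_add (ht c1).integral_prod_left (ht c2).integral_prod_left,
    ← integral_add _ (ht c3).integral_prod_left]
  swap
  · exact (ht c1).integral_prod_left.add (ht c2).integral_prod_left
  congr 1
  ext t
  have k1 := hy (c1.comp (by fun_prop : Continuous fun y : ι → ℝ => (t, y)))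
  have k2 := hy (c2.comp (by fun_prop : Continuous fun y : ι → ℝ => (t, y)))
  have k3 := hy (c3.comp (by fun_prop : Continuous fun y : ι → ℝ => (t, y)))
  rw [← integral_re_sum_fluxDeriv hψ hψ' hψ'' hzero hv t]
  simp only [re_sum_fluxDeriv]
  refine Eq.symm ((integral_add (k1.add k2) k3).trans ?_)
  congr 1
  exact integral_add k1 k2

end IntegratedRellich

section HighFrequency

lemma hasDerivAt_max_pow (a : ℝ) (k : ℕ) (u : ℝ) :
    HasDerivAt (fun u => max (u - a) 0 ^ (k + 2)) ((k + 2) * max (u - a) 0 ^ (k + 1)) u := by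
  have hne : ∀ y, y ≠ a →
      HasDerivAt (fun u => max (u - a) 0 ^ (k + 2)) ((k + 2) * max (y - a) 0 ^ (k + 1)) y := by
    intro y hy
    rcases lt_or_gt_of_ne hy with h | h
    · have h1 : (fun u => max (u - a) 0 ^ (k + 2)) =ᶠ[nhds y] fun _ => 0 := by
        filter_upwards [gt_mem_nhds h] with z hz
        rw [max_eq_right (by linarith)]; simp
      rw [max_eq_right (by linarith)]
      simpa using (hasDerivAt_const y (0 : ℝ)).congr_of_eventuallyEq h1
    · have h1 : (fun u => max (u - a) 0 ^ (k + 2)) =ᶠ[nhds y] fun u => (u - a) ^ (k + 2) := by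
        filter_upwards [lt_mem_nhds h] with z hz
        rw [max_eq_left (by linarith)]
      rw [max_eq_left (by linarith)]
      refine (((hasDerivAt_id y).sub_const a).pow (k + 2)).congr_of_eventuallyEq h1 |>.congr_deriv ?_
      simp
  by_cases h : u = a
  · subst h
    refine hasDerivAt_of_hasDerivAt_of_ne' (g := fun y => (k + 2) * max (y - u) 0 ^ (k + 1))
      hne ?_ ?_ u
    · exact (by fun_prop : Continuous fun u_1 => max (u_1 - u) 0 ^ (k + 2)).continuousAt
    · exact (by fun_prop : Continuous fun y => (k + 2) * max (y - u) 0 ^ (k + 1)).continuousAt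
  · exact hne u h

/-- The part of a face of the cube `(0, π)^n` close to the vertex `(π, …, π)`. -/
def faceNear {n : ℕ} (ε : ℝ) (j : Fin n) (σ : ℝ) : Set ({i : Fin n // i ≠ j} → ℝ) :=
  {x' | (∀ i, x' i ∈ Set.Ioo 0 Real.pi) ∧ (n : ℝ) * Real.pi - ε < σ + ∑ i, x' i}

lemma measurableSet_faceNear {n : ℕ} (ε : ℝ) (j : Fin n) (σ : ℝ) :
    MeasurableSet (faceNear ε j σ) := by
  refine IsOpen.measurableSet ?_
  simp only [faceNear, Set.ofPred_and, Set.ofPred_forall, Set.mem_Ioo]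
  refine (isOpen_iInter_of_finite fun i => ?_).inter ?_
  · exact (isOpen_lt continuous_const (continuous_apply i)).inter
      (isOpen_lt (continuous_apply i) continuous_const)
  · exact isOpen_lt continuous_const (by fun_prop)

lemma faceNear_subset_Icc {n : ℕ} (ε : ℝ) (j : Fin n) (σ : ℝ) :
    faceNear ε j σ ⊆ Set.Icc (fun _ => 0) (fun _ => Real.pi) := fun _ hx =>
  ⟨fun i => (hx.1 i).1.le, fun i => (hx.1 i).2.le⟩

lemma sum_glue {ι : Type*} [Fintype ι] [DecidableEq ι] (j : ι) (t : ℝ) (x : {i : ι // i ≠ j} → ℝ) :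
    ∑ i, glue j t x i = t + ∑ i, x i := by
  simp [Fintype.sum_eq_add_sum_subtype_ne _ j]

lemma integral_face_weight_le {n : ℕ} {ε : ℝ} (hε : 0 < ε) (j : Fin n)
    {f : ({i : Fin n // i ≠ j} → ℝ) → ℝ} (hf : Continuous f) (hf0 : ∀ x, 0 ≤ f x) :
    ∫ x in Set.Icc (fun _ : {i : Fin n // i ≠ j} => 0) (fun _ => Real.pi),
        max (∑ i, glue j Real.pi x i - (n * Real.pi - ε)) 0 ^ 3 * f x ≤
      ε ^ 3 * ∫ x in faceNear ε j Real.pi, f x := by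
  have hsub : faceNear ε j Real.pi ⊆ Set.univ.pi fun _ => Set.Ioo 0 Real.pi :=
    fun x hx i _ => hx.1 i
  have hae : (Set.univ.pi fun _ : {i : Fin n // i ≠ j} => Set.Ioo 0 Real.pi) =ᵐ[volume]
      Set.Icc (fun _ : {i : Fin n // i ≠ j} => (0 : ℝ)) (fun _ => Real.pi) :=
    Measure.univ_pi_Ioo_ae_eq_Icc
  rw [← setIntegral_congr_set hae, ← integral_const_mul]
  rw [setIntegral_eq_of_subset_of_forall_sdiff_eq_zero
    (MeasurableSet.univ_pi fun _ => measurableSet_Ioo) hsub]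
  · refine setIntegral_mono_on ?_ ?_ (measurableSet_faceNear _ _ _) ?_
    · refine IntegrableOn.mono_set (t := Set.Icc (fun _ => 0) (fun _ => Real.pi)) ?_
        (faceNear_subset_Icc _ _ _)
      refine ContinuousOn.integrableOn_compact isCompact_Icc (Continuous.continuousOn ?_)
      simp only [sum_glue]
      fun_prop
    · refine IntegrableOn.mono_set (t := Set.Icc (fun _ => 0) (fun _ => Real.pi)) ?_
        (faceNear_subset_Icc _ _ _)
      exact ContinuousOn.integrableOn_compact isCompact_Icc (Continuous.continuousOn (by fun_prop))
    · intro x hx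
      refine mul_le_mul_of_nonneg_right ?_ (hf0 x)
      refine pow_le_pow_left₀ (le_max_right _ _) (max_le ?_ hε.le) _
      have hle : ∑ i, glue j Real.pi x i ≤ n * Real.pi := by
        have : ∀ i ∈ Finset.univ, glue j Real.pi x i ≤ Real.pi := by
          intro i _
          by_cases h : i = j
          · subst h; simp
          · rw [glue_of_ne h]; exact (hx.1 ⟨i, h⟩).2.le
        simpa using Finset.sum_le_sum this
      linarith
  · intro x hx
    have : ¬ (n * Real.pi - ε < Real.pi + ∑ i, x i) := fun h =>
      hx.2 ⟨fun i => hx.1 i (Set.mem_univ i), h⟩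
    rw [sum_glue, max_eq_right (by linarith)]
    simp

lemma mul_integral_integral_le {X : Type*} [TopologicalSpace X] [T2Space X]
    [SecondCountableTopology X]
    [MeasurableSpace X] [BorelSpace X] {μ : Measure X} [IsFiniteMeasureOnCompacts μ] [SFinite μ]
    {A A' : Set ℝ} {B B' : Set X} (hA : IsCompact A) (hA' : IsCompact A') (hB : IsCompact B)
    (hB' : IsCompact B') (hAA : A' ⊆ A) (hBB : B' ⊆ B) {κ : ℝ} {f g : ℝ → X → ℝ}
    (hf : Continuous (Function.uncurry f)) (hg : Continuous (Function.uncurry g))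
    (hf0 : ∀ t ∈ A, ∀ x ∈ B, 0 ≤ f t x) (h : ∀ t ∈ A', ∀ x ∈ B', κ * g t x ≤ f t x) :
    κ * ∫ t in A', ∫ x in B', g t x ∂μ ≤ ∫ t in A, ∫ x in B, f t x ∂μ := by
  have i1 : IntegrableOn (Function.uncurry f) (A ×ˢ B) (volume.prod μ) :=
    hf.continuousOn.integrableOn_compact (hA.prod hB)
  have i2 : IntegrableOn (Function.uncurry g) (A' ×ˢ B') (volume.prod μ) :=
    hg.continuousOn.integrableOn_compact (hA'.prod hB')
  have e1 := setIntegral_prod _ i1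
  have e2 := setIntegral_prod _ i2
  simp only [Function.uncurry_apply_pair] at e1 e2
  rw [← e1, ← e2, ← integral_const_mul]
  refine (setIntegral_mono_on (i2.const_mul κ) (i1.mono_set (Set.prod_mono hAA hBB))
    (hA'.measurableSet.prod hB'.measurableSet) fun z hz => h _ hz.1 _ hz.2).trans ?_
  refine setIntegral_mono_set i1 ?_ (Set.prod_mono hAA hBB).eventuallyLE
  refine (ae_restrict_iff' (hA.measurableSet.prod hB.measurableSet)).2
    (Filter.Eventually.of_forall fun z hz => hf0 _ hz.1 _ hz.2)

lemma norm_diagCoeff_sq {ι : Type*} [Fintype ι] (b : (ι → ℤ) → ℂ) (q : ι → ℤ) :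
    ‖diagCoeff b q‖ ^ 2 = (∑ j, (q j : ℝ)) ^ 2 * ‖b q‖ ^ 2 := by
  have : (∑ j, (q j : ℂ)) = ((∑ j, (q j : ℝ) : ℝ) : ℂ) := by push_cast; rfl
  rw [diagCoeff, this, norm_mul, norm_mul, Complex.norm_I, Complex.norm_real, one_mul, mul_pow,
    Real.norm_eq_abs, sq_abs]

lemma integral_norm_sq_waveSum_le {ι : Type*} [Fintype ι] (F : Finset (ι → ℤ))
    (b : (ι → ℤ) → ℂ) (t : ℝ) {s : Set (ι → ℝ)} (hs : s ⊆ cube ι Real.pi) :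
    ∫ y in s, ‖waveSum F b y t‖ ^ 2 ≤ (2 * Real.pi) ^ Fintype.card ι * ∑ q ∈ F, ‖b q‖ ^ 2 := by
  have h := integral_norm_sq_expo_le hs F
    (fun q => b q * Complex.exp (-Complex.I * (nsq q : ℂ) * (t : ℂ)))
  have hn : ∀ q : ι → ℤ, ‖Complex.exp (-Complex.I * (nsq q : ℂ) * (t : ℂ))‖ = 1 := by
    intro q
    rw [Complex.norm_exp]; simp
  simp only [norm_mul, hn, mul_one] at h
  refine (le_of_eq ?_).trans h
  congr 1; ext y
  congr 2
  simp only [waveSum, wave]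
  exact Finset.sum_congr rfl fun q _ => by ring

/-- Low order terms are small compared with the energy at high frequencies. -/
lemma abs_setIntegral_le_div {ι : Type*} [Fintype ι] {F : Finset (ι → ℤ)} {b : (ι → ℤ) → ℂ}
    {K : ℝ} (hK : 0 < K) (hF : ∀ q ∈ F, K ^ 2 ≤ nsq q)
    (hdiag : ∑ q ∈ F, (∑ j, (q j : ℝ)) ^ 2 * ‖b q‖ ^ 2 = ∑ q ∈ F, nsq q * ‖b q‖ ^ 2)
    {M : ℝ} (hM : 0 ≤ M) (t : ℝ) {s : Set (ι → ℝ)} (hs : IsCompact s) (hsub : s ⊆ cube ι Real.pi)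
    {g : (ι → ℝ) → ℝ}
    (hg : ∀ y ∈ s, |g y| ≤ M * (‖waveSum F b y t‖ * ‖waveSum F (diagCoeff b) y t‖)) :
    |∫ y in s, g y| ≤
      M * ((2 * Real.pi) ^ Fintype.card ι * ((∑ q ∈ F, nsq q * ‖b q‖ ^ 2) / K)) := by
  have i1 : IntegrableOn (fun y => ‖waveSum F b y t‖ ^ 2) s :=
    (by fun_prop : Continuous fun y => ‖waveSum F b y t‖ ^ 2).continuousOn.integrableOn_compact hs
  have i2 : IntegrableOn (fun y => ‖waveSum F (diagCoeff b) y t‖ ^ 2) s :=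
    (by fun_prop : Continuous fun y =>
      ‖waveSum F (diagCoeff b) y t‖ ^ 2).continuousOn.integrableOn_compact hs
  have h1 := integral_norm_sq_waveSum_le F b t hsub
  have h2 := integral_norm_sq_waveSum_le F (diagCoeff b) t hsub
  simp only [norm_diagCoeff_sq, hdiag] at h2
  set X := ∑ q ∈ F, nsq q * ‖b q‖ ^ 2
  have h3 : K ^ 2 * ∑ q ∈ F, ‖b q‖ ^ 2 ≤ X := by
    rw [Finset.mul_sum]
    exact Finset.sum_le_sum fun q hq => mul_le_mul_of_nonneg_right (hF q hq) (sq_nonneg _)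
  set P := (2 * Real.pi) ^ Fintype.card ι
  have hP : 0 < P := by have := Real.pi_pos; positivity
  have h4 : |∫ y in s, g y| ≤ ∫ y in s, M * (K / 2 * ‖waveSum F b y t‖ ^ 2 +
      1 / (2 * K) * ‖waveSum F (diagCoeff b) y t‖ ^ 2) := by
    rw [← Real.norm_eq_abs]
    refine norm_integral_le_of_norm_le (((i1.const_mul _).add (i2.const_mul _)).const_mul _) ?_
    refine (ae_restrict_iff' hs.measurableSet).2 (Filter.Eventually.of_forall fun y hy => ?_)
    refine (hg y hy).trans (mul_le_mul_of_nonneg_left ?_ hM)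
    set p := ‖waveSum F b y t‖
    set d := ‖waveSum F (diagCoeff b) y t‖
    have : K / 2 * p ^ 2 + 1 / (2 * K) * d ^ 2 - p * d = (K * p - d) ^ 2 / (2 * K) := by
      field_simp; ring
    have h5 : 0 ≤ (K * p - d) ^ 2 / (2 * K) := by positivity
    linarith
  refine h4.trans ?_
  rw [integral_const_mul]
  refine mul_le_mul_of_nonneg_left ?_ hM
  rw [integral_add (i1.const_mul _) (i2.const_mul _), integral_const_mul, integral_const_mul]
  set S := ∑ q ∈ F, ‖b q‖ ^ 2
  have h6 : K / 2 * (P * S) ≤ P * X / (2 * K) := by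
    rw [le_div_iff₀ (by positivity)]
    nlinarith
  have h7 : P * (X / K) = P * X / (2 * K) + 1 / (2 * K) * (P * X) := by field_simp; ring
  rw [h7]
  gcongr
  exact (mul_le_mul_of_nonneg_left h1 (by positivity)).trans h6

end HighFrequency

/-- Boundary observability for waves vanishing on the faces `x_j = π` that contain only
high frequencies. -/
lemma exists_high_frequency_observability {n : ℕ} (hn : 0 < n) {T ε : ℝ} (hT : 0 < T)
    (hε : 0 < ε) (hεπ : ε < Real.pi) :
    ∃ K : ℝ, 0 < K ∧ ∃ C : ℝ, 0 < C ∧ ∀ (F : Finset (Fin n → ℤ)) (b : (Fin n → ℤ) → ℂ),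
      (∀ q ∈ F, K ^ 2 ≤ nsq q) →
      (∑ q ∈ F, (∑ j, (q j : ℝ)) ^ 2 * ‖b q‖ ^ 2 = ∑ q ∈ F, nsq q * ‖b q‖ ^ 2) →
      (∀ j x t, x j = Real.pi → waveSum F b x t = 0) →
      ∑ q ∈ F, nsq q * ‖b q‖ ^ 2 ≤ C * ∫ t in Set.Icc 0 T, ∑ j,
        ∫ x in faceNear ε j Real.pi, ‖waveSum F (coordCoeff j b) (glue j Real.pi x) t‖ ^ 2 := by
  have hπ := Real.pi_pos
  have hn1 : (1 : ℝ) ≤ n := by exact_mod_cast hn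
  obtain ⟨r, hr, hrT, hrε⟩ : ∃ r : ℝ, 0 < r ∧ r ≤ T / 2 ∧ n * (4 * r) ≤ ε := by
    refine ⟨min (T / 2) (ε / (4 * n)), by positivity, min_le_left _ _, ?_⟩
    calc n * (4 * min (T / 2) (ε / (4 * n))) ≤ n * (4 * (ε / (4 * n))) := by
          gcongr; exact min_le_right _ _
      _ = ε := by field_simp
  have h4r : 4 * r ≤ ε := by nlinarith
  obtain ⟨c, hc, hio⟩ := exists_internal_observability n hr (by linarith : r ≤ Real.pi)
  set κ : ℝ := 2 * (3 * (ε / 2) ^ 2) * c with hκ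
  have hκ0 : 0 < κ := by positivity
  set P : ℝ := (2 * Real.pi) ^ n with hP
  have hP0 : 0 < P := by positivity
  set M : ℝ := (T * (n * (6 * ε)) + 2 * ε ^ 3) * P with hM
  have hM0 : 0 < M := by positivity
  refine ⟨2 * M / κ, by positivity, 2 * ε ^ 3 / κ, by positivity, fun F b hF hdiag hv => ?_⟩
  set K : ℝ := 2 * M / κ with hKdef
  have hK : 0 < K := by positivity
  set X := ∑ q ∈ F, nsq q * ‖b q‖ ^ 2 with hX
  have hX0 : 0 ≤ X := Finset.sum_nonneg fun q _ =>
    mul_nonneg (Finset.sum_nonneg fun _ _ => sq_nonneg _) (sq_nonneg _)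
  set a : ℝ := n * Real.pi - ε with ha
  set ψ : ℝ → ℝ := fun u => max (u - a) 0 ^ 3 with hψ
  set ψ' : ℝ → ℝ := fun u => 3 * max (u - a) 0 ^ 2 with hψ'
  set ψ'' : ℝ → ℝ := fun u => 6 * max (u - a) 0 with hψ''
  have d1 : ∀ u, HasDerivAt ψ (ψ' u) u := fun u =>
    (hasDerivAt_max_pow a 1 u).congr_deriv (by simp only [hψ']; norm_num)
  have d2 : ∀ u, HasDerivAt ψ' (ψ'' u) u := fun u =>
    ((hasDerivAt_max_pow a 0 u).const_mul 3).congr_deriv (by simp only [hψ'']; norm_num; ring)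
  have cψ' : Continuous ψ' := by fun_prop
  have cψ'' : Continuous ψ'' := by fun_prop
  set W : Set (Fin n → ℝ) := Set.Icc (fun _ => 0) (fun _ => Real.pi) with hW
  have hWc : IsCompact W := isCompact_Icc
  have hWsub : W ⊆ cube (Fin n) Real.pi := Set.Icc_subset_Icc (fun _ => by simp [hπ.le]) le_rfl
  have hmax : ∀ y ∈ W, max (∑ i, y i - a) 0 ≤ ε := by
    intro y hy
    have : ∑ i, y i ≤ n * Real.pi := by
      simpa using Finset.sum_le_sum fun i (_ : i ∈ Finset.univ) => hy.2 i
    exact max_le (by linarith) hε.le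
  have hmax0 : ∀ y : Fin n → ℝ, 0 ≤ max (∑ i, y i - a) 0 := fun y => le_max_right _ _
  have key := integral_multiplier_eq (F := F) (b := b) d1 d2 cψ''
    (fun u hu => by
      have : u - a ≤ 0 := by simp only [Fintype.card_fin] at hu; linarith
      simp [hψ, hψ', max_eq_right this]) hv hT.le
  simp only [Fintype.card_fin] at key
  -- the main term
  have hmain : κ * X ≤ ∫ t in Set.Icc 0 T, ∫ y in W,
      2 * ψ' (∑ i, y i) * ‖waveSum F (diagCoeff b) y t‖ ^ 2 := by
    have h1 := hio (T / 2) (fun _ => Real.pi - r) F (diagCoeff b)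
    simp only [norm_diagCoeff_sq, hdiag] at h1
    rw [hκ, mul_assoc]
    refine (mul_le_mul_of_nonneg_left h1 (by positivity)).trans ?_
    refine mul_integral_integral_le isCompact_Icc isCompact_Icc hWc isCompact_Icc
      (Set.Icc_subset_Icc (by linarith) (by linarith))
      (Set.Icc_subset_Icc (fun i => by dsimp; linarith) (fun i => by dsimp; linarith)) ?_ ?_ ?_ ?_
    · unfold Function.uncurry; fun_prop
    · unfold Function.uncurry; fun_prop
    · intro t _ x _
      simp only [hψ']
      have := hmax0 x
      positivity
    · intro t _ x hx
      refine mul_le_mul_of_nonneg_right ?_ (sq_nonneg _)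
      simp only [hψ']
      have h2 : n * (Real.pi - 2 * r) ≤ ∑ i, x i := by
        have := Finset.sum_le_sum fun i (_ : i ∈ Finset.univ) => hx.1 i
        simp only [Finset.sum_const, Finset.card_univ, Fintype.card_fin, nsmul_eq_mul] at this
        linarith
      have h3 : ε / 2 ≤ max (∑ i, x i - a) 0 := le_max_of_le_left (by linarith)
      gcongr
  -- the lower order terms
  have hlow : |∫ t in Set.Icc 0 T, ∫ y in W, n * (ψ'' (∑ i, y i) *
        (waveSum F b y t * conj (waveSum F (diagCoeff b) y t)).re)| ≤
      T * (n * (6 * ε)) * (P * (X / K)) := by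
    have h1 : ∀ t, |∫ y in W, n * (ψ'' (∑ i, y i) *
        (waveSum F b y t * conj (waveSum F (diagCoeff b) y t)).re)| ≤
        n * (6 * ε) * (P * (X / K)) := by
      intro t
      have := abs_setIntegral_le_div hK hF hdiag (by positivity : 0 ≤ n * (6 * ε)) t hWc hWsub
        (g := fun y => n * (ψ'' (∑ i, y i) *
          (waveSum F b y t * conj (waveSum F (diagCoeff b) y t)).re)) (fun y hy => by
          have e1 : |(waveSum F b y t * conj (waveSum F (diagCoeff b) y t)).re| ≤
              ‖waveSum F b y t‖ * ‖waveSum F (diagCoeff b) y t‖ := by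
            refine (Complex.abs_re_le_norm _).trans_eq ?_
            rw [norm_mul, RCLike.norm_conj]
          have e2 : |ψ'' (∑ i, y i)| ≤ 6 * ε := by
            simp only [hψ'']
            rw [abs_of_nonneg (mul_nonneg (by norm_num) (hmax0 y))]
            exact mul_le_mul_of_nonneg_left (hmax y hy) (by norm_num)
          rw [abs_mul, abs_mul, Nat.abs_cast, mul_assoc]
          gcongr)
      simpa using this
    have h2 := norm_setIntegral_le_of_norm_le_const (μ := volume) (s := Set.Icc 0 T)
      (f := fun t => ∫ y in W, n * (ψ'' (∑ i, y i) *
        (waveSum F b y t * conj (waveSum F (diagCoeff b) y t)).re))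
      (C := n * (6 * ε) * (P * (X / K))) (by simp) (fun t _ => h1 t)
    rw [Real.norm_eq_abs] at h2
    refine h2.trans_eq ?_
    simp [hT.le]
    ring
  have hbd : ∀ t, |∫ y in W, ψ (∑ i, y i) *
      (waveSum F b y t * conj (waveSum F (diagCoeff b) y t)).im| ≤ ε ^ 3 * (P * (X / K)) := by
    intro t
    have := abs_setIntegral_le_div hK hF hdiag (by positivity : 0 ≤ ε ^ 3) t hWc hWsub
      (g := fun y => ψ (∑ i, y i) *
        (waveSum F b y t * conj (waveSum F (diagCoeff b) y t)).im) (fun y hy => by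
        have e1 : |(waveSum F b y t * conj (waveSum F (diagCoeff b) y t)).im| ≤
            ‖waveSum F b y t‖ * ‖waveSum F (diagCoeff b) y t‖ := by
          refine (Complex.abs_im_le_norm _).trans_eq ?_
          rw [norm_mul, RCLike.norm_conj]
        have e2 : |ψ (∑ i, y i)| ≤ ε ^ 3 := by
          simp only [hψ]
          rw [abs_of_nonneg (pow_nonneg (hmax0 y) _)]
          exact pow_le_pow_left₀ (hmax0 y) (hmax y hy) _
        rw [abs_mul]
        gcongr)
    simpa using this
  -- the boundary term
  have hface : (∫ t in Set.Icc 0 T, ∑ j,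
        ∫ x in Set.Icc (fun _ : {i : Fin n // i ≠ j} => 0) (fun _ => Real.pi),
        ψ (∑ i, glue j Real.pi x i) *
          ‖waveSum F (coordCoeff j b) (glue j Real.pi x) t‖ ^ 2) ≤
      ε ^ 3 * ∫ t in Set.Icc 0 T, ∑ j,
        ∫ x in faceNear ε j Real.pi, ‖waveSum F (coordCoeff j b) (glue j Real.pi x) t‖ ^ 2 := by
    have hg : ∀ j : Fin n, Continuous fun z : ℝ × ({i : Fin n // i ≠ j} → ℝ) =>
        glue j Real.pi z.2 := fun j =>
      (continuous_glue j).comp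
        (by fun_prop : Continuous fun z : ℝ × ({i : Fin n // i ≠ j} → ℝ) => (Real.pi, z.2))
    rw [← integral_const_mul]
    refine setIntegral_mono_on ?_ ?_ measurableSet_Icc fun t _ => ?_
    · refine integrable_finsetSum _ fun j _ => ?_
      have : Integrable (fun z : ℝ × ({i : Fin n // i ≠ j} → ℝ) =>
          ψ (∑ i, glue j Real.pi z.2 i) *
            ‖waveSum F (coordCoeff j b) (glue j Real.pi z.2) z.1‖ ^ 2)
          ((volume.restrict (Set.Icc 0 T)).prod
            (volume.restrict (Set.Icc (fun _ => 0) (fun _ => Real.pi)))) := by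
        rw [Measure.prod_restrict]
        refine ContinuousOn.integrableOn_compact (isCompact_Icc.prod isCompact_Icc)
          (Continuous.continuousOn ?_)
        have := hg j
        fun_prop
      exact this.integral_prod_left
    · refine Integrable.const_mul (integrable_finsetSum _ fun j _ => ?_) _
      have : Integrable (fun z : ℝ × ({i : Fin n // i ≠ j} → ℝ) =>
            ‖waveSum F (coordCoeff j b) (glue j Real.pi z.2) z.1‖ ^ 2)
          ((volume.restrict (Set.Icc 0 T)).prod (volume.restrict (faceNear ε j Real.pi))) := by
        rw [Measure.prod_restrict]
        refine IntegrableOn.mono_set (t := Set.Icc 0 T ×ˢ Set.Icc (fun _ => 0) (fun _ => Real.pi)) ?_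
          (Set.prod_mono le_rfl (faceNear_subset_Icc _ _ _))
        refine ContinuousOn.integrableOn_compact (isCompact_Icc.prod isCompact_Icc)
          (Continuous.continuousOn ?_)
        have := hg j
        fun_prop
      exact this.integral_prod_left
    · rw [Finset.mul_sum]
      refine Finset.sum_le_sum fun j _ => ?_
      have hc : Continuous fun x : {i : Fin n // i ≠ j} → ℝ => glue j Real.pi x :=
        (hg j).comp (by fun_prop : Continuous fun x : {i : Fin n // i ≠ j} → ℝ => ((0 : ℝ), x))
      exact integral_face_weight_le hε j
        (f := fun x => ‖waveSum F (coordCoeff j b) (glue j Real.pi x) t‖ ^ 2)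
        (by fun_prop) (fun x => sq_nonneg _)
  set O := ∫ t in Set.Icc 0 T, ∑ j,
        ∫ x in faceNear ε j Real.pi, ‖waveSum F (coordCoeff j b) (glue j Real.pi x) t‖ ^ 2
  have hMX : M * (X / K) = κ * X / 2 := by
    rw [hKdef]; field_simp
  have b1 := abs_le.1 hlow
  have b2 := abs_le.1 (hbd T)
  have b3 := abs_le.1 (hbd 0)
  have hfin : κ * X ≤ ε ^ 3 * O + M * (X / K) := by
    rw [hM]
    linarith [b1.1, b2.1, b3.2]
  rw [hMX] at hfin
  rw [div_mul_eq_mul_div, le_div_iff₀ hκ0]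
  linarith

section SineExpansion

variable {ι : Type*} {n : ℕ}

/-- The frequency obtained from a sine frequency `p` and a choice of signs `s`. -/
def signed (p : ι → ℕ+) (s : ι → ℤˣ) : ι → ℤ := fun i => (s i : ℤ) * (p i : ℤ)

lemma signed_injective :
    Function.Injective fun z : (ι → ℕ+) × (ι → ℤˣ) => signed z.1 z.2 := by
  rintro ⟨p, s⟩ ⟨p', s'⟩ h
  have h1 : ∀ i, (s i : ℤ) * (p i : ℤ) = (s' i : ℤ) * (p' i : ℤ) := fun i => congrFun h i
  have h2 : ∀ i, s i = s' i ∧ p i = p' i := by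
    intro i
    have hi := h1 i
    have hp := (p i).pos
    have hp' := (p' i).pos
    have e : p i = p' i ↔ ((p i : ℕ) : ℤ) = ((p' i : ℕ) : ℤ) := by
      rw [Nat.cast_inj, PNat.coe_inj]
    rw [e]
    rcases Int.units_eq_one_or (s i) with hs | hs <;>
      rcases Int.units_eq_one_or (s' i) with hs' | hs' <;> rw [hs, hs'] at hi ⊢ <;>
      simp at hi ⊢ <;> omega
  ext i
  · simp [(h2 i).2]
  · simp [(h2 i).1]

lemma nsq_signed (p : Fin n → ℕ+) (s : Fin n → ℤˣ) : nsq (signed p s) = pnorm2 p := by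
  unfold nsq pnorm2 signed
  refine Finset.sum_congr rfl fun i _ => ?_
  rcases Int.units_eq_one_or (s i) with hs | hs <;> simp [hs]

lemma sum_units_mul (i j : Fin n) :
    ∑ s : Fin n → ℤˣ, ((s i : ℤ) : ℝ) * ((s j : ℤ) : ℝ) = if i = j then 2 ^ n else 0 := by
  by_cases h : i = j
  · subst h
    have : ∀ s : Fin n → ℤˣ, ((s i : ℤ) : ℝ) * ((s i : ℤ) : ℝ) = 1 := by
      intro s
      rcases Int.units_eq_one_or (s i) with hs | hs <;> simp [hs]
    simp [this]
  · rw [if_neg h]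
    have h1 := Equiv.sum_comp (Equiv.mulLeft (Pi.mulSingle i (-1) : Fin n → ℤˣ))
      (fun s : Fin n → ℤˣ => ((s i : ℤ) : ℝ) * ((s j : ℤ) : ℝ))
    simp [Pi.mulSingle_eq_of_ne (Ne.symm h)] at h1
    linarith

lemma sum_signed_sq (p : Fin n → ℕ+) :
    ∑ s : Fin n → ℤˣ, (∑ j, (signed p s j : ℝ)) ^ 2 = 2 ^ n * pnorm2 p := by
  have : ∀ s : Fin n → ℤˣ, (∑ j, (signed p s j : ℝ)) ^ 2 =
      ∑ i, ∑ j, ((p i : ℝ) * (p j : ℝ)) * (((s i : ℤ) : ℝ) * ((s j : ℤ) : ℝ)) := by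
    intro s
    rw [sq, Finset.sum_mul_sum]
    refine Finset.sum_congr rfl fun i _ => Finset.sum_congr rfl fun j _ => ?_
    simp only [signed]; push_cast; ring
  simp only [this]
  rw [Finset.sum_comm]
  simp only [Finset.sum_comm (s := (Finset.univ : Finset (Fin n → ℤˣ))), ← Finset.mul_sum,
    sum_units_mul]
  simp only [mul_ite, mul_zero, Finset.sum_ite_eq, Finset.mem_univ, if_true, pnorm2,
    Finset.mul_sum]
  exact Finset.sum_congr rfl fun i _ => by ring

/-- The coefficient of `expo (signed p s)` in the product of sines of frequency `p`. -/
noncomputable def signCoeff [Fintype ι] (s : ι → ℤˣ) : ℂ := ∏ i, ((s i : ℤ) : ℂ) / (2 * Complex.I)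

lemma norm_signCoeff_sq [Fintype ι] (s : ι → ℤˣ) :
    ‖signCoeff s‖ ^ 2 = (1 / 4) ^ Fintype.card ι := by
  have : ∀ i, ‖((s i : ℤ) : ℂ) / (2 * Complex.I)‖ = 1 / 2 := by
    intro i
    rcases Int.units_eq_one_or (s i) with hs | hs <;> simp [hs]
  rw [signCoeff, norm_prod]
  simp only [this, Finset.prod_const, Finset.card_univ, ← pow_mul]
  rw [mul_comm _ 2, pow_mul]
  norm_num

lemma ofReal_sin_eq_sum (x : ℝ) : (Real.sin x : ℂ) =
    ∑ s : ℤˣ, ((s : ℤ) : ℂ) / (2 * Complex.I) * Complex.exp (Complex.I * ((s : ℤ) * x)) := by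
  rw [UnitsInt.univ, Finset.sum_pair (by decide), Complex.ofReal_sin, Complex.sin]
  simp only [Units.val_one, Int.cast_one, Units.val_neg, Int.cast_neg]
  have e1 : Complex.I * (-1 * (x : ℂ)) = -(x : ℂ) * Complex.I := by ring
  have e2 : Complex.I * (1 * (x : ℂ)) = (x : ℂ) * Complex.I := by ring
  rw [e1, e2]
  field_simp
  rw [Complex.I_sq]
  ring

lemma prod_sin_eq_sum [Fintype ι] [DecidableEq ι] (p : ι → ℕ+) (x : ι → ℝ) :
    ∏ i, (Real.sin ((p i : ℝ) * x i) : ℂ) =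
      ∑ s : ι → ℤˣ, signCoeff s * expo (signed p s) x := by
  simp only [ofReal_sin_eq_sum, Finset.prod_univ_sum, Fintype.piFinset_univ]
  refine Finset.sum_congr rfl fun s _ => ?_
  rw [Finset.prod_mul_distrib, signCoeff, expo, Finset.mul_sum, Complex.exp_sum]
  congr 1
  refine Finset.prod_congr rfl fun i _ => ?_
  simp only [signed]; push_cast; ring_nf

variable (F : Finset (Fin n → ℕ+)) (a : (Fin n → ℕ+) → ℂ)

/-- The set of plane wave frequencies of a finite sine sum. -/
def signedSet : Finset (Fin n → ℤ) :=
  (F ×ˢ (Finset.univ : Finset (Fin n → ℤˣ))).image fun z => signed z.1 z.2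

/-- The plane wave coefficients of a sine sum. -/
noncomputable def signedCoeff : (Fin n → ℤ) → ℂ :=
  Function.extend (fun z : (Fin n → ℕ+) × (Fin n → ℤˣ) => signed z.1 z.2)
    (fun z => a z.1 * signCoeff z.2) 0

lemma signedCoeff_signed (p : Fin n → ℕ+) (s : Fin n → ℤˣ) :
    signedCoeff a (signed p s) = a p * signCoeff s :=
  signed_injective.extend_apply (fun z => a z.1 * signCoeff z.2) 0 (p, s)

lemma sum_signedSet {M : Type*} [AddCommMonoid M] (h : (Fin n → ℤ) → M) :
    ∑ q ∈ signedSet F, h q = ∑ p ∈ F, ∑ s, h (signed p s) := by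
  rw [signedSet, Finset.sum_image signed_injective.injOn, Finset.sum_product]

lemma waveSum_signed (x : Fin n → ℝ) (t : ℝ) :
    waveSum (signedSet F) (signedCoeff a) x t =
      ∑ p ∈ F, a p * Complex.exp (-Complex.I * (pnorm2 p : ℂ) * (t : ℂ)) *
        ∏ i, (Real.sin ((p i : ℝ) * x i) : ℂ) := by
  rw [waveSum, sum_signedSet]
  refine Finset.sum_congr rfl fun p _ => ?_
  rw [prod_sin_eq_sum, Finset.mul_sum]
  refine Finset.sum_congr rfl fun s _ => ?_
  rw [signedCoeff_signed, wave, nsq_signed]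
  ring

lemma waveSum_signed_eq_zero (j : Fin n) (x : Fin n → ℝ) (t : ℝ) (hx : x j = Real.pi) :
    waveSum (signedSet F) (signedCoeff a) x t = 0 := by
  rw [waveSum_signed]
  refine Finset.sum_eq_zero fun p _ => ?_
  rw [Finset.prod_eq_zero (Finset.mem_univ j), mul_zero]
  rw [hx]
  exact_mod_cast Real.sin_nat_mul_pi (p j)

/-- The `j`-th partial derivative of a finite sine sum. -/
noncomputable def dSum (j : Fin n) (x : Fin n → ℝ) (t : ℝ) : ℂ :=
  ∑ p ∈ F, a p * Complex.exp (-Complex.I * (pnorm2 p : ℂ) * (t : ℂ)) *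
    ((p j : ℝ) : ℂ) * (Real.cos ((p j : ℝ) * x j) : ℂ) *
    ∏ i ∈ Finset.univ.erase j, (Real.sin ((p i : ℝ) * x i) : ℂ)

lemma waveSum_coordCoeff_signed (j : Fin n) (x : Fin n → ℝ) (t : ℝ) :
    waveSum (signedSet F) (coordCoeff j (signedCoeff a)) x t = dSum F a j x t := by
  have h1 := hasDerivAt_waveSum_coord (signedSet F) (signedCoeff a) j x t
  refine h1.unique ?_
  simp only [waveSum_signed]
  refine HasDerivAt.fun_sum fun p _ => ?_
  have h2 : ∀ s, ∏ i, (Real.sin ((p i : ℝ) * Function.update x j s i) : ℂ) =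
      (Real.sin ((p j : ℝ) * s) : ℂ) *
        ∏ i ∈ Finset.univ.erase j, (Real.sin ((p i : ℝ) * x i) : ℂ) := by
    intro s
    rw [← Finset.mul_prod_erase _ _ (Finset.mem_univ j), Function.update_self]
    congr 1
    refine Finset.prod_congr rfl fun i hi => ?_
    rw [Function.update_of_ne (Finset.ne_of_mem_erase hi)]
  simp only [h2]
  have h3 := ((((hasDerivAt_id (x j)).const_mul (p j : ℝ)).sin).ofReal_comp.mul_const
    (∏ i ∈ Finset.univ.erase j, (Real.sin ((p i : ℝ) * x i) : ℂ))).const_mul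
      (a p * Complex.exp (-Complex.I * (pnorm2 p : ℂ) * (t : ℂ)))
  refine h3.congr_deriv ?_
  simp only [id]
  push_cast
  ring

lemma sum_nsq_signed : ∑ q ∈ signedSet F, nsq q * ‖signedCoeff a q‖ ^ 2 =
    (1 / 2) ^ n * ∑ p ∈ F, pnorm2 p * ‖a p‖ ^ 2 := by
  rw [sum_signedSet, Finset.mul_sum]
  refine Finset.sum_congr rfl fun p _ => ?_
  simp only [nsq_signed, signedCoeff_signed, norm_mul, mul_pow, norm_signCoeff_sq,
    Fintype.card_fin,
    Finset.sum_const, Finset.card_univ, nsmul_eq_mul]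
  simp only [Fintype.card_pi, Fintype.card_units_int, Finset.prod_const, Finset.card_univ,
    Fintype.card_fin]
  have : (1 / 2 : ℝ) ^ n = 2 ^ n * (1 / 4) ^ n := by rw [← mul_pow]; norm_num
  rw [this]; push_cast; ring

lemma sum_diag_signed : ∑ q ∈ signedSet F, (∑ j, (q j : ℝ)) ^ 2 * ‖signedCoeff a q‖ ^ 2 =
    ∑ q ∈ signedSet F, nsq q * ‖signedCoeff a q‖ ^ 2 := by
  rw [sum_nsq_signed, sum_signedSet, Finset.mul_sum]
  refine Finset.sum_congr rfl fun p _ => ?_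
  simp only [signedCoeff_signed, norm_mul, mul_pow, norm_signCoeff_sq,
    Fintype.card_fin]
  rw [← Finset.sum_mul, sum_signed_sq]
  have : (1 / 2 : ℝ) ^ n = 2 ^ n * (1 / 4) ^ n := by rw [← mul_pow]; norm_num
  rw [this]; ring

/-- The boundary observation of a finite sine sum near the vertex, in the time interval `[0, T]`. -/
noncomputable def observation (ε T : ℝ) : ℝ :=
  ∫ t in Set.Icc 0 T, ∑ j, ∫ x in faceNear ε j Real.pi, ‖dSum F a j (glue j Real.pi x) t‖ ^ 2

lemma exists_high_frequency_observability_sine (hn : 0 < n) {T ε : ℝ} (hT : 0 < T)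
    (hε : 0 < ε) (hεπ : ε < Real.pi) :
    ∃ K : ℝ, 0 < K ∧ ∃ C : ℝ, 0 < C ∧ ∀ (F : Finset (Fin n → ℕ+)) (a : (Fin n → ℕ+) → ℂ),
      (∀ p ∈ F, K ^ 2 ≤ pnorm2 p) →
      ∑ p ∈ F, pnorm2 p * ‖a p‖ ^ 2 ≤ C * observation F a ε T := by
  obtain ⟨K, hK, C, hC, h⟩ := exists_high_frequency_observability hn hT hε hεπ
  refine ⟨K, hK, 2 ^ n * C, by positivity, fun F a hF => ?_⟩
  have h1 := h (signedSet F) (signedCoeff a) (fun q hq => by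
    obtain ⟨z, hz, rfl⟩ := Finset.mem_image.1 hq
    rw [nsq_signed]
    exact hF _ (Finset.mem_product.1 hz).1) (sum_diag_signed F a)
    (fun j x t hx => waveSum_signed_eq_zero F a j x t hx)
  simp only [sum_nsq_signed, waveSum_coordCoeff_signed] at h1
  have h2 : ∑ p ∈ F, pnorm2 p * ‖a p‖ ^ 2 =
      2 ^ n * ((1 / 2) ^ n * ∑ p ∈ F, pnorm2 p * ‖a p‖ ^ 2) := by
    rw [← mul_assoc, ← mul_pow]; norm_num
  rw [h2, mul_assoc]
  exact mul_le_mul_of_nonneg_left h1 (by positivity)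

end SineExpansion

section Face

variable {n : ℕ}

/-- The squared length of a tuple of positive integers, as a natural number. -/
def normSqNat (p : Fin n → ℕ+) : ℕ := ∑ j, (p j : ℕ) ^ 2

lemma pnorm2_eq (p : Fin n → ℕ+) : pnorm2 p = normSqNat p := by
  simp [pnorm2, normSqNat]

lemma pnorm2_nonneg (p : Fin n → ℕ+) : 0 ≤ pnorm2 p := by
  rw [pnorm2_eq]; exact Nat.cast_nonneg _

/-- The normal derivative of a sine sum on the face `x_j = π`; the `j`-th coordinate of the argument
is the time. -/
noncomputable def faceFun (F : Finset (Fin n → ℕ+)) (a : (Fin n → ℕ+) → ℂ) (j : Fin n)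
    (y : Fin n → ℝ) : ℂ := dSum F a j (Function.update y j Real.pi) (y j)

lemma faceFun_glue (F : Finset (Fin n → ℕ+)) (a : (Fin n → ℕ+) → ℂ) (j : Fin n) (t : ℝ)
    (x : {i : Fin n // i ≠ j} → ℝ) :
    faceFun F a j (glue j t x) = dSum F a j (glue j Real.pi x) t := by
  rw [faceFun, update_glue, glue_self]

/-- The space-time frequencies of `faceFun`. -/
def faceFreq (j : Fin n) (z : (Fin n → ℕ+) × ({i : Fin n // i ≠ j} → ℤˣ)) : Fin n → ℤ :=
  fun i => if h : i = j then -(normSqNat z.1 : ℤ)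
    else signed (fun i : {i : Fin n // i ≠ j} => z.1 i) z.2 ⟨i, h⟩

/-- The Fourier coefficients of `faceFun`. -/
noncomputable def faceCoeff (a : (Fin n → ℕ+) → ℂ) (j : Fin n)
    (z : (Fin n → ℕ+) × ({i : Fin n // i ≠ j} → ℤˣ)) : ℂ :=
  a z.1 * ((z.1 j : ℝ) : ℂ) * (Real.cos ((z.1 j : ℝ) * Real.pi) : ℂ) * signCoeff z.2

lemma faceFreq_injective (j : Fin n) : Function.Injective (faceFreq j) := by
  rintro ⟨p, s⟩ ⟨p', s'⟩ h
  have h1 : ∀ i : {i : Fin n // i ≠ j}, signed (fun i : {i : Fin n // i ≠ j} => p i) s i =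
      signed (fun i : {i : Fin n // i ≠ j} => p' i) s' i := by
    intro i
    have := congrFun h i
    simpa [faceFreq, i.2] using this
  have h2 := signed_injective (a₁ := (_, s)) (a₂ := (_, s')) (funext h1)
  obtain ⟨h3, h4⟩ := Prod.mk.inj h2
  have h5 : normSqNat p = normSqNat p' := by
    have := congrFun h j
    simpa [faceFreq] using this
  have h6 : p j = p' j := by
    rw [normSqNat, normSqNat, Fintype.sum_eq_add_sum_subtype_ne _ j,
      Fintype.sum_eq_add_sum_subtype_ne _ j] at h5
    have h7 : ∀ i : {i : Fin n // i ≠ j}, p i = p' i := fun i => congrFun h3 i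
    simp only [h7, add_left_inj] at h5
    exact PNat.coe_injective (Nat.pow_left_injective two_ne_zero h5)
  refine Prod.ext (funext fun i => ?_) h4
  by_cases hi : i = j
  · exact hi ▸ h6
  · exact congrFun h3 ⟨i, hi⟩

lemma expo_faceFreq (j : Fin n) (z : (Fin n → ℕ+) × ({i : Fin n // i ≠ j} → ℤˣ))
    (y : Fin n → ℝ) : expo (faceFreq j z) y =
      Complex.exp (-Complex.I * (pnorm2 z.1 : ℂ) * (y j : ℂ)) *
        expo (signed (fun i : {i : Fin n // i ≠ j} => z.1 i) z.2)
          (fun i : {i : Fin n // i ≠ j} => y i) := by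
  rw [expo, expo, ← Complex.exp_add, Fintype.sum_eq_add_sum_subtype_ne _ j, mul_add]
  congr 2
  · simp [faceFreq, pnorm2_eq]; ring
  · congr 1
    refine Finset.sum_congr rfl fun i _ => ?_
    simp [faceFreq, i.2]

lemma faceFun_eq_sum (F : Finset (Fin n → ℕ+)) (a : (Fin n → ℕ+) → ℂ) (j : Fin n)
    (y : Fin n → ℝ) :
    faceFun F a j y = ∑ z ∈ F ×ˢ (Finset.univ : Finset ({i : Fin n // i ≠ j} → ℤˣ)),
      faceCoeff a j z * expo (faceFreq j z) y := by
  rw [Finset.sum_product, faceFun, dSum]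
  refine Finset.sum_congr rfl fun p _ => ?_
  have h1 : ∏ i ∈ Finset.univ.erase j,
      (Real.sin ((p i : ℝ) * Function.update y j Real.pi i) : ℂ) =
      ∏ i : {i : Fin n // i ≠ j}, (Real.sin ((p i : ℝ) * y i) : ℂ) := by
    rw [Finset.prod_subtype (Finset.univ.erase j) (p := fun i => i ≠ j) (by simp)]
    refine Finset.prod_congr rfl fun i _ => ?_
    rw [Function.update_of_ne i.2]
  rw [h1, prod_sin_eq_sum (fun i : {i : Fin n // i ≠ j} => p i) (fun i => y i), Finset.mul_sum,
    Function.update_self]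
  refine Finset.sum_congr rfl fun s _ => ?_
  rw [expo_faceFreq, faceCoeff]
  ring

lemma norm_faceCoeff_sq (a : (Fin n → ℕ+) → ℂ) (j : Fin n)
    (z : (Fin n → ℕ+) × ({i : Fin n // i ≠ j} → ℤˣ)) :
    ‖faceCoeff a j z‖ ^ 2 =
      (1 / 4) ^ Fintype.card {i : Fin n // i ≠ j} * ((z.1 j : ℝ) ^ 2 * ‖a z.1‖ ^ 2) := by
  have hc : (Real.cos ((z.1 j : ℝ) * Real.pi)) ^ 2 = 1 := by
    have := Real.sin_sq_add_cos_sq ((z.1 j : ℝ) * Real.pi)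
    rw [Real.sin_nat_mul_pi] at this
    linarith
  rw [faceCoeff, norm_mul, norm_mul, norm_mul, mul_pow, mul_pow, mul_pow, norm_signCoeff_sq,
    Complex.norm_real, Complex.norm_real, Real.norm_eq_abs, Real.norm_eq_abs, sq_abs, sq_abs, hc]
  ring

lemma sum_norm_faceCoeff_sq (F : Finset (Fin n → ℕ+)) (a : (Fin n → ℕ+) → ℂ) (j : Fin n) :
    ∑ z ∈ F ×ˢ (Finset.univ : Finset ({i : Fin n // i ≠ j} → ℤˣ)), ‖faceCoeff a j z‖ ^ 2 =
      (1 / 2) ^ Fintype.card {i : Fin n // i ≠ j} * ∑ p ∈ F, (p j : ℝ) ^ 2 * ‖a p‖ ^ 2 := by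
  have h2 : (1 / 2 : ℝ) ^ Fintype.card {i : Fin n // i ≠ j} =
      2 ^ Fintype.card {i : Fin n // i ≠ j} * (1 / 4) ^ Fintype.card {i : Fin n // i ≠ j} := by
    rw [← mul_pow]; norm_num
  rw [Finset.sum_product, Finset.mul_sum]
  refine Finset.sum_congr rfl fun p _ => ?_
  simp only [norm_faceCoeff_sq, Finset.sum_const, Finset.card_univ, nsmul_eq_mul,
    Fintype.card_pi, Fintype.card_units_int, Finset.prod_const]
  rw [h2]
  push_cast
  ring

@[fun_prop]
lemma continuous_dSum {X : Type*} [TopologicalSpace X] (F : Finset (Fin n → ℕ+))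
    (a : (Fin n → ℕ+) → ℂ) (j : Fin n) {f : X → Fin n → ℝ} {g : X → ℝ} (hf : Continuous f)
    (hg : Continuous g) : Continuous fun z => dSum F a j (f z) (g z) := by
  unfold dSum
  fun_prop

lemma continuous_faceFun (F : Finset (Fin n → ℕ+)) (a : (Fin n → ℕ+) → ℂ) (j : Fin n) :
    Continuous (faceFun F a j) := by
  unfold faceFun
  have : Continuous fun y : Fin n → ℝ => Function.update y j Real.pi :=
    continuous_id.update j continuous_const
  fun_prop

lemma cyl_subset_Icc {ε T : ℝ} (j : Fin n) (σ : ℝ) :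
    cyl j (Set.Icc 0 T) (faceNear ε j σ) ⊆
      Set.Icc (fun i => if i = j then 0 else 0) (fun i => if i = j then T else Real.pi) := by
  intro y hy
  rw [mem_cyl] at hy
  have h2 := faceNear_subset_Icc ε j σ hy.2
  refine ⟨fun i => ?_, fun i => ?_⟩ <;> by_cases h : i = j
  · subst h; simpa using hy.1.1
  · simpa [h] using h2.1 ⟨i, h⟩
  · subst h; simpa using hy.1.2
  · simpa [h] using h2.2 ⟨i, h⟩

lemma integrableOn_faceFun (F : Finset (Fin n → ℕ+)) (a : (Fin n → ℕ+) → ℂ) (j : Fin n)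
    (ε T σ : ℝ) :
    IntegrableOn (fun y => ‖faceFun F a j y‖ ^ 2) (cyl j (Set.Icc 0 T) (faceNear ε j σ)) := by
  have := continuous_faceFun F a j
  exact ((by fun_prop : Continuous fun y => ‖faceFun F a j y‖ ^ 2).continuousOn.integrableOn_compact
    isCompact_Icc).mono_set (cyl_subset_Icc j σ)

/-- The observed power at time `t`. -/
noncomputable def observedPower (F : Finset (Fin n → ℕ+)) (a : (Fin n → ℕ+) → ℂ) (ε t : ℝ) : ℝ :=
  ∑ j, ∫ x in faceNear ε j Real.pi, ‖dSum F a j (glue j Real.pi x) t‖ ^ 2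

lemma integrableOn_observedPower_summand (F : Finset (Fin n → ℕ+)) (a : (Fin n → ℕ+) → ℂ)
    (ε T : ℝ) (j : Fin n) :
    IntegrableOn (fun t => ∫ x in faceNear ε j Real.pi, ‖dSum F a j (glue j Real.pi x) t‖ ^ 2)
      (Set.Icc 0 T) := by
  have h := integrableOn_cyl_iff.1 (integrableOn_faceFun F a j ε T Real.pi)
  rw [IntegrableOn, Measure.volume_eq_prod, ← Measure.prod_restrict] at h
  have h' := h.integral_prod_left
  simp only [faceFun_glue] at h'
  exact h'

lemma integrableOn_observedPower (F : Finset (Fin n → ℕ+)) (a : (Fin n → ℕ+) → ℂ) (ε T : ℝ) :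
    IntegrableOn (observedPower F a ε) (Set.Icc 0 T) :=
  integrable_finsetSum _ fun j _ => integrableOn_observedPower_summand F a ε T j

lemma observedPower_nonneg (F : Finset (Fin n → ℕ+)) (a : (Fin n → ℕ+) → ℂ) (ε t : ℝ) :
    0 ≤ observedPower F a ε t :=
  Finset.sum_nonneg fun _ _ => integral_nonneg fun _ => sq_nonneg _

lemma observation_eq (F : Finset (Fin n → ℕ+)) (a : (Fin n → ℕ+) → ℂ) (ε T : ℝ) :
    observation F a ε T =
      ∑ j, ∫ y in cyl j (Set.Icc 0 T) (faceNear ε j Real.pi), ‖faceFun F a j y‖ ^ 2 := by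
  rw [observation, integral_finsetSum _ fun j _ => integrableOn_observedPower_summand F a ε T j]
  refine Finset.sum_congr rfl fun j _ => ?_
  rw [setIntegral_cyl (integrableOn_faceFun F a j ε T Real.pi)]
  simp only [faceFun_glue]

/-- The trace of a sine sum is controlled by its energy. -/
lemma observation_le (F : Finset (Fin n → ℕ+)) (a : (Fin n → ℕ+) → ℂ) (ε : ℝ) {T : ℝ}
    (hT : T ≤ Real.pi) :
    observation F a ε T ≤ (2 * Real.pi) ^ n * ∑ p ∈ F, pnorm2 p * ‖a p‖ ^ 2 := by
  have hπ := Real.pi_pos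
  rw [observation_eq]
  have h : ∀ j ∈ Finset.univ, ∫ y in cyl j (Set.Icc 0 T) (faceNear ε j Real.pi),
      ‖faceFun F a j y‖ ^ 2 ≤ (2 * Real.pi) ^ n * ∑ p ∈ F, (p j : ℝ) ^ 2 * ‖a p‖ ^ 2 := by
    intro j _
    have hsub : cyl j (Set.Icc 0 T) (faceNear ε j Real.pi) ⊆ cube (Fin n) Real.pi := by
      refine (cyl_subset_Icc j _).trans (Set.Icc_subset_Icc (fun i => ?_) (fun i => ?_))
      · simp [hπ.le]
      · dsimp only; split_ifs <;> simp [hT]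
    set S := F ×ˢ (Finset.univ : Finset ({i : Fin n // i ≠ j} → ℤˣ))
    have h1 := integral_norm_sq_expo_le hsub (S.image (faceFreq j))
      (Function.extend (faceFreq j) (faceCoeff a j) 0)
    simp only [Finset.sum_image (faceFreq_injective j).injOn,
      (faceFreq_injective j).extend_apply] at h1
    simp only [faceFun_eq_sum]
    refine h1.trans ?_
    rw [Fintype.card_fin]
    refine mul_le_mul_of_nonneg_left ?_ (by positivity)
    rw [sum_norm_faceCoeff_sq]
    refine mul_le_of_le_one_left (Finset.sum_nonneg fun _ _ => by positivity)
      (pow_le_one₀ (by norm_num) (by norm_num))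
  refine (Finset.sum_le_sum h).trans_eq ?_
  rw [← Finset.mul_sum, Finset.sum_comm]
  simp only [← Finset.sum_mul, pnorm2]

/-- Observability for sine sums with frequencies on a fixed sphere. -/
lemma exists_eigenspace_observability (hn : 0 < n) (N : ℕ) {T ε : ℝ} (hT : 0 < T)
    (hε : 0 < ε) (hεπ : ε < Real.pi) :
    ∃ C : ℝ, 0 < C ∧ ∀ (F : Finset (Fin n → ℕ+)) (a : (Fin n → ℕ+) → ℂ),
      (∀ p ∈ F, normSqNat p = N) →
      ∑ p ∈ F, pnorm2 p * ‖a p‖ ^ 2 ≤ C * observation F a ε T := by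
  have hπ := Real.pi_pos
  have hn1 : (1 : ℝ) ≤ n := by exact_mod_cast hn
  obtain ⟨r, hr, hrT, hrε⟩ : ∃ r : ℝ, 0 < r ∧ r ≤ T / 2 ∧ n * (4 * r) ≤ ε := by
    refine ⟨min (T / 2) (ε / (4 * n)), by positivity, min_le_left _ _, ?_⟩
    calc n * (4 * min (T / 2) (ε / (4 * n))) ≤ n * (4 * (ε / (4 * n))) := by
          gcongr; exact min_le_right _ _
      _ = ε := by field_simp
  have h4r : 4 * r ≤ ε := by nlinarith
  set Λ : Finset (Fin n → ℤ) := Finset.Icc (fun _ => -(N : ℤ)) (fun _ => (N : ℤ))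
  obtain ⟨c, hc, hobs⟩ := Observable.union_finset (ι := Fin n) (M := Λ.card) (r' := r / 2) (r := r)
    (c := 1) (by linarith) (by linarith) (by linarith) one_pos
  have hΛ := hobs ∅ Λ le_rfl (Observable.empty _ _)
  set j : Fin n := ⟨0, hn⟩
  set m := Fintype.card {i : Fin n // i ≠ j}
  refine ⟨(N + 1) * 2 ^ m / c, by positivity, fun F a hF => ?_⟩
  set S := F ×ˢ (Finset.univ : Finset ({i : Fin n // i ≠ j} → ℤˣ))
  have hmem : ∀ z ∈ S, faceFreq j z ∈ (∅ ∪ ↑Λ : Set (Fin n → ℤ)) := by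
    intro z hz
    have hz1 := hF z.1 (Finset.mem_product.1 hz).1
    right
    rw [Finset.mem_coe, Finset.mem_Icc, Pi.le_def, Pi.le_def, ← forall_and]
    intro i
    rw [← abs_le]
    by_cases h : i = j
    · simp [faceFreq, h, hz1]
    · have h1 : ((z.1 i : ℕ)) ≤ N := by
        rw [← hz1, normSqNat]
        refine le_trans (Nat.le_self_pow two_ne_zero _) ?_
        exact Finset.single_le_sum (f := fun j => (z.1 j : ℕ) ^ 2) (fun _ _ => Nat.zero_le _)
          (Finset.mem_univ i)
      simp only [faceFreq, h, dite_false, signed]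
      rw [abs_mul]
      rcases Int.units_eq_one_or (z.2 ⟨i, h⟩) with hs | hs <;> simp [hs] <;> exact_mod_cast h1
  have h1 := hΛ.le_integral_translate
    (fun i => if i = j then T / 2 else Real.pi - 2 * r) S (faceFreq j)
    (faceFreq_injective j).injOn hmem (faceCoeff a j)
  simp only [← faceFun_eq_sum, S, sum_norm_faceCoeff_sq] at h1
  have hsub : Set.Icc (fun i => (if i = j then T / 2 else Real.pi - 2 * r) - r)
      (fun i => (if i = j then T / 2 else Real.pi - 2 * r) + r) ⊆
      cyl j (Set.Icc 0 T) (faceNear ε j Real.pi) := by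
    intro y hy
    have hl := hy.1
    have hu := hy.2
    have hj1 := hl j
    have hj2 := hu j
    simp only [if_true] at hj1 hj2
    have hi : ∀ i : {i : Fin n // i ≠ j}, Real.pi - 3 * r ≤ y i ∧ y i ≤ Real.pi - r := by
      intro i
      have h1 := hl i
      have h2 := hu i
      simp only [i.2, if_false] at h1 h2
      exact ⟨by linarith, by linarith⟩
    refine mem_cyl.2 ⟨⟨by linarith, by linarith⟩, fun i => ⟨?_, ?_⟩, ?_⟩
    · have := (hi i).1; linarith
    · have := (hi i).2; linarith
    · have h2 := Finset.sum_le_sum fun i (_ : i ∈ Finset.univ) => (hi i).1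
      have hcard : (Fintype.card {i : Fin n // i ≠ j} : ℝ) = n - 1 := by
        rw [Fintype.card_subtype_compl, Fintype.card_fin, Fintype.card_unique,
          Nat.cast_sub hn, Nat.cast_one]
      simp only [Finset.sum_const, Finset.card_univ, hcard, nsmul_eq_mul] at h2
      nlinarith
  have h2 := h1.trans (setIntegral_mono_set (integrableOn_faceFun F a j ε T Real.pi)
    (Filter.Eventually.of_forall fun _ => sq_nonneg _) hsub.eventuallyLE)
  have h3 : ∫ y in cyl j (Set.Icc 0 T) (faceNear ε j Real.pi), ‖faceFun F a j y‖ ^ 2 ≤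
      observation F a ε T := by
    rw [observation_eq]
    exact Finset.single_le_sum
      (f := fun j => ∫ y in cyl j (Set.Icc 0 T) (faceNear ε j Real.pi), ‖faceFun F a j y‖ ^ 2)
      (fun _ _ => integral_nonneg fun _ => sq_nonneg _) (Finset.mem_univ j)
  have h4 : ∑ p ∈ F, pnorm2 p * ‖a p‖ ^ 2 ≤
      (N + 1) * ∑ p ∈ F, (p j : ℝ) ^ 2 * ‖a p‖ ^ 2 := by
    rw [Finset.mul_sum]
    refine Finset.sum_le_sum fun p hp => ?_
    rw [pnorm2_eq, hF p hp, ← mul_assoc]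
    refine mul_le_mul_of_nonneg_right ?_ (sq_nonneg _)
    have h5 : (1 : ℝ) ≤ p j := by exact_mod_cast (one_le : 1 ≤ p j)
    have h6 : (0 : ℝ) ≤ N := Nat.cast_nonneg N
    nlinarith [one_le_pow₀ h5 (n := 2)]
  have h6 : (2 : ℝ) ^ m * (1 / 2) ^ m = 1 := by rw [← mul_pow]; norm_num
  set R := ∑ p ∈ F, (p j : ℝ) ^ 2 * ‖a p‖ ^ 2
  calc ∑ p ∈ F, pnorm2 p * ‖a p‖ ^ 2 ≤ (N + 1) * R := h4
    _ = (N + 1) * 2 ^ m / c * (c * ((1 / 2) ^ m * R)) := by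
        have h7 : (N + 1) * 2 ^ m / c * (c * ((1 / 2) ^ m * R)) =
            (N + 1) * (2 ^ m * (1 / 2) ^ m) * R := by
          field_simp
        rw [h7, h6, mul_one]
    _ ≤ _ := mul_le_mul_of_nonneg_left (h2.trans h3) (by positivity)

end Face

section LowFrequency

variable {n : ℕ}

/-- Observability for sine sums avoiding the spheres of squared radius in `A`. -/
def ObservableOff (n : ℕ) (ε : ℝ) (A : Finset ℕ) (T : ℝ) : Prop :=
  ∃ C : ℝ, 0 < C ∧ ∀ (F : Finset (Fin n → ℕ+)) (a : (Fin n → ℕ+) → ℂ),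
    (∀ p ∈ F, normSqNat p ∉ A) →
    ∑ p ∈ F, pnorm2 p * ‖a p‖ ^ 2 ≤ C * observation F a ε T

lemma integrableOn_norm_sq_dSum (F : Finset (Fin n → ℕ+)) (a : (Fin n → ℕ+) → ℂ) (j : Fin n)
    (ε t : ℝ) :
    IntegrableOn (fun x => ‖dSum F a j (glue j Real.pi x) t‖ ^ 2) (faceNear ε j Real.pi) := by
  have hc : Continuous fun x : {i : Fin n // i ≠ j} → ℝ => glue j Real.pi x :=
    (continuous_glue j).comp
      (by fun_prop : Continuous fun x : {i : Fin n // i ≠ j} → ℝ => (Real.pi, x))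
  exact ((by fun_prop : Continuous fun x => ‖dSum F a j (glue j Real.pi x) t‖ ^ 2
    ).continuousOn.integrableOn_compact isCompact_Icc).mono_set (faceNear_subset_Icc ε j Real.pi)

lemma observedPower_le {F F₁ F₂ : Finset (Fin n → ℕ+)} {a a₁ a₂ : (Fin n → ℕ+) → ℂ}
    {t t₁ t₂ : ℝ} (ε : ℝ)
    (h : ∀ j x, ‖dSum F a j x t‖ ^ 2 ≤
      2 * ‖dSum F₁ a₁ j x t₁‖ ^ 2 + 2 * ‖dSum F₂ a₂ j x t₂‖ ^ 2) :
    observedPower F a ε t ≤ 2 * observedPower F₁ a₁ ε t₁ + 2 * observedPower F₂ a₂ ε t₂ := by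
  simp only [observedPower, Finset.mul_sum, ← Finset.sum_add_distrib]
  refine Finset.sum_le_sum fun j _ => ?_
  have i1 := (integrableOn_norm_sq_dSum F₁ a₁ j ε t₁).const_mul 2
  have i2 := (integrableOn_norm_sq_dSum F₂ a₂ j ε t₂).const_mul 2
  rw [← integral_const_mul, ← integral_const_mul, ← integral_add i1 i2]
  exact integral_mono (integrableOn_norm_sq_dSum F a j ε t) (i1.add i2) fun x => h j _

lemma observation_mono (F : Finset (Fin n → ℕ+)) (a : (Fin n → ℕ+) → ℂ) (ε : ℝ) {T T' : ℝ}
    (h : T ≤ T') : observation F a ε T ≤ observation F a ε T' :=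
  setIntegral_mono_set (integrableOn_observedPower F a ε T')
    (Filter.Eventually.of_forall fun t => observedPower_nonneg F a ε t)
    (Set.Icc_subset_Icc_right h).eventuallyLE

lemma ObservableOff.mono {ε : ℝ} {A : Finset ℕ} {T T' : ℝ} (h : ObservableOff n ε A T)
    (hT : T ≤ T') : ObservableOff n ε A T' := by
  obtain ⟨C, hC, h⟩ := h
  exact ⟨C, hC, fun F a hF => (h F a hF).trans
    (mul_le_mul_of_nonneg_left (observation_mono F a ε hT) hC.le)⟩

lemma dSum_shift (F : Finset (Fin n → ℕ+)) (a : (Fin n → ℕ+) → ℂ) (N : ℕ) (s : ℝ) (j : Fin n)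
    (x : Fin n → ℝ) (t : ℝ) :
    dSum F (fun p => a p *
      (1 - Complex.exp (Complex.I * (((((N : ℤ) - normSqNat p : ℤ) : ℝ) * s : ℝ) : ℂ)))) j x t =
      dSum F a j x t - Complex.exp (((N * s : ℝ) : ℂ) * Complex.I) * dSum F a j x (t + s) := by
  simp only [dSum, Finset.mul_sum, ← Finset.sum_sub_distrib]
  refine Finset.sum_congr rfl fun p _ => ?_
  have h : Complex.exp (Complex.I * (((((N : ℤ) - normSqNat p : ℤ) : ℝ) * s : ℝ) : ℂ)) *
      Complex.exp (-Complex.I * (pnorm2 p : ℂ) * (t : ℂ)) =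
      Complex.exp (((N * s : ℝ) : ℂ) * Complex.I) *
      Complex.exp (-Complex.I * (pnorm2 p : ℂ) * ((t + s : ℝ) : ℂ)) := by
    rw [← Complex.exp_add, ← Complex.exp_add, pnorm2_eq]
    congr 1
    push_cast
    ring
  have e : ∀ A B C D G : ℂ, A * (1 - B) * C * D * G = (A * C * D - A * (B * C) * D) * G := by
    intros; ring
  rw [mul_assoc _ _ (∏ i ∈ _, _), e, h]
  ring

lemma integral_observedPower_add_le (F : Finset (Fin n → ℕ+)) (a : (Fin n → ℕ+) → ℂ) (ε : ℝ)
    {T s T' : ℝ} (hT : 0 ≤ T) (hs : 0 ≤ s) (h : T + s ≤ T') :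
    ∫ t in Set.Icc 0 T, observedPower F a ε (t + s) ≤ observation F a ε T' := by
  rw [integral_Icc_eq_integral_Ioc, ← intervalIntegral.integral_of_le hT,
    intervalIntegral.integral_comp_add_right (fun t => observedPower F a ε t), zero_add,
    intervalIntegral.integral_of_le (by linarith), ← integral_Icc_eq_integral_Ioc]
  exact setIntegral_mono_set (integrableOn_observedPower F a ε T')
    (Filter.Eventually.of_forall fun t => observedPower_nonneg F a ε t)
    (Set.Icc_subset_Icc hs h).eventuallyLE

lemma integrableOn_observedPower_add (F : Finset (Fin n → ℕ+)) (a : (Fin n → ℕ+) → ℂ)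
    (ε T s : ℝ) : IntegrableOn (fun t => observedPower F a ε (t + s)) (Set.Icc 0 T) := by
  have : (fun t => observedPower F a ε (t + s)) =
      observedPower F (fun p => a p * Complex.exp (-Complex.I * (pnorm2 p : ℂ) * (s : ℂ))) ε := by
    ext t
    have h (j : Fin n) (x : Fin n → ℝ) : dSum F a j x (t + s) =
        dSum F (fun p => a p * Complex.exp (-Complex.I * (pnorm2 p : ℂ) * (s : ℂ))) j x t := by
      refine Finset.sum_congr rfl fun p _ => ?_
      rw [Complex.ofReal_add, mul_add, Complex.exp_add]
      ring
    simp only [observedPower, h]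
  rw [this]
  exact integrableOn_observedPower _ _ _ _

/-- Time differencing costs only a constant factor in the observation. -/
lemma observation_shift_le (F : Finset (Fin n → ℕ+)) (a : (Fin n → ℕ+) → ℂ) (ε : ℝ) (N : ℕ)
    {T s T' : ℝ} (hT : 0 ≤ T) (hs : 0 ≤ s) (h : T + s ≤ T') :
    observation F (fun p => a p *
      (1 - Complex.exp (Complex.I * (((((N : ℤ) - normSqNat p : ℤ) : ℝ) * s : ℝ) : ℂ)))) ε T ≤
      4 * observation F a ε T' := by
  have i1 := (integrableOn_observedPower F a ε T).const_mul 2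
  have i2 := (integrableOn_observedPower_add F a ε T s).const_mul 2
  have h1 := observation_mono F a ε (by linarith : T ≤ T')
  have h2 := integral_observedPower_add_le F a ε hT hs h
  have h3 : observation F (fun p => a p *
      (1 - Complex.exp (Complex.I * (((((N : ℤ) - normSqNat p : ℤ) : ℝ) * s : ℝ) : ℂ)))) ε T ≤
      ∫ t in Set.Icc 0 T, (2 * observedPower F a ε t + 2 * observedPower F a ε (t + s)) := by
    refine integral_mono (integrableOn_observedPower _ _ _ _) (i1.add i2) fun t => ?_
    refine observedPower_le ε fun j x => ?_
    rw [dSum_shift]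
    refine (norm_sub_sq_le_two _ _).trans_eq ?_
    rw [norm_mul, Complex.norm_exp_ofReal_mul_I, one_mul]
  rw [integral_add i1 i2, integral_const_mul, integral_const_mul] at h3
  have h4 : ∫ t in Set.Icc 0 T, observedPower F a ε t = observation F a ε T := rfl
  rw [h4] at h3
  linarith

/-- Adding the frequencies of one sphere preserves observability, up to an increase of the time. -/
lemma ObservableOff.of_insert (hn : 0 < n) {ε : ℝ} (hε : 0 < ε) (hεπ : ε < Real.pi)
    {A : Finset ℕ} {N : ℕ} {T T' : ℝ} (hT : 0 < T) (hTT : T < T') (hTπ : T' ≤ Real.pi)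
    (h : ObservableOff n ε (insert N A) T) : ObservableOff n ε A T' := by
  obtain ⟨C, hC, h⟩ := h
  obtain ⟨C₁, hC₁, h₁⟩ := exists_eigenspace_observability hn N (hT.trans hTT) hε hεπ
  obtain ⟨η, hη, hηm⟩ := exists_pos_le_integral_one_sub_exp (sub_pos.2 hTT)
  have hπ := Real.pi_pos
  set D : ℝ := (T' - T) * (4 * C) / η with hD
  have hD0 : 0 < D := div_pos (mul_pos (sub_pos.2 hTT) (by positivity)) hη
  set P : ℝ := (2 * Real.pi) ^ n
  have hP : 0 < P := by positivity
  refine ⟨D + C₁ * (2 + 2 * (P * D)), by positivity, fun F a hF => ?_⟩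
  set F' := F.filter fun p => normSqNat p ≠ N
  set F₀ := F.filter fun p => normSqNat p = N
  set O := observation F a ε T'
  have hsplit : ∀ g : (Fin n → ℕ+) → ℂ, ∑ p ∈ F₀, g p + ∑ p ∈ F', g p = ∑ p ∈ F, g p := fun g =>
    Finset.sum_filter_add_sum_filter_not _ _ _
  have hsplit' : ∀ g : (Fin n → ℕ+) → ℝ, ∑ p ∈ F₀, g p + ∑ p ∈ F', g p = ∑ p ∈ F, g p := fun g =>
    Finset.sum_filter_add_sum_filter_not _ _ _
  have hhigh : ∑ p ∈ F', pnorm2 p * ‖a p‖ ^ 2 ≤ D * O := by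
    have key := sum_filter_le_of_shift_bound (sub_pos.2 hTT) hηm F
      (fun p => pnorm2 p * ‖a p‖ ^ 2) (fun p => mul_nonneg (pnorm2_nonneg p) (sq_nonneg _))
      (fun p => (N : ℤ) - normSqNat p) (C * (4 * O)) (fun s hs => by
        set w : (Fin n → ℕ+) → ℂ := fun p => a p *
          (1 - Complex.exp (Complex.I * (((((N : ℤ) - normSqNat p : ℤ) : ℝ) * s : ℝ) : ℂ)))
        have hw0 : ∀ p ∈ F₀, w p = 0 := by
          intro p hp
          have : normSqNat p = N := (Finset.mem_filter.1 hp).2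
          simp [w, this]
        have e1 : observation F' w ε T = observation F w ε T := by
          simp only [observation]
          congr! 7 with t j _ x
          simp only [dSum]
          rw [← hsplit]
          rw [Finset.sum_eq_zero (s := F₀) fun p hp => by rw [hw0 p hp]; ring, zero_add]
        have e2 : ∑ p ∈ F', pnorm2 p * ‖w p‖ ^ 2 = ∑ p ∈ F, pnorm2 p * ‖w p‖ ^ 2 := by
          rw [← hsplit', Finset.sum_eq_zero (s := F₀) fun p hp => by rw [hw0 p hp]; simp, zero_add]
        have h2 := h F' w (fun p hp => by
          have := Finset.mem_filter.1 hp
          rw [Finset.mem_insert, not_or]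
          exact ⟨this.2, hF p this.1⟩)
        rw [e1, e2] at h2
        have h3 := observation_shift_le F a ε N hT.le hs.1 (by linarith [hs.2] : T + s ≤ T')
        have h4 := h2.trans (mul_le_mul_of_nonneg_left h3 hC.le)
        refine (le_of_eq ?_).trans h4
        refine Finset.sum_congr rfl fun p _ => ?_
        simp only [w]
        rw [norm_mul, mul_pow]
        ring)
    have e3 : F.filter (fun p => (N : ℤ) - normSqNat p ≠ 0) = F' := by
      refine Finset.filter_congr fun p _ => ?_
      rw [sub_ne_zero, ne_eq, ne_eq, Nat.cast_inj, eq_comm]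
    rw [e3] at key
    rw [hD, div_mul_eq_mul_div, le_div_iff₀ hη]
    linarith
  have hlow : ∑ p ∈ F₀, pnorm2 p * ‖a p‖ ^ 2 ≤ C₁ * (2 * O + 2 * (P * (D * O))) := by
    refine (h₁ F₀ a fun p hp => (Finset.mem_filter.1 hp).2).trans
      (mul_le_mul_of_nonneg_left ?_ hC₁.le)
    have i1 := (integrableOn_observedPower F a ε T').const_mul 2
    have i2 := (integrableOn_observedPower F' a ε T').const_mul 2
    have h3 : observation F₀ a ε T' ≤
        ∫ t in Set.Icc 0 T', (2 * observedPower F a ε t + 2 * observedPower F' a ε t) := by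
      refine integral_mono (integrableOn_observedPower _ _ _ _) (i1.add i2) fun t => ?_
      refine observedPower_le ε fun j x => ?_
      have : dSum F₀ a j x t = dSum F a j x t - dSum F' a j x t := by
        rw [eq_sub_iff_add_eq]; exact hsplit _
      rw [this]
      exact norm_sub_sq_le_two _ _
    rw [integral_add i1 i2, integral_const_mul, integral_const_mul] at h3
    have h4 := (observation_le F' a ε hTπ).trans (mul_le_mul_of_nonneg_left hhigh hP.le)
    have e4 : ∫ t in Set.Icc 0 T', observedPower F a ε t = O := rfl
    have e5 : ∫ t in Set.Icc 0 T', observedPower F' a ε t = observation F' a ε T' := rfl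
    rw [e4, e5] at h3
    linarith
  rw [← hsplit']
  calc _ ≤ C₁ * (2 * O + 2 * (P * (D * O))) + D * O := add_le_add hlow hhigh
    _ = _ := by ring

lemma ObservableOff.empty_of (hn : 0 < n) {ε : ℝ} (hε : 0 < ε) (hεπ : ε < Real.pi)
    (A : Finset ℕ) : ∀ {T T' : ℝ}, 0 < T → T < T' → T' ≤ Real.pi →
      ObservableOff n ε A T → ObservableOff n ε ∅ T' := by
  induction A using Finset.induction_on with
  | empty => exact fun _ h _ hA => hA.mono h.le
  | insert N A _ ih =>
    intro T T' hT hTT hTπ hA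
    exact ih (T := (T + T') / 2) (by linarith) (by linarith) hTπ
      (hA.of_insert hn hε hεπ hT (by linarith) (by linarith))

/-- Boundary observability for all finite sine sums. -/
lemma observableOff_empty (hn : 0 < n) {ε T : ℝ} (hT : 0 < T) (hε : 0 < ε)
    (hεπ : ε < Real.pi) : ObservableOff n ε ∅ T := by
  have hπ := Real.pi_pos
  set T₀ := min T Real.pi
  have hT₀ : 0 < T₀ := lt_min hT hπ
  obtain ⟨K, hK, C, hC, h⟩ :=
    exists_high_frequency_observability_sine hn (half_pos hT₀) hε hεπ
  have hbase : ObservableOff n ε (Finset.range ⌈K ^ 2⌉₊) (T₀ / 2) := by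
    refine ⟨C, hC, fun F a hF => h F a fun p hp => ?_⟩
    have h1 := hF p hp
    rw [Finset.mem_range, not_lt] at h1
    rw [pnorm2_eq]
    exact Nat.ceil_le.1 h1
  exact (ObservableOff.empty_of hn hε hεπ _ (half_pos hT₀) (half_lt_self hT₀)
    (min_le_right _ _) hbase).mono (min_le_left _ _)

end LowFrequency

end Observability

/-- Proposition 2 (boundary observability near the vertex `(π,…,π)`):
`Σ_p |p|²|v_p|² ≤ c Σ_{j,σ} ∫₀ᵀ ∫_{G_{j,σ}} |∂v/∂x_j|²`, where on the face
`{x_j = σ}` (`σ ∈ {0,π}`) one integrates over the remaining coordinates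
`x' ∈ (0,π)^{n−1}` satisfying `σ + Σᵢ x'ᵢ > nπ − ε`. -/
theorem stmt0 (n : ℕ) (hn : 2 ≤ n) (T : ℝ) (hT : 0 < T) (ε : ℝ)
    (hε : 0 < ε) (hε' : ε < Real.pi) :
    ∃ c : ℝ, 0 < c ∧ ∀ v : (Fin n → ℕ+) →₀ ℂ,
      (v.sum fun p a => pnorm2 p * ‖a‖ ^ 2) ≤
        c * ∑ j : Fin n, ∑ σ ∈ ({0, Real.pi} : Finset ℝ),
          ∫ t in Set.Ioc (0 : ℝ) T,
            ∫ x' in {x' : {i : Fin n // i ≠ j} → ℝ |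
                (∀ i, x' i ∈ Set.Ioo 0 Real.pi) ∧
                (n : ℝ) * Real.pi - ε < σ + ∑ i, x' i},
              ‖dV v j (fun i => if h : i = j then σ else x' ⟨i, h⟩) t‖ ^ 2 := by
  obtain ⟨c, hc, h⟩ := observableOff_empty (by omega : 0 < n) hT hε hε'
  refine ⟨c, hc, fun v => (h v.support v (by simp)).trans (mul_le_mul_of_nonneg_left ?_ hc.le)⟩
  rw [observation,
    integral_finsetSum _ fun j _ => integrableOn_observedPower_summand v.support v ε T j]
  refine Finset.sum_le_sum fun j _ => ?_
  rw [integral_Icc_eq_integral_Ioc]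
  exact Finset.single_le_sum (f := fun σ : ℝ => ∫ t in Set.Ioc (0 : ℝ) T,
    ∫ x' in faceNear ε j σ, ‖dV v j (glue j σ x') t‖ ^ 2)
    (fun σ _ => integral_nonneg fun t => integral_nonneg fun x => sq_nonneg _) (by simp)
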